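/- arXiv:1711.08396 — 8 statements merged into one kernel-verified Lean document; each statement's English description precedes it below -/
import Mathlib

section
/- Let n ≥ 1 be an integer. There is a constant C = C(n) > 0 such that for all real B ≥ 2, the number of primitive vectors x ∈ ℤ^{n+1} with max_i |x_i| ≤ B satisfies |#{x ∈ ℤ^{n+1} : x primitive, max_i |x_i| ≤ B} − (2^{n+1}/ζ(n+1))·B^{n+1}| ≤ C·B^n·(log B)^{[1/n]}, where ζ is the Riemann zeta function. -/
open Finset in
theorem card_filter_dvd_Icc_neg (N d : ℕ) (hd : 0 < d) :
    #{z ∈ Icc (-(N : ℤ)) N | (d : ℤ) ∣ z} = 2 * (N / d) + 1 := by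
  have hd' : (0 : ℤ) < d := by exact_mod_cast hd
  have h : {z ∈ Icc (-(N : ℤ)) N | (d : ℤ) ∣ z} =
      (Icc (-((N / d : ℕ) : ℤ)) ((N / d : ℕ) : ℤ)).image (fun k => (d : ℤ) * k) := by
    ext z
    simp only [mem_filter, mem_Icc, mem_image, Int.natCast_ediv]
    constructor
    · rintro ⟨⟨h1, h2⟩, k, rfl⟩
      refine ⟨k, ⟨?_, ?_⟩, rfl⟩
      · rw [neg_le, Int.le_ediv_iff_mul_le hd']
        linarith
      · rw [Int.le_ediv_iff_mul_le hd']
        linarith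
    · rintro ⟨k, ⟨h1, h2⟩, rfl⟩
      rw [neg_le, Int.le_ediv_iff_mul_le hd'] at h1
      rw [Int.le_ediv_iff_mul_le hd'] at h2
      exact ⟨⟨by linarith, by linarith⟩, dvd_mul_right _ _⟩
  rw [h, card_image_of_injective _ (mul_right_injective₀ hd'.ne'), Int.card_Icc]
  omega

open Finset ArithmeticFunction in
/-- Möbius inversion for the number of primitive integer vectors in a cube. -/
theorem card_primitive_vectors (m N : ℕ) :
    (#{x ∈ Fintype.piFinset (fun _ : Fin m => Icc (-(N : ℤ)) N) |
        univ.gcd (fun i => (x i).natAbs) = 1} : ℤ) =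
      ∑ d ∈ Icc 1 N, moebius d * ((2 * (N / d : ℕ) + 1) ^ m - 1) := by
  set box := Fintype.piFinset (fun _ : Fin m => Icc (-(N : ℤ)) N) with hbox
  have h0 : (0 : Fin m → ℤ) ∈ box := by simp [hbox]
  have hset : {x ∈ box | univ.gcd (fun i => (x i).natAbs) = 1} =
      {x ∈ box.erase 0 | univ.gcd (fun i => (x i).natAbs) = 1} := by
    ext x
    simp only [mem_filter, mem_erase]
    constructor
    · rintro ⟨h1, h2⟩
      refine ⟨⟨?_, h1⟩, h2⟩
      rintro rfl
      have : univ.gcd (fun i : Fin m => ((0 : Fin m → ℤ) i).natAbs) = 0 := by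
        rw [Finset.gcd_eq_zero_iff]; simp
      omega
    · rintro ⟨⟨_, h1⟩, h2⟩
      exact ⟨h1, h2⟩
  rw [hset, card_filter]
  push_cast
  have hind : ∀ x ∈ box.erase 0,
      (if univ.gcd (fun i => (x i).natAbs) = 1 then (1 : ℤ) else 0) =
        ∑ d ∈ Icc 1 N, if ∀ i, (d : ℤ) ∣ x i then moebius d else 0 := by
    intro x hx
    obtain ⟨hx0, hxb⟩ := mem_erase.1 hx
    obtain ⟨j, hj⟩ : ∃ j, x j ≠ 0 := by
      by_contra! h
      exact hx0 (funext h)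
    have hjN : (x j).natAbs ≤ N := by
      have := mem_Icc.1 (Fintype.mem_piFinset.1 hxb j)
      omega
    rw [← sum_filter]
    have hdiv : {d ∈ Icc 1 N | ∀ i, ((d : ℕ) : ℤ) ∣ x i} =
        (univ.gcd (fun i => (x i).natAbs)).divisors := by
      ext d
      simp only [mem_filter, mem_Icc, Nat.mem_divisors, Finset.dvd_gcd_iff, mem_univ,
        forall_true_left, Int.natCast_dvd, ne_eq, Finset.gcd_eq_zero_iff]
      constructor
      · rintro ⟨_, h⟩
        exact ⟨h, fun h' => hj (by simpa using h' j)⟩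
      · rintro ⟨h, _⟩
        have hp : 0 < (x j).natAbs := Int.natAbs_pos.2 hj
        exact ⟨⟨Nat.pos_of_dvd_of_pos (h j) hp, (Nat.le_of_dvd hp (h j)).trans hjN⟩, h⟩
    rw [hdiv, ← coe_mul_zeta_apply, moebius_mul_coe_zeta, one_apply]
  rw [sum_congr rfl hind, sum_comm]
  refine sum_congr rfl fun d hd => ?_
  have hd1 : 0 < d := (mem_Icc.1 hd).1
  rw [← sum_filter, sum_const, nsmul_eq_mul, mul_comm]
  congr 1
  have hS : {x ∈ box.erase 0 | ∀ i, (d : ℤ) ∣ x i} =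
      (Fintype.piFinset
        (fun _ : Fin m => {z ∈ Icc (-(N : ℤ)) N | (d : ℤ) ∣ z})).erase 0 := by
    ext x
    simp only [hbox, mem_filter, mem_erase, Fintype.mem_piFinset, forall_and]
    tauto
  rw [hS, card_erase_of_mem (by simp), Fintype.card_piFinset]
  simp only [card_filter_dvd_Icc_neg N d hd1, prod_const, card_univ, Fintype.card_fin]
  rw [Nat.cast_sub (Nat.one_le_pow _ _ (by omega))]
  push_cast
  rfl

open ArithmeticFunction in
theorem hasSum_moebius_div_pow (k : ℕ) (hk : 1 < k) :
    HasSum (fun d : ℕ => (moebius d : ℝ) / (d : ℝ) ^ k)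
      (∑' j : ℕ, (1 : ℝ) / (j + 1) ^ k)⁻¹ := by
  have hre : 1 < ((k : ℂ)).re := by simpa using hk
  have hz : riemannZeta k = ((∑' j : ℕ, (1 : ℝ) / (j + 1) ^ k : ℝ) : ℂ) := by
    have hs : Summable (fun j : ℕ => (1 : ℝ) / (j : ℝ) ^ k) :=
      Real.summable_one_div_nat_pow.2 hk
    have h1 : ∑' j : ℕ, (1 : ℝ) / (j : ℝ) ^ k = ∑' j : ℕ, (1 : ℝ) / (j + 1) ^ k := by
      rw [hs.tsum_eq_zero_add]
      simp [show k ≠ 0 by omega]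
    rw [zeta_nat_eq_tsum_of_gt_one hk, ← h1]
    push_cast
    rfl
  have hL := LSeries_zeta_mul_Lseries_moebius hre
  rw [LSeries_zeta_eq_riemannZeta hre, hz] at hL
  have hsum := (LSeriesSummable_moebius_iff.2 hre).LSeriesHasSum
  rw [eq_inv_of_mul_eq_one_right hL] at hsum
  rw [← Complex.hasSum_ofReal]
  have hk0 : (k : ℂ) ≠ 0 := by exact_mod_cast (show k ≠ 0 by omega)
  rw [Complex.ofReal_inv]
  refine (congrArg (HasSum · _) (funext fun d => ?_)).mpr hsum
  rw [LSeries.term_of_ne_zero' hk0]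
  simp

open Finset ArithmeticFunction in
theorem abs_sum_moebius_div_pow_sub_le (n : ℕ) (hn : 1 ≤ n) (N : ℕ) (hN : 1 ≤ N) :
    |∑ d ∈ Icc 1 N, (moebius d : ℝ) / (d : ℝ) ^ (n + 1) -
      (∑' j : ℕ, (1 : ℝ) / (j + 1) ^ (n + 1))⁻¹| ≤ 2 / (N : ℝ) ^ n := by
  have hT := (hasSum_moebius_div_pow (n + 1) (by omega)).tendsto_sum_nat
  have hN0 : (0 : ℝ) < N := by exact_mod_cast hN
  have hIcc : ∑ d ∈ Icc 1 N, (moebius d : ℝ) / (d : ℝ) ^ (n + 1) =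
      ∑ d ∈ range (N + 1), (moebius d : ℝ) / (d : ℝ) ^ (n + 1) := by
    rw [range_eq_Ico, sum_eq_sum_Ico_succ_bot (by omega)]
    simp
    rfl
  rw [hIcc, abs_sub_comm]
  refine le_of_tendsto (hT.sub_const _).abs ?_
  filter_upwards [Filter.eventually_ge_atTop (N + 1)] with M hM
  rw [← sum_Ico_eq_sub _ hM]
  calc |∑ d ∈ Ico (N + 1) M, (moebius d : ℝ) / (d : ℝ) ^ (n + 1)|
      ≤ ∑ d ∈ Ico (N + 1) M, |(moebius d : ℝ) / (d : ℝ) ^ (n + 1)| := abs_sum_le_sum_abs _ _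
    _ ≤ ∑ d ∈ Ico (N + 1) M, ((N : ℝ) ^ (n - 1))⁻¹ * ((d : ℝ) ^ 2)⁻¹ := by
        refine sum_le_sum fun d hd => ?_
        have hd := (mem_Ico.1 hd).1
        have hNd : (N : ℝ) ≤ d := by exact_mod_cast (by omega : N ≤ d)
        have hmu : |(moebius d : ℝ)| ≤ 1 := by exact_mod_cast abs_moebius_le_one
        rw [abs_div, abs_of_nonneg (by positivity : (0 : ℝ) ≤ (d : ℝ) ^ (n + 1)), ← mul_inv,
          ← one_div]
        have : (d : ℝ) ^ (n + 1) = (d : ℝ) ^ (n - 1) * (d : ℝ) ^ 2 := by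
          rw [← pow_add]; congr 1; omega
        rw [this]
        have : (0 : ℝ) < d := hN0.trans_le hNd
        gcongr
    _ ≤ ((N : ℝ) ^ (n - 1))⁻¹ * (2 / (N + 1)) := by
        rw [← mul_sum]
        gcongr
        exact sum_Ioo_inv_sq_le N M
    _ ≤ ((N : ℝ) ^ (n - 1))⁻¹ * (2 / N) := by gcongr; linarith
    _ = 2 / (N : ℝ) ^ n := by
        obtain ⟨k, rfl⟩ : ∃ k, n = k + 1 := ⟨n - 1, by omega⟩
        simp only [Nat.add_sub_cancel]
        field_simp
        ring

theorem one_le_two_mul_log_pow (B : ℝ) (hB : 2 ≤ B) (k : ℕ) (hk : k ≤ 1) :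
    1 ≤ 2 * Real.log B ^ k := by
  have : Real.log 2 ≤ Real.log B := Real.log_le_log (by norm_num) hB
  have := Real.log_two_gt_d9
  interval_cases k
  · norm_num
  · linarith

open Finset in
theorem sum_inv_pow_le_log_pow (n : ℕ) (hn : 1 ≤ n) (B : ℝ) (hB : 2 ≤ B) :
    ∑ d ∈ Icc 1 ⌊B⌋₊, ((d : ℝ) ^ n)⁻¹ ≤ 3 * Real.log B ^ (1 / n : ℕ) := by
  rcases hn.eq_or_lt with rfl | hn
  · have h := harmonic_floor_le_one_add_log B (by linarith)
    have hlog := one_le_two_mul_log_pow B hB 1 le_rfl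
    rw [harmonic_eq_sum_Icc] at h
    push_cast at h
    simp only [pow_one, Nat.div_self one_pos] at hlog ⊢
    linarith
  · rw [Nat.div_eq_of_lt hn, pow_zero]
    calc ∑ d ∈ Icc 1 ⌊B⌋₊, ((d : ℝ) ^ n)⁻¹
        ≤ ∑ d ∈ Ioo 0 (⌊B⌋₊ + 1), ((d : ℝ) ^ 2)⁻¹ := by
          rw [show Ioo 0 (⌊B⌋₊ + 1) = Icc 1 ⌊B⌋₊ by ext; simp; omega]
          refine sum_le_sum fun d hd => ?_
          have : (1 : ℝ) ≤ d := by exact_mod_cast (mem_Icc.1 hd).1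
          exact inv_anti₀ (by positivity) (pow_le_pow_right₀ this hn)
      _ ≤ 2 / ((0 : ℕ) + 1) := sum_Ioo_inv_sq_le 0 _
      _ ≤ 3 * 1 := by norm_num

theorem abs_odd_pow_sub_le (n q : ℕ) (t : ℝ) (ht : 1 ≤ t) (h1 : q ≤ t) (h2 : t < q + 1) :
    |((2 * (q : ℝ) + 1) ^ (n + 1) - 1) - (2 * t) ^ (n + 1)| ≤
      ((n + 1) * 3 ^ n + 1) * t ^ n := by
  have hq : (0 : ℝ) ≤ q := by positivity
  have h := abs_pow_sub_pow_le (2 * (q : ℝ) + 1) (2 * t) (n + 1)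
  have hu : |(2 * (q : ℝ) + 1) - 2 * t| ≤ 1 := by rw [abs_le]; constructor <;> linarith
  have hm : max |2 * (q : ℝ) + 1| |2 * t| ≤ 3 * t := by
    rw [abs_of_nonneg (by positivity), abs_of_nonneg (by positivity)]
    exact max_le (by linarith) (by linarith)
  have hm' : max |2 * (q : ℝ) + 1| |2 * t| ^ n ≤ (3 * t) ^ n :=
    pow_le_pow_left₀ (le_max_of_le_left (abs_nonneg _)) hm n
  have h3 : |(2 * (q : ℝ) + 1) ^ (n + 1) - (2 * t) ^ (n + 1)| ≤ (n + 1) * 3 ^ n * t ^ n := by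
    refine h.trans ?_
    rw [Nat.add_sub_cancel, mul_assoc _ (3 ^ n), ← mul_pow]
    push_cast
    calc _ ≤ 1 * ((n : ℝ) + 1) * (3 * t) ^ n := by gcongr
      _ = _ := by ring
  have h4 : 1 ≤ t ^ n := one_le_pow₀ ht
  rw [show (2 * (q : ℝ) + 1) ^ (n + 1) - 1 - (2 * t) ^ (n + 1) =
    ((2 * (q : ℝ) + 1) ^ (n + 1) - (2 * t) ^ (n + 1)) + -1 by ring]
  refine (abs_add_le _ _).trans ?_
  rw [abs_neg, abs_one]
  linarith

open Finset in
theorem natCard_primitive_vectors (m : ℕ) (B : ℝ) (hB : 0 ≤ B) :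
    Nat.card {x : Fin m → ℤ //
        univ.gcd (fun i => (x i).natAbs) = 1 ∧ ∀ i, |(x i : ℝ)| ≤ B} =
      #{x ∈ Fintype.piFinset (fun _ : Fin m => Icc (-(⌊B⌋₊ : ℤ)) ⌊B⌋₊) |
        univ.gcd (fun i => (x i).natAbs) = 1} := by
  refine Nat.subtype_card _ fun x => ?_
  rw [mem_filter, and_comm, Fintype.mem_piFinset]
  refine and_congr_right fun _ => forall_congr' fun i => ?_
  rw [← Int.cast_abs, ← Nat.cast_natAbs, ← Nat.le_floor_iff hB, mem_Icc]
  omega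

/-- Counting primitive integer vectors of sup-norm at most `B`:
`#{x ∈ ℤ^{n+1} : gcd(x) = 1, max |x_i| ≤ B} = (2^{n+1}/ζ(n+1))·B^{n+1}
  + O(B^n (log B)^{[1/n]})`,
where `ζ(n+1) = ∑_{k≥1} 1/k^{n+1}` and `[1/n]` is `1` for `n = 1` and `0` for `n ≥ 2`. -/
theorem primitive_vector_count (n : ℕ) (hn : 1 ≤ n) :
    ∃ C : ℝ, 0 < C ∧ ∀ B : ℝ, 2 ≤ B →
      |(Nat.card {x : Fin (n + 1) → ℤ //
            Finset.univ.gcd (fun i => (x i).natAbs) = 1 ∧ ∀ i, |(x i : ℝ)| ≤ B} : ℝ) -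
          (2 ^ (n + 1) / (∑' k : ℕ, (1 : ℝ) / (k + 1) ^ (n + 1))) * B ^ (n + 1)|
        ≤ C * B ^ n * Real.log B ^ (1 / n : ℕ) := by
  refine ⟨3 * ((n + 1) * 3 ^ n + 1) + 2 ^ (2 * n + 3), by positivity, fun B hB => ?_⟩
  have hB0 : (0 : ℝ) < B := by linarith
  set N := ⌊B⌋₊
  set Z := ∑' k : ℕ, (1 : ℝ) / (k + 1) ^ (n + 1)
  set L := Real.log B ^ (1 / n : ℕ)
  set S := ∑ d ∈ Finset.Icc 1 N, (ArithmeticFunction.moebius d : ℝ) / (d : ℝ) ^ (n + 1)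
  have hN : 1 ≤ N := Nat.le_floor (by push_cast; linarith)
  have hNB : (N : ℝ) ≤ B := Nat.floor_le hB0.le
  have hN0 : (0 : ℝ) < N := by exact_mod_cast hN
  have hBN : B ≤ 2 * N := by
    have h1 : B < N + 1 := Nat.lt_floor_add_one B
    have h2 : (1 : ℝ) ≤ N := by exact_mod_cast hN
    linarith
  have hL : 1 ≤ 2 * L := one_le_two_mul_log_pow B hB _ (Nat.div_le_self 1 n)
  have hcount := card_primitive_vectors (n + 1) N
  rw [natCard_primitive_vectors _ B hB0.le]
  have hcountR := congrArg (Int.cast : ℤ → ℝ) hcount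
  simp only [Int.cast_sum, Int.cast_mul, Int.cast_sub, Int.cast_pow, Int.cast_add, Int.cast_one,
    Int.cast_ofNat, Int.cast_natCast] at hcountR
  rw [hcountR]
  have hmain : |∑ d ∈ Finset.Icc 1 N,
      (ArithmeticFunction.moebius d : ℝ) * ((2 * ((N / d : ℕ) : ℝ) + 1) ^ (n + 1) - 1) -
        2 ^ (n + 1) * B ^ (n + 1) * S| ≤ ((n + 1) * 3 ^ n + 1) * B ^ n * (3 * L) := by
    rw [Finset.mul_sum, ← Finset.sum_sub_distrib]
    refine (Finset.abs_sum_le_sum_abs _ _).trans ?_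
    calc _ ≤ ∑ d ∈ Finset.Icc 1 N, ((n + 1) * 3 ^ n + 1) * B ^ n * ((d : ℝ) ^ n)⁻¹ := by
          refine Finset.sum_le_sum fun d hd => ?_
          obtain ⟨hd1, hdN⟩ := Finset.mem_Icc.1 hd
          have hd0 : (0 : ℝ) < d := by exact_mod_cast hd1
          have hdB : (d : ℝ) ≤ B := le_trans (by exact_mod_cast hdN) hNB
          have hfl : N / d = ⌊B / d⌋₊ := (Nat.floor_div_natCast B d).symm
          have h := abs_odd_pow_sub_le n (N / d) (B / d) ((one_le_div hd0).2 hdB)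
            (hfl ▸ Nat.floor_le (by positivity)) (hfl ▸ Nat.lt_floor_add_one _)
          have hmu : |(ArithmeticFunction.moebius d : ℝ)| ≤ 1 := by
            exact_mod_cast ArithmeticFunction.abs_moebius_le_one
          calc _ = |(ArithmeticFunction.moebius d : ℝ)| *
                |((2 * ((N / d : ℕ) : ℝ) + 1) ^ (n + 1) - 1) - (2 * (B / d)) ^ (n + 1)| := by
                rw [← abs_mul, mul_pow, div_pow]
                congr 1
                ring
            _ ≤ 1 * (((n + 1) * 3 ^ n + 1) * (B / d) ^ n) := by gcongr
            _ = _ := by rw [div_pow]; ring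
      _ ≤ _ := by
          rw [← Finset.mul_sum]
          gcongr
          exact sum_inv_pow_le_log_pow n hn B hB
  have htail : |2 ^ (n + 1) * B ^ (n + 1) * S - 2 ^ (n + 1) / Z * B ^ (n + 1)| ≤
      2 ^ (2 * n + 3) * B ^ n * L := by
    rw [show 2 ^ (n + 1) * B ^ (n + 1) * S - 2 ^ (n + 1) / Z * B ^ (n + 1) =
      2 ^ (n + 1) * B ^ (n + 1) * (S - Z⁻¹) by rw [div_eq_mul_inv]; ring, abs_mul,
      abs_of_nonneg (by positivity : (0 : ℝ) ≤ 2 ^ (n + 1) * B ^ (n + 1))]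
    have hBn : B ≤ B ^ n := le_self_pow₀ (by linarith) (by omega)
    calc _ ≤ 2 ^ (n + 1) * B ^ (n + 1) * (2 / (N : ℝ) ^ n) := by
          gcongr
          exact abs_sum_moebius_div_pow_sub_le n hn N hN
      _ = 2 ^ (n + 2) * B * (B / N) ^ n := by rw [div_pow]; ring
      _ ≤ 2 ^ (n + 2) * B ^ n * 2 ^ n := by
          gcongr
          rwa [div_le_iff₀ hN0]
      _ = 2 ^ (2 * n + 2) * B ^ n * 1 := by ring
      _ ≤ 2 ^ (2 * n + 2) * B ^ n * (2 * L) := by gcongr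
      _ = _ := by ring
  refine (abs_sub_le _ (2 ^ (n + 1) * B ^ (n + 1) * S) _).trans ?_
  linarith
end

section
/- Let n ≥ 1 be an integer. There is a constant C = C(n) > 0 with the following property. For every real B > 1, every integer Q ≥ 1, and every set Υ̂ ⊆ (ℤ/Qℤ)^{n+1} consisting of unimodular vectors and stable under multiplication by units of ℤ/Qℤ, one has | #{x ∈ ℤ^{n+1} : x primitive, max_i |x_i| ≤ B, (x mod Q) ∈ Υ̂} − (2^{n+1}/ζ(n+1)) · #Υ̂ · B^{n+1} / (Q^{n+1} ∏_{p ∣ Q, p prime}(1 − p^{−(n+1)})) | ≤ C · (Q/φ(Q)) · #Υ̂ · ( B + (B/Q)^n (log B)^{[1/n]} ). -/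
open ArithmeticFunction in
/-- The Möbius sum over integers coprime to `Q`: the Euler product of `1 / ζ(m)` with the factors
at the primes dividing `Q` removed. -/
lemma hasSum_moebius_coprime (m Q : ℕ) (hm : 2 ≤ m) (hQ : Q ≠ 0) :
    HasSum (fun d : ℕ => if d.Coprime Q then (moebius d : ℝ) / (d : ℝ) ^ m else 0)
      (1 / ((∑' k : ℕ, (1 : ℝ) / (k + 1) ^ m) *
        ∏ p ∈ Q.primeFactors, (1 - 1 / (p : ℝ) ^ m))) := by
  have : NeZero Q := ⟨hQ⟩
  set χ : DirichletCharacter ℂ Q := 1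
  have hs : 1 < (m : ℂ).re := by
    rw [Complex.natCast_re]; exact_mod_cast hm
  have hs1 : (m : ℂ) ≠ 1 := by
    intro h; rw [h] at hs; simp at hs
  have hinv := DirichletCharacter.LSeries.mul_mu_eq_one χ hs
  have htriv : DirichletCharacter.LFunction χ m = _ :=
    DirichletCharacter.LFunctionTrivChar_eq_mul_riemannZeta hs1
  rw [← DirichletCharacter.LFunction_eq_LSeries χ hs, htriv] at hinv
  have hzeta : riemannZeta m = ((∑' k : ℕ, (1 : ℝ) / (k + 1) ^ m : ℝ) : ℂ) := by
    rw [zeta_eq_tsum_one_div_nat_add_one_cpow hs]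
    push_cast
    simp [Complex.cpow_natCast]
  have hterm : LSeries.term (fun d : ℕ => χ d * (moebius d : ℂ)) m = fun d : ℕ =>
      ((if d.Coprime Q then (moebius d : ℝ) / (d : ℝ) ^ m else 0 : ℝ) : ℂ) := by
    ext d
    rcases eq_or_ne d 0 with rfl | hd
    · simp
    · rw [LSeries.term_of_ne_zero hd]
      by_cases h : d.Coprime Q
      · have : χ d = 1 := MulChar.one_apply ((ZMod.isUnit_iff_coprime d Q).mpr h)
        rw [if_pos h]
        simp [this]
      · have : χ d = 0 := MulChar.map_nonunit _ (mt (ZMod.isUnit_iff_coprime d Q).mp h)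
        rw [if_neg h]
        simp [this]
  have hsum : LSeriesSummable (fun d : ℕ => χ d * (moebius d : ℂ)) m :=
    DirichletCharacter.LSeriesSummable_mul χ (LSeriesSummable_moebius_iff.mpr hs)
  have hH := hsum.hasSum
  rw [hterm] at hH
  have hval : ∑' d : ℕ,
      ((if d.Coprime Q then (moebius d : ℝ) / (d : ℝ) ^ m else 0 : ℝ) : ℂ) =
      ((1 / ((∑' k : ℕ, (1 : ℝ) / (k + 1) ^ m) *
        ∏ p ∈ Q.primeFactors, (1 - 1 / (p : ℝ) ^ m)) : ℝ) : ℂ) := by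
    rw [← hterm]
    change LSeries _ _ = _
    rw [hzeta] at hinv
    rw [Complex.ofReal_div, Complex.ofReal_one, Complex.ofReal_mul]
    refine eq_one_div_of_mul_eq_one_right ?_
    rw [← hinv]
    congr 1
    rw [mul_comm]
    push_cast
    simp [Complex.cpow_neg]
  rw [hval] at hH
  exact_mod_cast hH

/-- Integers of absolute value at most `B` that are divisible by `d` and congruent to `a` mod `Q`
form a residue class modulo `d * Q`. -/
lemma abs_card_dvd_residue_sub_le (d Q : ℕ) (hd : d ≠ 0) (hQ : Q ≠ 0) (hdQ : d.Coprime Q)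
    (a : ZMod Q) (B : ℝ) (hB : 0 ≤ B) :
    |((((Finset.Icc (-⌊B⌋) ⌊B⌋).filter
      (fun x : ℤ => (d : ℤ) ∣ x ∧ (x : ZMod Q) = a)).card : ℕ) : ℝ) - 2 * B / (d * Q)| ≤ 2 := by
  obtain ⟨b, rfl⟩ := ZMod.intCast_surjective a
  obtain ⟨u, v, huv⟩ := Nat.isCoprime_iff_coprime.mpr hdQ
  have key : ∀ x : ℤ, ((d : ℤ) ∣ x ∧ (x : ZMod Q) = (b : ZMod Q)) ↔
      x ≡ b * (u * d) [ZMOD ((d * Q : ℕ) : ℤ)] := by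
    intro x
    rw [ZMod.intCast_eq_intCast_iff, Nat.cast_mul,
      ← Int.modEq_and_modEq_iff_modEq_mul (by simpa using hdQ)]
    have h1 : b * (u * d) ≡ 0 [ZMOD d] := by
      rw [Int.modEq_zero_iff_dvd]; exact ⟨b * u, by ring⟩
    have h2 : b * (u * d) ≡ b [ZMOD Q] := by
      rw [Int.modEq_iff_dvd]; exact ⟨b * v, by linear_combination (-b) * huv⟩
    rw [← Int.modEq_zero_iff_dvd]
    exact ⟨fun h => ⟨h.1.trans h1.symm, h.2.trans h2.symm⟩,
      fun h => ⟨h.1.trans h1, h.2.trans h2⟩⟩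
  set r : ℕ := d * Q with hr
  have hr0 : 0 < r := Nat.pos_of_ne_zero (mul_ne_zero hd hQ)
  set w := b * (u * d)
  set F := ⌊B⌋ with hF
  have hF0 : 0 ≤ F := Int.floor_nonneg.mpr hB
  have hIcc : Finset.Icc (-F) F = Finset.Ioc (-F - 1) F := by
    ext x; simp only [Finset.mem_Icc, Finset.mem_Ioc]; omega
  rw [Finset.filter_congr (fun x _ => key x), hIcc]
  have hcard := Int.Ioc_filter_modEq_card (-F - 1) F (r := (r : ℤ)) (by exact_mod_cast hr0) w
  have hrq : (0 : ℚ) < r := by exact_mod_cast hr0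
  set α : ℚ := (F - w) / ((r : ℤ) : ℚ) with hα
  set β : ℚ := (((-F - 1 : ℤ) : ℚ) - w) / ((r : ℤ) : ℚ) with hβ
  have hαβ : β ≤ α := by
    rw [hα, hβ]
    have : (0 : ℚ) ≤ F := by exact_mod_cast hF0
    gcongr
    linarith
  rw [max_eq_left (sub_nonneg.mpr (Int.floor_le_floor hαβ))] at hcard
  set c := ((Finset.Ioc (-F - 1) F).filter (fun x => x ≡ w [ZMOD (r : ℤ)])).card
  have hdiff : α - β = (2 * F + 1) / r := by
    rw [hα, hβ]; push_cast; field_simp; ring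
  have hc1 : (c : ℚ) ≤ (2 * F + 1) / r + 1 := by
    have h1 := Int.floor_le α
    have h2 := Int.lt_floor_add_one β
    have h3 : (c : ℚ) = (⌊α⌋ : ℚ) - ⌊β⌋ := by exact_mod_cast hcard
    linarith
  have hc2 : (2 * F + 1) / r - 1 ≤ (c : ℚ) := by
    have h1 := Int.floor_le β
    have h2 := Int.lt_floor_add_one α
    have h3 : (c : ℚ) = (⌊α⌋ : ℚ) - ⌊β⌋ := by exact_mod_cast hcard
    linarith
  have hc1' : (c : ℝ) ≤ (2 * F + 1) / r + 1 := by exact_mod_cast hc1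
  have hc2' : (2 * F + 1) / r - 1 ≤ (c : ℝ) := by exact_mod_cast hc2
  have hrr : (1 : ℝ) ≤ r := by exact_mod_cast hr0
  have e1 : |(2 * (F : ℝ) + 1) / r - 2 * B / r| ≤ 1 := by
    rw [← sub_div, abs_div, abs_of_pos (by linarith : (0 : ℝ) < r), div_le_one (by linarith)]
    refine le_trans ?_ hrr
    have h1 := Int.floor_le B
    have h2 := Int.lt_floor_add_one B
    rw [abs_le]; constructor <;> linarith
  have hrc : (d : ℝ) * Q = r := by rw [hr]; push_cast; rfl
  rw [hrc]
  rw [abs_le] at e1 ⊢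
  constructor <;> linarith [e1.1, e1.2]

/-- If all factors are within `δ` of `t`, then the product is within `(t + δ) ^ m - t ^ m` of
`t ^ m`. -/
lemma abs_prod_sub_pow_le {ι : Type*} (s : Finset ι) (c : ι → ℝ) (t δ : ℝ) (ht : 0 ≤ t)
    (hδ : 0 ≤ δ) (hc : ∀ i ∈ s, |c i - t| ≤ δ) :
    |∏ i ∈ s, c i - t ^ s.card| ≤ (t + δ) ^ s.card - t ^ s.card := by
  classical
  induction s using Finset.induction_on with
  | empty => simp
  | insert a s ha ih =>
    rw [Finset.prod_insert ha, Finset.card_insert_of_notMem ha]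
    have ih' := ih fun i hi => hc i (Finset.mem_insert_of_mem hi)
    have hca := hc a (Finset.mem_insert_self a s)
    have hca' : |c a| ≤ t + δ := by
      rw [abs_le] at hca ⊢; constructor <;> linarith [hca.1, hca.2]
    calc |c a * ∏ i ∈ s, c i - t ^ (s.card + 1)|
        = |c a * (∏ i ∈ s, c i - t ^ s.card) + t ^ s.card * (c a - t)| := by congr 1; ring
      _ ≤ |c a| * |∏ i ∈ s, c i - t ^ s.card| + t ^ s.card * |c a - t| := by
        refine (abs_add_le _ _).trans ?_
        rw [abs_mul, abs_mul, abs_of_nonneg (pow_nonneg ht _)]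
      _ ≤ (t + δ) * ((t + δ) ^ s.card - t ^ s.card) + t ^ s.card * δ := by gcongr
      _ = _ := by ring

/-- `(t + 2) ^ (n + 1) - t ^ (n + 1)` is `O(t ^ n + 1)`. -/
lemma add_two_pow_sub_pow_le (n : ℕ) (t : ℝ) (ht : 0 ≤ t) :
    (t + 2) ^ (n + 1) - t ^ (n + 1) ≤ 2 * (n + 1) * 4 ^ n * (t ^ n + 1) := by
  have h1 : (t + 2) ^ (n + 1) - t ^ (n + 1) ≤ 2 * (n + 1) * (t + 2) ^ n := by
    induction n with
    | zero => simp
    | succ n ih =>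
      have h2 : t ^ (n + 1) ≤ (t + 2) ^ (n + 1) := by gcongr; linarith
      have h3 := mul_le_mul_of_nonneg_right ih (by linarith : 0 ≤ t + 2)
      push_cast
      calc (t + 2) ^ (n + 1 + 1) - t ^ (n + 1 + 1)
          = ((t + 2) ^ (n + 1) - t ^ (n + 1)) * (t + 2) + 2 * t ^ (n + 1) := by ring
        _ ≤ 2 * (n + 1) * (t + 2) ^ n * (t + 2) + 2 * (t + 2) ^ (n + 1) := by linarith
        _ = _ := by ring
  have h2 : (t + 2) ^ n ≤ 4 ^ n * (t ^ n + 1) := by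
    rcases le_total t 1 with h | h
    · calc (t + 2) ^ n ≤ 4 ^ n * 1 := by rw [mul_one]; gcongr; linarith
        _ ≤ _ := by gcongr; linarith [pow_nonneg ht n]
    · calc (t + 2) ^ n ≤ (4 * t) ^ n := by gcongr; linarith
        _ = 4 ^ n * t ^ n := by ring
        _ ≤ _ := by gcongr; linarith
  calc _ ≤ 2 * ((n : ℝ) + 1) * (t + 2) ^ n := h1
    _ ≤ 2 * ((n : ℝ) + 1) * (4 ^ n * (t ^ n + 1)) := by gcongr
    _ = _ := by ring

/-- Elementary bound for the partial sums of `∑ 1 / d ^ n`. -/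
lemma sum_inv_pow_le (n : ℕ) (hn : 1 ≤ n) (B : ℝ) (hB : 1 < B) :
    ∑ d ∈ Finset.Icc 1 ⌊B⌋₊, (1 : ℝ) / (d : ℝ) ^ n ≤ 2 + 2 * Real.log B ^ (1 / n : ℕ) := by
  rcases hn.eq_or_lt with rfl | hn
  · have h := harmonic_floor_le_one_add_log B hB.le
    rw [harmonic_eq_sum_Icc] at h
    push_cast at h
    have := Real.log_pos hB
    simp only [one_div, pow_one, Nat.div_self one_pos]
    linarith
  · have h : ∑ d ∈ Finset.Icc 1 ⌊B⌋₊, (1 : ℝ) / (d : ℝ) ^ n ≤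
        ∑ d ∈ Finset.Ioo 0 (⌊B⌋₊ + 1), ((d : ℝ) ^ 2)⁻¹ := by
      rw [show Finset.Ioo 0 (⌊B⌋₊ + 1) = Finset.Icc 1 ⌊B⌋₊ by
        ext; simp only [Finset.mem_Ioo, Finset.mem_Icc]; omega]
      refine Finset.sum_le_sum fun d hd => ?_
      have hd1 : (1 : ℝ) ≤ d := by exact_mod_cast (Finset.mem_Icc.mp hd).1
      rw [one_div]
      gcongr
      · exact hn
    have h2 := sum_Ioo_inv_sq_le (α := ℝ) 0 (⌊B⌋₊ + 1)
    rw [Nat.div_eq_of_lt hn, pow_zero]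
    norm_num at h2
    linarith

/-- Tail bound for a series dominated by `∑ 1 / d ^ (n + 1)`. -/
lemma abs_sub_sum_le_of_hasSum (n : ℕ) (hn : 1 ≤ n) (g : ℕ → ℝ) (S : ℝ) (hg : HasSum g S)
    (hg0 : g 0 = 0) (hle : ∀ d, |g d| ≤ 1 / (d : ℝ) ^ (n + 1)) (B : ℝ) (hB : 1 < B) :
    |S - ∑ d ∈ Finset.Icc 1 ⌊B⌋₊, g d| ≤ 2 / B ^ n := by
  set F := ⌊B⌋₊
  have hFB : B < F + 1 := Nat.lt_floor_add_one B
  have hlim := (hg.tendsto_sum_nat.sub_const (∑ d ∈ Finset.Icc 1 F, g d)).abs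
  refine le_of_tendsto hlim ?_
  filter_upwards [Filter.eventually_ge_atTop (F + 1)] with N hN
  have hsplit : ∑ d ∈ Finset.range N, g d - ∑ d ∈ Finset.Icc 1 F, g d =
      ∑ d ∈ Finset.Ioo F N, g d := by
    have h1 : ∑ d ∈ Finset.Icc 1 F, g d = ∑ d ∈ Finset.range (F + 1), g d := by
      refine Finset.sum_subset (fun d => ?_) (fun d hd hd' => ?_)
      · simp only [Finset.mem_Icc, Finset.mem_range]; omega
      · simp only [Finset.mem_Icc, Finset.mem_range] at hd hd'
        rw [show d = 0 by omega, hg0]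
    rw [h1, ← Finset.sum_Ico_eq_sub _ hN]
    exact Finset.sum_congr (by ext; simp only [Finset.mem_Ico, Finset.mem_Ioo]; omega)
      fun _ _ => rfl
  rw [hsplit]
  calc |∑ d ∈ Finset.Ioo F N, g d| ≤ ∑ d ∈ Finset.Ioo F N, |g d| :=
        Finset.abs_sum_le_sum_abs _ _
    _ ≤ ∑ d ∈ Finset.Ioo F N, 1 / B ^ (n - 1) * ((d : ℝ) ^ 2)⁻¹ := by
        refine Finset.sum_le_sum fun d hd => (hle d).trans ?_
        have hd1 : B ≤ d := by
          refine hFB.le.trans ?_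
          exact_mod_cast (Finset.mem_Ioo.mp hd).1
        have hd0 : (0 : ℝ) < d := by linarith
        rw [show n + 1 = (n - 1) + 2 by omega, pow_add, one_div, mul_inv, ← one_div]
        gcongr
    _ ≤ 1 / B ^ (n - 1) * (2 / (F + 1)) := by
        rw [← Finset.mul_sum]
        gcongr
        exact sum_Ioo_inv_sq_le F N
    _ ≤ 1 / B ^ (n - 1) * (2 / B) := by gcongr
    _ = 2 / B ^ n := by
        conv_rhs => rw [show n = (n - 1) + 1 by omega, pow_succ]
        field_simp

open ArithmeticFunction in
/-- Möbius inversion for the number of primitive vectors in a finite set of nonzero vectors. -/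
lemma card_filter_gcd_eq_one {k : ℕ} (s : Finset (Fin k → ℤ)) (F : ℕ)
    (hs : ∀ x ∈ s, x ≠ 0) (hF : ∀ x ∈ s, ∀ i, (x i).natAbs ≤ F) :
    ((s.filter fun x => Finset.univ.gcd (fun i => (x i).natAbs) = 1).card : ℝ) =
      ∑ d ∈ Finset.Icc 1 F,
        (moebius d : ℝ) * ((s.filter fun x => ∀ i, (d : ℤ) ∣ x i).card : ℝ) := by
  simp_rw [Finset.card_filter, Nat.cast_sum, Finset.mul_sum]
  rw [Finset.sum_comm]
  refine Finset.sum_congr rfl fun x hx => ?_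
  set g := Finset.univ.gcd (fun i => (x i).natAbs) with hg
  have hdvd : ∀ d : ℕ, (∀ i, (d : ℤ) ∣ x i) ↔ d ∣ g := by
    intro d
    simp [hg, Finset.dvd_gcd_iff, Int.natCast_dvd]
  obtain ⟨i, hi⟩ := Function.ne_iff.mp (hs x hx)
  have hi' : 0 < (x i).natAbs := Int.natAbs_pos.mpr hi
  have hgi : g ∣ (x i).natAbs := Finset.gcd_dvd (Finset.mem_univ i)
  have hg0 : g ≠ 0 := (Nat.pos_of_dvd_of_pos hgi hi').ne'
  have hgF : g ≤ F := (Nat.le_of_dvd hi' hgi).trans (hF x hx i)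
  have hdiv : g.divisors = (Finset.Icc 1 F).filter (fun d => d ∣ g) := by
    ext d
    simp only [Nat.mem_divisors, Finset.mem_filter, Finset.mem_Icc]
    exact ⟨fun h => ⟨⟨Nat.pos_of_dvd_of_pos h.1 (Nat.pos_of_ne_zero hg0),
      (Nat.le_of_dvd (Nat.pos_of_ne_zero hg0) h.1).trans hgF⟩, h.1⟩, fun h => ⟨h.2, hg0⟩⟩
  have hmu : ∑ d ∈ g.divisors, (moebius d : ℝ) = if g = 1 then 1 else 0 := by
    have h := congrArg (fun f : ArithmeticFunction ℤ => f g) moebius_mul_coe_zeta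
    simp only [coe_mul_zeta_apply, one_apply] at h
    exact_mod_cast h
  simp_rw [hdvd]
  push_cast
  rw [← hmu, hdiv, Finset.sum_filter]
  exact Finset.sum_congr rfl fun d _ => by split_ifs <;> simp

/-- A vector divisible by `d` cannot be unimodular modulo `Q` unless `d` is coprime to `Q`. -/
lemma coprime_of_dvd_of_span_eq_top {ι : Type*} (d Q : ℕ) (x : ι → ℤ) (hd : ∀ i, (d : ℤ) ∣ x i)
    (hx : Ideal.span (Set.range fun i => (x i : ZMod Q)) = ⊤) : d.Coprime Q := by
  rw [← ZMod.isUnit_iff_coprime, ← Ideal.span_singleton_eq_top, eq_top_iff, ← hx,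
    Ideal.span_le]
  rintro _ ⟨i, rfl⟩
  obtain ⟨k, hk⟩ := hd i
  rw [SetLike.mem_coe, Ideal.mem_span_singleton]
  exact ⟨k, by simp [hk]⟩

/-- The number of vectors in the box of size `B` that are divisible by `d` and whose reduction
lies in `Υ`. -/
lemma abs_card_box_sub_le (n d Q : ℕ) (hd : d ≠ 0) (hQ : Q ≠ 0) (hdQ : d.Coprime Q)
    (Υ : Finset (Fin (n + 1) → ZMod Q)) (B : ℝ) (hB : 0 ≤ B) :
    |((((Fintype.piFinset fun _ : Fin (n + 1) => Finset.Icc (-⌊B⌋) ⌊B⌋).filter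
        (fun x => (fun i => (x i : ZMod Q)) ∈ Υ ∧ ∀ i, (d : ℤ) ∣ x i)).card : ℕ) : ℝ) -
      Υ.card * (2 * B / (d * Q)) ^ (n + 1)| ≤
      Υ.card * (2 * (n + 1) * 4 ^ n * ((2 * B / (d * Q)) ^ n + 1)) := by
  classical
  set t := 2 * B / (d * Q) with ht
  have ht0 : 0 ≤ t := by positivity
  set S : ZMod Q → Finset ℤ := fun a => (Finset.Icc (-⌊B⌋) ⌊B⌋).filter
    (fun x : ℤ => (d : ℤ) ∣ x ∧ (x : ZMod Q) = a) with hS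
  have hcard : ((Fintype.piFinset fun _ : Fin (n + 1) => Finset.Icc (-⌊B⌋) ⌊B⌋).filter
      (fun x => (fun i => (x i : ZMod Q)) ∈ Υ ∧ ∀ i, (d : ℤ) ∣ x i)).card =
      ∑ v ∈ Υ, ∏ i, (S (v i)).card := by
    rw [Finset.card_eq_sum_card_fiberwise (t := Υ) (f := fun x i => (x i : ZMod Q))
      (fun x hx => (Finset.mem_filter.mp hx).2.1)]
    refine Finset.sum_congr rfl fun v hv => ?_
    rw [← Fintype.card_piFinset]
    congr 1
    ext x
    simp only [hS, Finset.mem_filter, Fintype.mem_piFinset]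
    constructor
    · rintro ⟨⟨h1, h2, h3⟩, rfl⟩
      exact fun i => ⟨h1 i, h3 i, rfl⟩
    · intro h
      have hxv : (fun i => (x i : ZMod Q)) = v := funext fun i => (h i).2.2
      exact ⟨⟨fun i => (h i).1, hxv ▸ hv, fun i => (h i).2.1⟩, hxv⟩
  have hv : ∀ v ∈ Υ, |∏ i, ((S (v i)).card : ℝ) - t ^ (n + 1)| ≤
      2 * (n + 1) * 4 ^ n * (t ^ n + 1) := fun v _ => by
    have h := abs_prod_sub_pow_le Finset.univ (fun i => ((S (v i)).card : ℝ)) t 2 ht0 zero_le_two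
      fun i _ => abs_card_dvd_residue_sub_le d Q hd hQ hdQ (v i) B hB
    rw [Finset.card_univ, Fintype.card_fin] at h
    exact h.trans (add_two_pow_sub_pow_le n t ht0)
  rw [hcard]
  push_cast
  rw [← nsmul_eq_mul, ← nsmul_eq_mul, ← Finset.sum_const, ← Finset.sum_sub_distrib]
  exact (Finset.abs_sum_le_sum_abs _ _).trans (Finset.sum_le_card_nsmul _ _ _ hv)

/-- Variant of `abs_card_box_sub_le` in which the zero vector is left out. -/
lemma abs_card_box_ne_zero_sub_le (n d Q : ℕ) (hd : d ≠ 0) (hQ : Q ≠ 0) (hdQ : d.Coprime Q)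
    (Υ : Finset (Fin (n + 1) → ZMod Q)) (B : ℝ) (hB : 0 ≤ B) :
    |(((((Fintype.piFinset fun _ : Fin (n + 1) => Finset.Icc (-⌊B⌋) ⌊B⌋).filter
        (fun x => (fun i => (x i : ZMod Q)) ∈ Υ ∧ x ≠ 0)).filter
          fun x => ∀ i, (d : ℤ) ∣ x i).card : ℕ) : ℝ) -
      Υ.card * (2 * B / (d * Q)) ^ (n + 1)| ≤
      Υ.card * (4 * (n + 1) * 4 ^ n * ((2 * B / (d * Q)) ^ n + 1)) := by
  classical
  have hmain := abs_card_box_sub_le n d Q hd hQ hdQ Υ B hB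
  set A := (Fintype.piFinset fun _ : Fin (n + 1) => Finset.Icc (-⌊B⌋) ⌊B⌋).filter
    (fun x => (fun i => (x i : ZMod Q)) ∈ Υ ∧ ∀ i, (d : ℤ) ∣ x i) with hA
  have heq : ((Fintype.piFinset fun _ : Fin (n + 1) => Finset.Icc (-⌊B⌋) ⌊B⌋).filter
      (fun x => (fun i => (x i : ZMod Q)) ∈ Υ ∧ x ≠ 0)).filter
        (fun x => ∀ i, (d : ℤ) ∣ x i) = A.erase 0 := by
    ext x
    simp only [hA, Finset.mem_filter, Finset.mem_erase]
    tauto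
  rw [heq]
  have hle : (A.card : ℝ) - Υ.card ≤ (A.erase 0).card := by
    by_cases h0 : (0 : Fin (n + 1) → ℤ) ∈ A
    · have h1 : (1 : ℝ) ≤ Υ.card := by
        exact_mod_cast Finset.card_pos.mpr ⟨_, (Finset.mem_filter.mp h0).2.1⟩
      have h2 : ((A.erase 0).card : ℝ) + 1 = A.card := by
        exact_mod_cast Finset.card_erase_add_one h0
      linarith
    · rw [Finset.erase_eq_of_notMem h0]
      linarith [Nat.cast_nonneg (α := ℝ) Υ.card]
  have hle' : ((A.erase 0).card : ℝ) ≤ A.card := by exact_mod_cast Finset.card_erase_le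
  have hone : (1 : ℝ) ≤ 2 * (n + 1) * 4 ^ n * ((2 * B / (d * Q)) ^ n + 1) := by
    have h4 : (1 : ℝ) ≤ 4 ^ n := one_le_pow₀ (by norm_num)
    have hn0 : (0 : ℝ) ≤ n := Nat.cast_nonneg n
    have ht : (0 : ℝ) ≤ (2 * B / (d * Q)) ^ n := by positivity
    calc (1 : ℝ) = 1 * 1 * 1 := by norm_num
      _ ≤ _ := by gcongr <;> linarith
  have hmul := mul_le_mul_of_nonneg_left hone (Nat.cast_nonneg (α := ℝ) Υ.card)
  rw [abs_le] at hmain ⊢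
  constructor <;> linarith [hmain.1, hmain.2]

/-- Möbius inversion for the number of primitive vectors of height at most `B` whose reduction
lies in `Υ`. -/
lemma natCard_primitive_eq_sum (n Q : ℕ) (Υ : Finset (Fin (n + 1) → ZMod Q)) (B : ℝ)
    (hB : 0 ≤ B) :
    (Nat.card {x : Fin (n + 1) → ℤ //
        Finset.univ.gcd (fun i => (x i).natAbs) = 1 ∧
        (∀ i, |(x i : ℝ)| ≤ B) ∧
        (fun i => ((x i : ZMod Q))) ∈ Υ} : ℝ) =
      ∑ d ∈ Finset.Icc 1 ⌊B⌋₊, (ArithmeticFunction.moebius d : ℝ) *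
        ((((Fintype.piFinset fun _ : Fin (n + 1) => Finset.Icc (-⌊B⌋) ⌊B⌋).filter
          (fun x => (fun i => (x i : ZMod Q)) ∈ Υ ∧ x ≠ 0)).filter
            fun x => ∀ i, (d : ℤ) ∣ x i).card : ℝ) := by
  have habs : ∀ y : ℤ, |(y : ℝ)| ≤ B ↔ y ∈ Finset.Icc (-⌊B⌋) ⌊B⌋ := by
    intro y
    rw [← Int.cast_abs, ← Int.le_floor, abs_le, Finset.mem_Icc]
  rw [← card_filter_gcd_eq_one _ ⌊B⌋₊ (fun x hx => (Finset.mem_filter.mp hx).2.2)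
    (fun x hx i => by
      have h := (habs _).mpr (Fintype.mem_piFinset.mp (Finset.mem_filter.mp hx).1 i)
      rw [Nat.le_floor_iff hB, Nat.cast_natAbs, Int.cast_abs]
      exact h)]
  rw [Nat.cast_inj, ← Nat.card_eq_finsetCard]
  refine Nat.card_congr (Equiv.subtypeEquivRight fun x => ?_)
  simp only [Finset.mem_filter, Fintype.mem_piFinset, ← habs]
  refine ⟨fun h => ⟨⟨h.2.1, h.2.2, ?_⟩, h.1⟩, fun h => ⟨h.2, h.1.1, h.1.2.1⟩⟩
  rintro rfl
  have h0 : Finset.univ.gcd (fun _ : Fin (n + 1) => 0) = 0 :=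
    Finset.gcd_eq_zero_iff.mpr fun _ _ => rfl
  simpa [h0] using h.1

/-- Comparison of the number of primitive vectors with the truncated Möbius sum. -/
lemma abs_natCard_primitive_sub_le (n Q : ℕ) (hQ : Q ≠ 0) (Υ : Finset (Fin (n + 1) → ZMod Q))
    (hΥ : ∀ v ∈ Υ, Ideal.span (Set.range v) = ⊤) (B : ℝ) (hB : 0 ≤ B) :
    |(Nat.card {x : Fin (n + 1) → ℤ //
        Finset.univ.gcd (fun i => (x i).natAbs) = 1 ∧
        (∀ i, |(x i : ℝ)| ≤ B) ∧
        (fun i => ((x i : ZMod Q))) ∈ Υ} : ℝ) -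
      Υ.card * (2 * B / Q) ^ (n + 1) * ∑ d ∈ Finset.Icc 1 ⌊B⌋₊,
        (if d.Coprime Q then (ArithmeticFunction.moebius d : ℝ) / (d : ℝ) ^ (n + 1) else 0)| ≤
      ∑ d ∈ Finset.Icc 1 ⌊B⌋₊,
        Υ.card * (4 * (n + 1) * 4 ^ n * ((2 * B / (d * Q)) ^ n + 1)) := by
  have hmu : ∀ d : ℕ, |(ArithmeticFunction.moebius d : ℝ)| ≤ 1 := fun d => by
    exact_mod_cast ArithmeticFunction.abs_moebius_le_one
  rw [natCard_primitive_eq_sum n Q Υ B hB, Finset.mul_sum, ← Finset.sum_sub_distrib]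
  refine (Finset.abs_sum_le_sum_abs _ _).trans (Finset.sum_le_sum fun d hd => ?_)
  have hd0 : d ≠ 0 := by have := (Finset.mem_Icc.mp hd).1; omega
  by_cases hdQ : d.Coprime Q
  · have h := abs_card_box_ne_zero_sub_le n d Q hd0 hQ hdQ Υ B hB
    have hdR : (d : ℝ) ≠ 0 := by exact_mod_cast hd0
    have hrw : Υ.card * (2 * B / Q) ^ (n + 1) *
        ((ArithmeticFunction.moebius d : ℝ) / (d : ℝ) ^ (n + 1)) =
        (ArithmeticFunction.moebius d : ℝ) * (Υ.card * (2 * B / (d * Q)) ^ (n + 1)) := by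
      simp only [div_pow, mul_pow]; field_simp
    rw [if_pos hdQ, hrw, ← mul_sub, abs_mul]
    exact (mul_le_of_le_one_left (abs_nonneg _) (hmu d)).trans h
  · rw [if_neg hdQ, Finset.filter_eq_empty_iff.mpr fun x hx hdx => hdQ <|
      coprime_of_dvd_of_span_eq_top d Q x hdx (hΥ _ (Finset.mem_filter.mp hx).2.1)]
    simp only [Finset.card_empty, Nat.cast_zero, mul_zero, sub_zero, abs_zero]
    positivity

/-- Summation over `d` of the error terms coming from the individual box counts. -/
lemma sum_box_error_le (n Q : ℕ) (hn : 1 ≤ n) (B K : ℝ) (hB : 1 < B) (hK : 0 ≤ K) (N : ℕ) :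
    ∑ d ∈ Finset.Icc 1 ⌊B⌋₊, N * (K * ((2 * B / (d * Q)) ^ n + 1)) ≤
      N * (K * (2 ^ n * (B / Q) ^ n * (2 + 2 * Real.log B ^ (1 / n : ℕ)) + B)) := by
  have hB0 : 0 ≤ B := by linarith
  rw [← Finset.mul_sum, ← Finset.mul_sum, Finset.sum_add_distrib]
  have h1 : ∑ d ∈ Finset.Icc 1 ⌊B⌋₊, (2 * B / (d * Q)) ^ n =
      2 ^ n * (B / Q) ^ n * ∑ d ∈ Finset.Icc 1 ⌊B⌋₊, (1 : ℝ) / (d : ℝ) ^ n := by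
    rw [Finset.mul_sum]
    refine Finset.sum_congr rfl fun d _ => ?_
    simp only [div_eq_mul_inv, mul_inv, mul_pow, inv_pow]
    ring
  rw [h1]
  gcongr
  · exact sum_inv_pow_le n hn B hB
  · simpa using Nat.floor_le hB0

/-- Combination of the error terms into the shape `B + (B / Q) ^ n * (log B) ^ [1 / n]`. -/
lemma combined_error_le (n Q : ℕ) (hn : 1 ≤ n) (hQ : 1 ≤ Q) (B K : ℝ) (hB : 1 < B)
    (hK : 0 ≤ K) :
    K * (2 ^ n * (B / Q) ^ n * (2 + 2 * Real.log B ^ (1 / n : ℕ)) + B) +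
        (2 * B / Q) ^ (n + 1) * (2 / B ^ n) ≤
      ((4 * 2 ^ n + 1) * K + 2 * 2 ^ (n + 1)) *
        (B + (B / Q) ^ n * Real.log B ^ (1 / n : ℕ)) := by
  have hB0 : 0 < B := by linarith
  have hQR : (1 : ℝ) ≤ Q := by exact_mod_cast hQ
  set L := Real.log B ^ (1 / n : ℕ) with hL
  set P : ℝ := (B / Q) ^ n with hP
  have hP0 : 0 ≤ P := by positivity
  have hL0 : 0 ≤ L := pow_nonneg (Real.log_pos hB).le _
  have hPB : P ≤ B + P * L := by
    rcases hn.eq_or_lt with rfl | hn2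
    · have : P ≤ B := by rw [hP, pow_one]; exact div_le_self hB0.le hQR
      linarith [mul_nonneg hP0 hL0]
    · have : L = 1 := by rw [hL, Nat.div_eq_of_lt hn2, pow_zero]
      rw [this]; linarith
  have htail' : (2 * B / Q) ^ (n + 1) * (2 / B ^ n) ≤ 2 * 2 ^ (n + 1) * B := by
    calc (2 * B / Q) ^ (n + 1) * (2 / B ^ n) ≤ (2 * B) ^ (n + 1) * (2 / B ^ n) := by
          gcongr
          exact div_le_self (by positivity) hQR
      _ = 2 * 2 ^ (n + 1) * B := by
          rw [mul_pow, pow_succ B]; field_simp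
  have hPL : 0 ≤ P * L := mul_nonneg hP0 hL0
  calc K * (2 ^ n * P * (2 + 2 * L) + B) + (2 * B / Q) ^ (n + 1) * (2 / B ^ n)
      = K * (2 ^ n * (2 * P + 2 * (P * L)) + B) + (2 * B / Q) ^ (n + 1) * (2 / B ^ n) := by ring
    _ ≤ K * (2 ^ n * (2 * (B + P * L) + 2 * (B + P * L)) + (B + P * L)) +
          2 * 2 ^ (n + 1) * (B + P * L) := by
        refine add_le_add ?_ (htail'.trans ?_)
        · gcongr
          · linarith
          · linarith
        · gcongr
          linarith
    _ = _ := by ring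

/-- Equidistribution of primitive integer vectors with prescribed reduction mod `Q`
(affine-cone form of Proposition 2.1 of the paper). For a set `Υ̂` of unimodular
vectors of `(ℤ/Qℤ)^{n+1}` stable under scaling by units,
`#{x primitive : max|x_i| ≤ B, x mod Q ∈ Υ̂}
  = (2^{n+1}/ζ(n+1))·#Υ̂·B^{n+1}/(Q^{n+1}∏_{p∣Q}(1-p^{-(n+1)}))
    + O((Q/φ(Q))·#Υ̂·(B + (B/Q)^n (log B)^{[1/n]}))`. -/
theorem primitive_vector_count_congruence (n : ℕ) (hn : 1 ≤ n) :
    ∃ C : ℝ, 0 < C ∧ ∀ (Q : ℕ), 1 ≤ Q →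
      ∀ Υ : Finset (Fin (n + 1) → ZMod Q),
        (∀ v ∈ Υ, Ideal.span (Set.range v) = ⊤) →
        (∀ (u : (ZMod Q)ˣ), ∀ v ∈ Υ, (fun i => (u : ZMod Q) * v i) ∈ Υ) →
        ∀ B : ℝ, 1 < B →
          |(Nat.card {x : Fin (n + 1) → ℤ //
                Finset.univ.gcd (fun i => (x i).natAbs) = 1 ∧
                (∀ i, |(x i : ℝ)| ≤ B) ∧
                (fun i => ((x i : ZMod Q))) ∈ Υ} : ℝ) -
              (2 ^ (n + 1) / (∑' k : ℕ, (1 : ℝ) / (k + 1) ^ (n + 1))) * Υ.card *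
                B ^ (n + 1) /
                (Q ^ (n + 1) * ∏ p ∈ Q.primeFactors, (1 - 1 / (p : ℝ) ^ (n + 1)))|
            ≤ C * ((Q : ℝ) / Nat.totient Q) * Υ.card *
                (B + (B / Q) ^ n * Real.log B ^ (1 / n : ℕ)) := by
  set K : ℝ := 4 * (n + 1) * 4 ^ n with hK
  have hK0 : 0 < K := by positivity
  refine ⟨(4 * 2 ^ n + 1) * K + 2 * 2 ^ (n + 1), by positivity, ?_⟩
  intro Q hQ1 Υ hΥ _ B hB
  have hQ : Q ≠ 0 := by omega
  have hB0 : 0 < B := by linarith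
  set g : ℕ → ℝ := fun d =>
    if d.Coprime Q then (ArithmeticFunction.moebius d : ℝ) / (d : ℝ) ^ (n + 1) else 0 with hg
  set S : ℝ := 1 / ((∑' k : ℕ, (1 : ℝ) / (k + 1) ^ (n + 1)) *
    ∏ p ∈ Q.primeFactors, (1 - 1 / (p : ℝ) ^ (n + 1))) with hS
  have htail := abs_sub_sum_le_of_hasSum n hn g S
    (hasSum_moebius_coprime (n + 1) Q (by omega) hQ) (by simp [hg]) (fun d => by
      simp only [hg]
      split_ifs
      · rw [abs_div, abs_of_nonneg (by positivity : (0 : ℝ) ≤ (d : ℝ) ^ (n + 1))]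
        gcongr
        exact_mod_cast ArithmeticFunction.abs_moebius_le_one
      · rw [abs_zero]; positivity) B hB
  have hmain : 2 ^ (n + 1) / (∑' k : ℕ, (1 : ℝ) / (k + 1) ^ (n + 1)) * Υ.card * B ^ (n + 1) /
      (Q ^ (n + 1) * ∏ p ∈ Q.primeFactors, (1 - 1 / (p : ℝ) ^ (n + 1))) =
      Υ.card * (2 * B / Q) ^ (n + 1) * S := by
    rw [hS, div_pow, mul_pow]
    simp only [div_eq_mul_inv, mul_inv]
    ring
  have hφ : (1 : ℝ) ≤ (Q : ℝ) / Nat.totient Q := by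
    rw [one_le_div (by exact_mod_cast Nat.totient_pos.mpr hQ1)]
    exact_mod_cast Nat.totient_le Q
  have hE : 0 ≤ B + (B / Q) ^ n * Real.log B ^ (1 / n : ℕ) := by
    have := Real.log_pos hB
    positivity
  have hcount := (abs_natCard_primitive_sub_le n Q hQ Υ hΥ B hB0.le).trans
    (sum_box_error_le n Q hn B K hB hK0.le Υ.card)
  have hdiff : |Υ.card * (2 * B / Q) ^ (n + 1) * ∑ d ∈ Finset.Icc 1 ⌊B⌋₊, g d -
      Υ.card * (2 * B / Q) ^ (n + 1) * S| ≤
      Υ.card * ((2 * B / Q) ^ (n + 1) * (2 / B ^ n)) := by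
    rw [← mul_sub, abs_mul, abs_of_nonneg (by positivity), abs_sub_comm, mul_assoc]
    gcongr
  rw [hmain]
  refine (abs_sub_le _ _ _).trans ((add_le_add hcount hdiff).trans ?_)
  rw [← mul_add]
  refine (mul_le_mul_of_nonneg_left (combined_error_le n Q hn hQ1 B K hB hK0.le)
    (Nat.cast_nonneg _)).trans ?_
  calc _ = ((4 * 2 ^ n + 1) * K + 2 * 2 ^ (n + 1)) * 1 * Υ.card *
        (B + (B / Q) ^ n * Real.log B ^ (1 / n : ℕ)) := by ring
    _ ≤ _ := by gcongr
end

section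
/- Let n ≥ 0 and Q ≥ 1 be integers. The number of unimodular vectors in (ℤ/Qℤ)^{n+1} equals Q^{n+1} ∏_{p ∣ Q, p prime} (1 − p^{−(n+1)}). Equivalently, since the scaling action of the unit group (ℤ/Qℤ)^× on unimodular vectors is free, Q^{n+1} ∏_{p ∣ Q}(1 − p^{−(n+1)}) = φ(Q) · #ℙⁿ(ℤ/Qℤ), where #ℙⁿ(ℤ/Qℤ) is the number of unit-group orbits of unimodular vectors. -/
/-- A family in a commutative ring generates the unit ideal iff it admits a linear combination
equal to one. -/
theorem span_range_eq_top_iff_exists_sum {R ι : Type*} [CommRing R] [Fintype ι] (v : ι → R) :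
    Ideal.span (Set.range v) = ⊤ ↔ ∃ c : ι → R, ∑ i, c i * v i = 1 := by
  rw [Ideal.eq_top_iff_one, Ideal.mem_span_range_iff_exists_fun]

theorem span_range_eq_top_iff_of_ringEquiv {R S ι : Type*} [CommRing R] [CommRing S] [Fintype ι]
    (e : R ≃+* S) (v : ι → R) :
    Ideal.span (Set.range v) = ⊤ ↔ Ideal.span (Set.range fun i => e (v i)) = ⊤ := by
  simp only [span_range_eq_top_iff_exists_sum]
  constructor
  · rintro ⟨c, hc⟩
    exact ⟨fun i => e (c i), by simpa using congrArg e hc⟩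
  · rintro ⟨c, hc⟩
    exact ⟨fun i => e.symm (c i), by simpa using congrArg e.symm hc⟩

theorem span_range_prod_eq_top_iff {R S ι : Type*} [CommRing R] [CommRing S] [Fintype ι]
    (v : ι → R × S) :
    Ideal.span (Set.range v) = ⊤ ↔
      Ideal.span (Set.range fun i => (v i).1) = ⊤ ∧
        Ideal.span (Set.range fun i => (v i).2) = ⊤ := by
  simp only [span_range_eq_top_iff_exists_sum]
  constructor
  · rintro ⟨c, hc⟩
    exact ⟨⟨fun i => (c i).1, by simpa [Prod.fst_sum] using congrArg Prod.fst hc⟩,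
      ⟨fun i => (c i).2, by simpa [Prod.snd_sum] using congrArg Prod.snd hc⟩⟩
  · rintro ⟨⟨c, hc⟩, d, hd⟩
    refine ⟨fun i => (c i, d i), Prod.ext ?_ ?_⟩
    · simpa [Prod.fst_sum] using hc
    · simpa [Prod.snd_sum] using hd

theorem span_range_eq_top_iff_exists_isUnit {R ι : Type*} [CommRing R] [IsLocalRing R]
    (v : ι → R) : Ideal.span (Set.range v) = ⊤ ↔ ∃ i, IsUnit (v i) := by
  constructor
  · intro h
    by_contra! hv
    have hle : Ideal.span (Set.range v) ≤ IsLocalRing.maximalIdeal R := by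
      rw [Ideal.span_le]
      rintro _ ⟨i, rfl⟩
      exact hv i
    exact Ideal.IsPrime.ne_top' (top_le_iff.mp (h ▸ hle))
  · rintro ⟨i, hi⟩
    exact Ideal.eq_top_of_isUnit_mem _ (Ideal.subset_span ⟨i, rfl⟩) hi

theorem card_unimodular_congr {R S ι : Type*} [CommRing R] [CommRing S] [Fintype ι]
    (e : R ≃+* S) :
    Nat.card {v : ι → R // Ideal.span (Set.range v) = ⊤} =
      Nat.card {v : ι → S // Ideal.span (Set.range v) = ⊤} :=
  Nat.card_congr <| (Equiv.arrowCongr (Equiv.refl ι) e.toEquiv).subtypeEquiv fun v =>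
    span_range_eq_top_iff_of_ringEquiv e v

theorem card_unimodular_prod (R S ι : Type*) [CommRing R] [CommRing S] [Fintype ι] :
    Nat.card {v : ι → R × S // Ideal.span (Set.range v) = ⊤} =
      Nat.card {v : ι → R // Ideal.span (Set.range v) = ⊤} *
        Nat.card {v : ι → S // Ideal.span (Set.range v) = ⊤} := by
  rw [← Nat.card_prod]
  exact Nat.card_congr <|
    ((Equiv.arrowProdEquivProdArrow ι (fun _ => R) (fun _ => S)).subtypeEquiv
      fun v => span_range_prod_eq_top_iff v).trans
    (Equiv.subtypeProdEquivProd (p := fun v : ι → R => Ideal.span (Set.range v) = ⊤)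
      (q := fun v : ι → S => Ideal.span (Set.range v) = ⊤))

/-- In a finite local ring, the vectors that are not unimodular are those whose coordinates are
all nonunits. -/
theorem card_unimodular_add_card_nonunits_pow (R ι : Type*) [CommRing R] [IsLocalRing R] [Finite R]
    [Fintype ι] :
    Nat.card {v : ι → R // Ideal.span (Set.range v) = ⊤} +
      Nat.card {x : R // ¬IsUnit x} ^ Fintype.card ι = Nat.card R ^ Fintype.card ι := by
  classical
  have hcompl : Nat.card {v : ι → R // ¬Ideal.span (Set.range v) = ⊤} =
      Nat.card {x : R // ¬IsUnit x} ^ Fintype.card ι := by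
    rw [← Nat.card_eq_fintype_card, ← Nat.card_fun]
    refine Nat.card_congr <| (Equiv.subtypeEquivRight fun v => ?_).trans
      (Equiv.subtypePiEquivPi (p := fun (_ : ι) (x : R) => ¬IsUnit x))
    rw [span_range_eq_top_iff_exists_isUnit, not_exists]
  rw [← hcompl, ← Nat.card_sum,
    Nat.card_congr (Equiv.sumCompl fun v : ι → R => Ideal.span (Set.range v) = ⊤), Nat.card_fun,
    Nat.card_eq_fintype_card (α := ι)]

theorem card_units_add_card_nonunits (R : Type*) [CommRing R] [Finite R] :
    Nat.card Rˣ + Nat.card {x : R // ¬IsUnit x} = Nat.card R := by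
  classical
  have hunits : Nat.card Rˣ = Nat.card {x : R // IsUnit x} :=
    Nat.card_congr (Equiv.ofBijective (fun u : Rˣ => (⟨u, u.isUnit⟩ : {x : R // IsUnit x}))
      ⟨fun u w h => Units.ext (congrArg Subtype.val h), fun ⟨_, u, hu⟩ => ⟨u, Subtype.ext hu⟩⟩)
  rw [hunits, ← Nat.card_sum, Nat.card_congr (Equiv.sumCompl fun x : R => IsUnit x)]

theorem ZMod.card_nonunits_prime_pow {p : ℕ} (hp : p.Prime) (k : ℕ) :
    Nat.card {x : ZMod (p ^ (k + 1)) // ¬IsUnit x} = p ^ k := by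
  have : NeZero (p ^ (k + 1)) := ⟨pow_ne_zero _ hp.ne_zero⟩
  have h := card_units_add_card_nonunits (ZMod (p ^ (k + 1)))
  rw [Nat.card_eq_fintype_card, ZMod.card_units_eq_totient, Nat.totient_prime_pow_succ hp,
    Nat.card_zmod] at h
  obtain ⟨m, rfl⟩ : ∃ m, p = m + 1 := ⟨p - 1, (Nat.sub_add_cancel hp.one_le).symm⟩
  rw [Nat.add_sub_cancel, pow_succ, mul_add, mul_one] at h
  exact Nat.add_left_cancel h

theorem ZMod.isLocalRing_prime_pow {p : ℕ} (hp : p.Prime) (k : ℕ) :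
    IsLocalRing (ZMod (p ^ (k + 1))) := by
  have : Fact (1 < p ^ (k + 1)) := ⟨Nat.one_lt_pow k.succ_ne_zero hp.one_lt⟩
  have hunit (m : ℤ) (hm : ¬(p : ℤ) ∣ m) : IsUnit (m : ZMod (p ^ (k + 1))) := by
    rw [ZMod.coe_int_isUnit_iff_isCoprime, Nat.cast_pow]
    exact ((Nat.prime_iff_prime_int.mp hp).irreducible.coprime_iff_not_dvd.mpr hm).pow_left
  refine IsLocalRing.of_isUnit_or_isUnit_one_sub_self fun a => ?_
  obtain ⟨m, rfl⟩ := ZMod.intCast_surjective a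
  by_cases hm : (p : ℤ) ∣ m
  · right
    rw [← Int.cast_one, ← Int.cast_sub]
    refine hunit _ fun h => ?_
    exact (Nat.prime_iff_prime_int.mp hp).not_dvd_one ((dvd_sub_left hm).mp h)
  · exact Or.inl (hunit m hm)

theorem card_unimodular_zmod_prime_pow (n : ℕ) {p : ℕ} (hp : p.Prime) (k : ℕ) :
    (Nat.card {v : Fin (n + 1) → ZMod (p ^ (k + 1)) // Ideal.span (Set.range v) = ⊤} : ℝ) =
      ((p ^ (k + 1) : ℕ) : ℝ) ^ (n + 1) * (1 - 1 / (p : ℝ) ^ (n + 1)) := by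
  have : NeZero (p ^ (k + 1)) := ⟨pow_ne_zero _ hp.ne_zero⟩
  have := ZMod.isLocalRing_prime_pow hp k
  have h := card_unimodular_add_card_nonunits_pow (ZMod (p ^ (k + 1))) (Fin (n + 1))
  rw [ZMod.card_nonunits_prime_pow hp, Nat.card_zmod, Fintype.card_fin] at h
  have h' := congrArg (Nat.cast : ℕ → ℝ) h
  push_cast at h' ⊢
  have hp0 : (p : ℝ) ≠ 0 := mod_cast hp.ne_zero
  rw [eq_sub_of_add_eq h', pow_succ (p : ℝ) k, mul_pow]
  field_simp

theorem card_unimodular_zmod (n Q : ℕ) (hQ : Q ≠ 0) :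
    (Nat.card {v : Fin (n + 1) → ZMod Q // Ideal.span (Set.range v) = ⊤} : ℝ) =
      (Q : ℝ) ^ (n + 1) * ∏ p ∈ Q.primeFactors, (1 - 1 / (p : ℝ) ^ (n + 1)) := by
  induction Q using Nat.recOnPosPrimePosCoprime with
  | zero => exact absurd rfl hQ
  | one =>
    have htop (I : Ideal (ZMod 1)) : I = ⊤ := Subsingleton.elim _ _
    simp [htop]
  | prime_pow p k hp hk =>
    obtain ⟨k, rfl⟩ := Nat.exists_eq_succ_of_ne_zero hk.ne'
    rw [card_unimodular_zmod_prime_pow n hp, Nat.primeFactors_prime_pow k.succ_ne_zero hp,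
      Finset.prod_singleton]
  | coprime a b ha hb hab iha ihb =>
    rw [card_unimodular_congr (ZMod.chineseRemainder hab), card_unimodular_prod, Nat.cast_mul,
      iha (by lia), ihb (by lia), hab.primeFactors_mul,
      Finset.prod_union hab.disjoint_primeFactors, Nat.cast_mul, mul_pow]
    ring

theorem span_range_units_smul {R ι : Type*} [CommRing R] (u : Rˣ) (v : ι → R) :
    Ideal.span (Set.range (u • v)) = Ideal.span (Set.range v) := by
  have hle (u : Rˣ) (v : ι → R) :
      Ideal.span (Set.range (u • v)) ≤ Ideal.span (Set.range v) := by
    rw [Ideal.span_le]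
    rintro _ ⟨i, rfl⟩
    exact Ideal.mul_mem_left _ _ (Ideal.subset_span ⟨i, rfl⟩)
  exact le_antisymm (hle u v) (by simpa using hle u⁻¹ (u • v))

/-- Units act freely on unimodular vectors. -/
theorem units_smul_left_injective_of_span_eq_top {R ι : Type*} [CommRing R] [Fintype ι]
    {v : ι → R} (hv : Ideal.span (Set.range v) = ⊤) :
    Function.Injective fun u : Rˣ => u • v := by
  intro u w h
  obtain ⟨c, hc⟩ := (span_range_eq_top_iff_exists_sum v).mp hv
  have hi (i : ι) : (u : R) * v i = w * v i := congrFun h i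
  have hsum (a : R) : ∑ i, c i * (a * v i) = a := by
    simp only [mul_left_comm _ a, ← Finset.mul_sum, hc, mul_one]
  apply Units.ext
  rw [← hsum u, ← hsum w]
  simp only [hi]

theorem card_unimodular_eq_card_units_mul_card_orbits (R ι : Type*) [CommRing R] [Fintype ι] :
    Nat.card {v : ι → R // Ideal.span (Set.range v) = ⊤} =
      Nat.card Rˣ *
        Nat.card {c : Quotient (MulAction.orbitRel Rˣ (ι → R)) //
          ∃ v : ι → R, Ideal.span (Set.range v) = ⊤ ∧
            Quotient.mk (MulAction.orbitRel Rˣ (ι → R)) v = c} := by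
  have hout (c : Quotient (MulAction.orbitRel Rˣ (ι → R)))
      (hc : ∃ v : ι → R, Ideal.span (Set.range v) = ⊤ ∧
        Quotient.mk (MulAction.orbitRel Rˣ (ι → R)) v = c) :
      Ideal.span (Set.range c.out) = ⊤ := by
    obtain ⟨v, hv, rfl⟩ := hc
    obtain ⟨u, hu⟩ := Quotient.mk_out (s := MulAction.orbitRel Rˣ (ι → R)) v
    rw [← hu]
    exact (span_range_units_smul u v).trans hv
  rw [← Nat.card_prod]
  symm
  refine Nat.card_congr (Equiv.ofBijective
    (fun x => ⟨x.1 • x.2.1.out, (span_range_units_smul _ _).trans (hout _ x.2.2)⟩) ⟨?_, ?_⟩)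
  · rintro ⟨u, c, hc⟩ ⟨w, d, hd⟩ h
    have h' : u • c.out = w • d.out := congrArg Subtype.val h
    have hcd : c = d := by
      rw [← Quotient.out_eq c, ← Quotient.out_eq d]
      refine Quotient.sound (s := MulAction.orbitRel Rˣ (ι → R)) ⟨u⁻¹ * w, ?_⟩
      simp only [mul_smul, ← h', inv_smul_smul]
    subst hcd
    rw [units_smul_left_injective_of_span_eq_top (hout c hc) h']
  · rintro ⟨v, hv⟩
    obtain ⟨u, hu⟩ := Quotient.mk_out (s := MulAction.orbitRel Rˣ (ι → R)) v
    refine ⟨(u⁻¹, ⟨Quotient.mk _ v, v, hv, rfl⟩), Subtype.ext ?_⟩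
    simp only [← hu, inv_smul_smul]

/-- The number of unimodular vectors in `(ℤ/Qℤ)^{n+1}` equals
`Q^{n+1} ∏_{p ∣ Q} (1 - p^{-(n+1)})`; equivalently, since the scaling action of
`(ℤ/Qℤ)ˣ` on unimodular vectors is free, this number also equals
`φ(Q) · #ℙⁿ(ℤ/Qℤ)`, where `#ℙⁿ(ℤ/Qℤ)` is the number of unit-orbits of
unimodular vectors. -/
theorem card_unimodular_vectors (n Q : ℕ) (hQ : 1 ≤ Q) :
    ((Nat.card {v : Fin (n + 1) → ZMod Q // Ideal.span (Set.range v) = ⊤} : ℝ) =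
        Q ^ (n + 1) * ∏ p ∈ Q.primeFactors, (1 - 1 / (p : ℝ) ^ (n + 1))) ∧
      (Nat.card {v : Fin (n + 1) → ZMod Q // Ideal.span (Set.range v) = ⊤} =
        Nat.totient Q *
          Nat.card {c : Quotient (MulAction.orbitRel (ZMod Q)ˣ (Fin (n + 1) → ZMod Q)) //
            ∃ v : Fin (n + 1) → ZMod Q, Ideal.span (Set.range v) = ⊤ ∧
              Quotient.mk (MulAction.orbitRel (ZMod Q)ˣ (Fin (n + 1) → ZMod Q)) v = c}) := by
  have : NeZero Q := ⟨Nat.one_le_iff_ne_zero.mp hQ⟩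
  refine ⟨card_unimodular_zmod n Q (NeZero.ne Q), ?_⟩
  rw [card_unimodular_eq_card_units_mul_card_orbits, Nat.card_eq_fintype_card (α := (ZMod Q)ˣ),
    ZMod.card_units_eq_totient]
end

section
/- Let p be a prime, let n ≥ 1 and k ≥ 1 be integers, and let a = (a_0, a_1, …, a_n) ∈ ℤ_p^{n+1} with a_0 a p-adic unit. Let μ be the Haar probability measure on ℤ_p^{n+1} (the (n+1)-fold product of the Haar probability measure on the compact group ℤ_p). Then the set W = { x ∈ ℤ_p^{n+1} : x_0 ≠ 0 and |x_i − (a_i/a_0)·x_0|_p ≤ p^{−k}·|x_0|_p for all 1 ≤ i ≤ n } satisfies μ(W) = (p − 1) / ( p^{n(k−1)} (p^{n+1} − 1) ). -/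
open MeasureTheory

namespace PadicInt

variable {p : ℕ} [Fact p.Prime] {n : ℕ}

theorem toZModPow_eq_zero_iff_norm_le (r : ℕ) (x : ℤ_[p]) :
    toZModPow r x = 0 ↔ ‖x‖ ≤ (p : ℝ) ^ (-(r : ℤ)) := by
  rw [norm_le_pow_iff_mem_span_pow, ← ker_toZModPow, RingHom.mem_ker]

/-- Reduction of the first coordinate modulo `p ^ r`, and of the minors `a 0 * x i - a i * x 0`
modulo `p ^ s`. -/
noncomputable def coneReduction (a : Fin (n + 1) → ℤ_[p]) (r s : ℕ) :
    (Fin (n + 1) → ℤ_[p]) →+ ZMod (p ^ r) × (Fin n → ZMod (p ^ s)) where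
  toFun x := (toZModPow r (x 0), fun i => toZModPow s (a 0 * x i.succ - a i.succ * x 0))
  map_zero' := by ext <;> simp
  map_add' x y := by
    ext
    · simp
    · simp only [Pi.add_apply, Prod.snd_add, ← map_add]
      congr 1
      ring

theorem coneReduction_surjective (a : Fin (n + 1) → ℤ_[p]) (ha : IsUnit (a 0)) (r s : ℕ) :
    Function.Surjective (coneReduction a r s) := by
  rintro ⟨u, v⟩
  obtain ⟨y, hy⟩ := ZMod.ringHom_surjective (toZModPow (p := p) r) u
  choose z hz using fun i => ZMod.ringHom_surjective (toZModPow (p := p) s) (v i)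
  obtain ⟨b, hb⟩ := ha.exists_right_inv
  refine ⟨Fin.cons y fun i => b * (z i + a i.succ * y), ?_⟩
  refine Prod.ext (by simpa [coneReduction] using hy) (funext fun i => ?_)
  simp only [coneReduction, AddMonoidHom.coe_mk, ZeroHom.coe_mk, Fin.cons_succ, Fin.cons_zero]
  rw [← hz i, ← mul_assoc, hb]
  congr 1
  ring

theorem mem_ker_coneReduction (a : Fin (n + 1) → ℤ_[p]) (r s : ℕ) (x : Fin (n + 1) → ℤ_[p]) :
    x ∈ (coneReduction a r s).ker ↔ ‖x 0‖ ≤ (p : ℝ) ^ (-(r : ℤ)) ∧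
      ∀ i : Fin (n + 1), i ≠ 0 → ‖a 0 * x i - a i * x 0‖ ≤ (p : ℝ) ^ (-(s : ℤ)) := by
  simp only [AddMonoidHom.mem_ker, coneReduction, AddMonoidHom.coe_mk, ZeroHom.coe_mk,
    Prod.ext_iff, funext_iff, Prod.fst_zero, Prod.snd_zero, Pi.zero_apply,
    toZModPow_eq_zero_iff_norm_le, Fin.forall_fin_succ (n := n)]
  simp

theorem index_ker_coneReduction (a : Fin (n + 1) → ℤ_[p]) (ha : IsUnit (a 0)) (r s : ℕ) :
    (coneReduction a r s).ker.index = p ^ (r + n * s) := by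
  rw [AddSubgroup.index_ker, AddMonoidHom.range_eq_top.2 (coneReduction_surjective a ha r s)]
  rw [Nat.card_congr AddSubgroup.topEquiv.toEquiv, Nat.card_prod, Nat.card_fun]
  simp [pow_add, pow_mul, mul_comm n s]

theorem isClosed_ker_coneReduction (a : Fin (n + 1) → ℤ_[p]) (r s : ℕ) :
    IsClosed ((coneReduction a r s).ker : Set (Fin (n + 1) → ℤ_[p])) := by
  have h : ((coneReduction a r s).ker : Set (Fin (n + 1) → ℤ_[p])) =
      {x | ‖x 0‖ ≤ (p : ℝ) ^ (-(r : ℤ))} ∩ ⋂ i : Fin (n + 1), ⋂ _ : i ≠ 0,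
        {x | ‖a 0 * x i - a i * x 0‖ ≤ (p : ℝ) ^ (-(s : ℤ))} := by
    ext x
    simp only [SetLike.mem_coe, mem_ker_coneReduction, Set.mem_inter_iff, Set.mem_iInter,
      Set.mem_ofPred_eq]
  rw [h]
  refine (isClosed_le (by fun_prop) continuous_const).inter ?_
  exact isClosed_iInter fun i => isClosed_iInter fun _ =>
    isClosed_le (by fun_prop) continuous_const

/-- The part of the affine cone over a residue disk where `‖x 0‖ = p ^ (-r)`. -/
def coneShell (a : Fin (n + 1) → ℤ_[p]) (k r : ℕ) : Set (Fin (n + 1) → ℤ_[p]) :=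
  ((coneReduction a r (k + r)).ker : Set _) \ (coneReduction a (r + 1) (k + r)).ker

theorem mem_coneShell (a : Fin (n + 1) → ℤ_[p]) (k r : ℕ) (x : Fin (n + 1) → ℤ_[p]) :
    x ∈ coneShell a k r ↔ ‖x 0‖ = (p : ℝ) ^ (-(r : ℤ)) ∧ ∀ i : Fin (n + 1), i ≠ 0 →
      ‖a 0 * x i - a i * x 0‖ ≤ (p : ℝ) ^ (-(k : ℤ)) * ‖x 0‖ := by
  have hp : (1 : ℝ) < p := mod_cast (Fact.out : p.Prime).one_lt
  have hkr : (p : ℝ) ^ (-((k + r : ℕ) : ℤ)) = (p : ℝ) ^ (-(k : ℤ)) * (p : ℝ) ^ (-(r : ℤ)) := by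
    rw [← zpow_add₀ (by positivity)]
    congr 1
    push_cast
    ring
  have hlt : ‖x 0‖ ≤ (p : ℝ) ^ (-((r + 1 : ℕ) : ℤ)) ↔ ‖x 0‖ < (p : ℝ) ^ (-(r : ℤ)) := by
    rw [norm_le_pow_iff_norm_lt_pow_add_one]
    simp
  simp only [coneShell, Set.mem_sdiff, SetLike.mem_coe, mem_ker_coneReduction, hlt, hkr]
  constructor
  · rintro ⟨⟨h₁, h₂⟩, h₃⟩
    have h : ‖x 0‖ = (p : ℝ) ^ (-(r : ℤ)) := h₁.antisymm (not_lt.1 fun h => h₃ ⟨h, h₂⟩)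
    exact ⟨h, h ▸ h₂⟩
  · rintro ⟨h₁, h₂⟩
    rw [h₁] at h₂ ⊢
    exact ⟨⟨le_rfl, h₂⟩, fun h => lt_irrefl _ h.1⟩

variable [MeasurableSpace ℤ_[p]] [BorelSpace ℤ_[p]]

theorem measurableSet_ker_coneReduction (a : Fin (n + 1) → ℤ_[p]) (r s : ℕ) :
    MeasurableSet ((coneReduction a r s).ker : Set (Fin (n + 1) → ℤ_[p])) :=
  (isClosed_ker_coneReduction a r s).measurableSet

theorem measure_ker_coneReduction (a : Fin (n + 1) → ℤ_[p]) (ha : IsUnit (a 0)) (r s : ℕ)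
    (μ : Measure (Fin (n + 1) → ℤ_[p])) [IsProbabilityMeasure μ] [μ.IsAddLeftInvariant] :
    μ (coneReduction a r s).ker = ENNReal.ofReal ((p : ℝ)⁻¹ ^ (r + n * s)) := by
  have hp : (0 : ℝ) < p := mod_cast (Fact.out : p.Prime).pos
  have hidx := index_ker_coneReduction a ha r s
  have : (coneReduction a r s).ker.FiniteIndex :=
    ⟨by rw [hidx]; exact pow_ne_zero _ (Fact.out : p.Prime).ne_zero⟩
  have h := AddSubgroup.index_mul_measure _ (measurableSet_ker_coneReduction a r s) μ
  rw [hidx, measure_univ, mul_comm] at h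
  rw [ENNReal.eq_inv_of_mul_eq_one_left h, inv_pow, ENNReal.ofReal_inv_of_pos (by positivity),
    ENNReal.ofReal_pow hp.le, ENNReal.ofReal_natCast, Nat.cast_pow]

theorem measure_coneShell (a : Fin (n + 1) → ℤ_[p]) (ha : IsUnit (a 0)) (k r : ℕ)
    (μ : Measure (Fin (n + 1) → ℤ_[p])) [IsProbabilityMeasure μ] [μ.IsAddLeftInvariant] :
    μ (coneShell a k r) =
      ENNReal.ofReal ((1 - (p : ℝ)⁻¹) * (p : ℝ)⁻¹ ^ (n * k) * ((p : ℝ)⁻¹ ^ (n + 1)) ^ r) := by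
  have hp : (1 : ℝ) < p := mod_cast (Fact.out : p.Prime).one_lt
  have hsub : ((coneReduction a (r + 1) (k + r)).ker : Set (Fin (n + 1) → ℤ_[p])) ⊆
      (coneReduction a r (k + r)).ker := by
    intro x hx
    rw [SetLike.mem_coe, mem_ker_coneReduction] at hx ⊢
    exact ⟨hx.1.trans (zpow_le_zpow_right₀ hp.le (by simp)), hx.2⟩
  rw [coneShell, measure_sdiff hsub (measurableSet_ker_coneReduction a _ _).nullMeasurableSet
    (measure_ne_top _ _), measure_ker_coneReduction a ha, measure_ker_coneReduction a ha,
    ← ENNReal.ofReal_sub _ (by positivity)]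
  congr 1
  ring

end PadicInt

/-- (Lemma 2.4 of the paper.) Let `p` be a prime, `n ≥ 1`, `k ≥ 1`, and let
`a ∈ ℤ_p^{n+1}` with `a 0` a `p`-adic unit. For the Haar probability measure `μ` on
`ℤ_p^{n+1}` (i.e. the unique translation-invariant Borel probability measure), the
affine cone
`W = {x : x 0 ≠ 0 and ‖x i − (a i / a 0)·x 0‖_p ≤ p^{-k}·‖x 0‖_p for i = 1,…,n}`
satisfies `μ(W) = (p-1)/(p^{n(k-1)}(p^{n+1}-1))`. (The congruence condition is
written as `‖a 0 * x i − a i * x 0‖ ≤ p^{-k}‖x 0‖`, which is equivalent since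
`‖a 0‖ = 1`.) -/
theorem haar_measure_affine_cone_residue_disk
    (p : ℕ) [Fact p.Prime] (n k : ℕ) (hn : 1 ≤ n) (hk : 1 ≤ k)
    (a : Fin (n + 1) → ℤ_[p]) (ha : IsUnit (a 0))
    [MeasurableSpace ℤ_[p]] [BorelSpace ℤ_[p]]
    (μ : Measure (Fin (n + 1) → ℤ_[p])) [IsProbabilityMeasure μ]
    (hinv : ∀ t : Fin (n + 1) → ℤ_[p], Measure.map (fun x => t + x) μ = μ) :
    μ {x : Fin (n + 1) → ℤ_[p] | x 0 ≠ 0 ∧ ∀ i : Fin (n + 1), i ≠ 0 →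
        ‖a 0 * x i - a i * x 0‖ ≤ (p : ℝ) ^ (-(k : ℤ)) * ‖x 0‖} =
      ENNReal.ofReal
        (((p : ℝ) - 1) / ((p : ℝ) ^ (n * (k - 1)) * ((p : ℝ) ^ (n + 1) - 1))) := by
  have : μ.IsAddLeftInvariant := ⟨hinv⟩
  have hp : (1 : ℝ) < p := mod_cast (Fact.out : p.Prime).one_lt
  have hp0 : (0 : ℝ) < p := by positivity
  have hq : (p : ℝ)⁻¹ < 1 := inv_lt_one_of_one_lt₀ hp
  have hqn : (p : ℝ)⁻¹ ^ (n + 1) < 1 := pow_lt_one₀ (by positivity) hq (by simp)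
  have hunion : {x : Fin (n + 1) → ℤ_[p] | x 0 ≠ 0 ∧ ∀ i : Fin (n + 1), i ≠ 0 →
        ‖a 0 * x i - a i * x 0‖ ≤ (p : ℝ) ^ (-(k : ℤ)) * ‖x 0‖} =
      ⋃ r, PadicInt.coneShell a k r := by
    ext x
    simp only [Set.mem_ofPred_eq, Set.mem_iUnion, PadicInt.mem_coneShell, exists_and_right]
    refine and_congr_left fun _ =>
      ⟨fun h => ⟨_, PadicInt.norm_eq_zpow_neg_valuation h⟩, ?_⟩
    rintro ⟨r, hr⟩ h
    rw [h, norm_zero] at hr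
    exact (zpow_pos hp0 _).ne hr
  have hdisj : Pairwise (Function.onFun Disjoint (PadicInt.coneShell a k)) := by
    intro r s hrs
    refine Set.disjoint_left.2 fun x hr hs => hrs ?_
    rw [PadicInt.mem_coneShell] at hr hs
    simpa using zpow_right_injective₀ hp0 hp.ne' (hr.1.symm.trans hs.1)
  rw [hunion, measure_iUnion hdisj fun r =>
    (PadicInt.measurableSet_ker_coneReduction a _ _).diff
      (PadicInt.measurableSet_ker_coneReduction a _ _)]
  simp_rw [PadicInt.measure_coneShell a ha]
  rw [← ENNReal.ofReal_tsum_of_nonneg, tsum_mul_left,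
    tsum_geometric_of_lt_one (by positivity) hqn]
  · obtain ⟨m, rfl⟩ := Nat.exists_eq_add_of_le' hk
    have h₁ : (p : ℝ) ^ (n + 1) - 1 ≠ 0 := (sub_pos.2 (one_lt_pow₀ hp (by simp))).ne'
    have h₂ : 1 - (p : ℝ)⁻¹ ^ (n + 1) = ((p : ℝ) ^ (n + 1) - 1) / (p : ℝ) ^ (n + 1) := by
      rw [inv_pow, sub_div, div_self (by positivity), one_div]
    rw [h₂, inv_pow, Nat.add_sub_cancel, mul_add, pow_add]
    congr 1
    field_simp
    ring
  · intro r
    have := sub_nonneg.2 hq.le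
    positivity
  · exact (summable_geometric_of_lt_one (by positivity) hqn).mul_left _
end

section
/- Let n ≥ 1 be an integer, let Δ ≥ 0 and C > 0 be real numbers, and let a : {primes} → ℝ_{≥0} be a function such that for all real B ≥ 2 one has | ∑_{p ≤ B} a_p − Δ·B^n/(n log B) | ≤ C·B^n/(log B)². Then there exist a real constant β and a constant C' > 0 such that for all real B ≥ 3: | ∑_{p ≤ B} a_p·(p − 1)/(p^{n+1} − 1) − Δ·log log B − β | ≤ C'/log B. -/
open MeasureTheory Finset

/-- The geometric sum `1 + t + ⋯ + tⁿ`, whose value at a prime power `q` is `#ℙⁿ(𝔽_q)`. -/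
noncomputable def projCard (n : ℕ) (t : ℝ) : ℝ := ∑ i ∈ range (n + 1), t ^ i

/-- The derivative of `projCard n`. -/
noncomputable def projCardDeriv (n : ℕ) (t : ℝ) : ℝ :=
  ∑ i ∈ range (n + 1), (i : ℝ) * t ^ (i - 1)

lemma hasDerivAt_projCard (n : ℕ) (t : ℝ) :
    HasDerivAt (projCard n) (projCardDeriv n t) t :=
  HasDerivAt.fun_sum fun i _ ↦ hasDerivAt_pow i t

lemma continuous_projCard (n : ℕ) : Continuous (projCard n) := by
  unfold projCard; fun_prop

lemma continuous_projCardDeriv (n : ℕ) : Continuous (projCardDeriv n) := by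
  unfold projCardDeriv; fun_prop

lemma mul_projCardDeriv (n : ℕ) (t : ℝ) :
    t * projCardDeriv n t = ∑ i ∈ range (n + 1), (i : ℝ) * t ^ i := by
  rw [projCardDeriv, mul_sum]
  refine sum_congr rfl fun i _ ↦ ?_
  cases i with
  | zero => simp
  | succ k => simp only [Nat.add_sub_cancel]; ring

lemma pow_le_projCard (n : ℕ) {t : ℝ} (ht : 0 ≤ t) : t ^ n ≤ projCard n t :=
  single_le_sum (f := fun i ↦ t ^ i) (fun i _ ↦ pow_nonneg ht i) (self_mem_range_succ n)

lemma projCard_pos (n : ℕ) {t : ℝ} (ht : 0 < t) : 0 < projCard n t :=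
  (pow_pos ht n).trans_le (pow_le_projCard n ht.le)

lemma inv_projCard (n : ℕ) {t : ℝ} (ht : t ≠ 1) :
    (projCard n t)⁻¹ = (t - 1) / (t ^ (n + 1) - 1) := by
  rw [projCard, geom_sum_eq ht, inv_div]

lemma mul_projCard_le (n : ℕ) {t : ℝ} (ht : 1 ≤ t) :
    t * projCard n t ≤ t ^ n * (t + n) := by
  have h : ∑ i ∈ range n, t * t ^ i ≤ ∑ _i ∈ range n, t ^ n := by
    refine sum_le_sum fun i hi ↦ ?_
    rw [← pow_succ']
    exact pow_le_pow_right₀ ht (mem_range.mp hi)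
  rw [sum_const, card_range, nsmul_eq_mul, ← mul_sum] at h
  rw [projCard, sum_range_succ]
  linarith

lemma natCast_mul_pow_le_mul_projCardDeriv (n : ℕ) {t : ℝ} (ht : 0 ≤ t) :
    n * t ^ n ≤ t * projCardDeriv n t := by
  rw [mul_projCardDeriv]
  exact single_le_sum (f := fun i : ℕ ↦ (i : ℝ) * t ^ i) (fun i _ ↦ by positivity)
    (self_mem_range_succ n)

lemma mul_projCardDeriv_le (n : ℕ) {t : ℝ} (ht : 0 ≤ t) :
    t * projCardDeriv n t ≤ n * projCard n t := by
  rw [mul_projCardDeriv, projCard, mul_sum]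
  refine sum_le_sum fun i hi ↦ ?_
  gcongr
  exact Nat.lt_succ_iff.mp (mem_range.mp hi)

lemma pow_mul_projCardDeriv_div_sq_le (n : ℕ) {t : ℝ} (ht : 0 < t) :
    t ^ (n + 1) * (projCardDeriv n t / projCard n t ^ 2) ≤ n := by
  have hG := projCard_pos n ht
  rw [← mul_div_assoc, div_le_iff₀ (by positivity)]
  calc t ^ (n + 1) * projCardDeriv n t = t ^ n * (t * projCardDeriv n t) := by ring
    _ ≤ projCard n t * (n * projCard n t) := by
        refine mul_le_mul (pow_le_projCard n ht.le) (mul_projCardDeriv_le n ht.le) ?_ hG.le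
        exact (by positivity : (0 : ℝ) ≤ n * t ^ n).trans
          (natCast_mul_pow_le_mul_projCardDeriv n ht.le)
    _ = n * projCard n t ^ 2 := by ring

lemma le_pow_mul_projCardDeriv_div_sq (n : ℕ) {t : ℝ} (ht : 1 ≤ t) :
    n - 2 * n ^ 2 / t ≤ t ^ (n + 1) * (projCardDeriv n t / projCard n t ^ 2) := by
  have ht0 : 0 < t := by linarith
  have hG := projCard_pos n ht0
  set x := t ^ n / projCard n t with hx
  have hx0 : 0 ≤ x := by positivity
  have hx1 : x ≤ 1 := div_le_one_of_le₀ (pow_le_projCard n ht0.le) hG.le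
  have hxn : 1 - n / t ≤ x := by
    have h1 : 1 ≤ x * (1 + n / t) := by
      rw [hx, div_mul_eq_mul_div, le_div_iff₀ hG, one_mul,
        show t ^ n * (1 + n / t) = t ^ n * (t + n) / t by field_simp, le_div_iff₀ ht0, mul_comm]
      exact mul_projCard_le n ht
    have h2 : x * (n / t) ≤ n / t := mul_le_of_le_one_left (by positivity) hx1
    linarith
  have hx2 : 1 - 2 * (n / t) ≤ x ^ 2 := by nlinarith
  calc (n : ℝ) - 2 * n ^ 2 / t = n * (1 - 2 * (n / t)) := by ring
    _ ≤ n * x ^ 2 := by gcongr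
    _ = t ^ n * (n * t ^ n) / projCard n t ^ 2 := by rw [hx]; field_simp
    _ ≤ t ^ n * (t * projCardDeriv n t) / projCard n t ^ 2 := by
        gcongr ?_ * ?_ / _
        exact natCast_mul_pow_le_mul_projCardDeriv n ht0.le
    _ = _ := by ring

lemma hasDerivAt_neg_inv_log {t : ℝ} (ht : 1 < t) :
    HasDerivAt (fun x ↦ -(Real.log x)⁻¹) (1 / (t * Real.log t ^ 2)) t := by
  have hl := (Real.log_pos ht).ne'
  have ht0 : t ≠ 0 := by positivity
  refine ((Real.hasDerivAt_log ht0).fun_inv hl).fun_neg.congr_deriv ?_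
  field_simp

lemma tendsto_neg_inv_log :
    Filter.Tendsto (fun x ↦ -(Real.log x)⁻¹) Filter.atTop (nhds 0) := by
  simpa using Real.tendsto_log_atTop.inv_tendsto_atTop.neg

lemma integrableOn_Ioi_one_div_mul_log_sq {b : ℝ} (hb : 1 < b) :
    IntegrableOn (fun t ↦ 1 / (t * Real.log t ^ 2)) (Set.Ioi b) :=
  integrableOn_Ioi_deriv_of_nonneg' (fun t ht ↦ hasDerivAt_neg_inv_log (hb.trans_le ht))
    (fun t ht ↦ by have : 0 < t := by linarith [Set.mem_Ioi.mp ht]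
                   positivity) tendsto_neg_inv_log

lemma integral_Ioi_one_div_mul_log_sq {b : ℝ} (hb : 1 < b) :
    ∫ t in Set.Ioi b, 1 / (t * Real.log t ^ 2) = 1 / Real.log b := by
  rw [integral_Ioi_of_hasDerivAt_of_tendsto'
    (fun t ht ↦ hasDerivAt_neg_inv_log (hb.trans_le ht))
    (integrableOn_Ioi_one_div_mul_log_sq hb) tendsto_neg_inv_log]
  simp

lemma hasDerivAt_log_log {t : ℝ} (ht : 1 < t) :
    HasDerivAt (fun x ↦ Real.log (Real.log x)) (1 / (t * Real.log t)) t := by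
  convert (Real.hasDerivAt_log (by positivity : t ≠ 0)).log (Real.log_pos ht).ne' using 1
  field_simp

lemma continuousOn_one_div_mul_log : ContinuousOn (fun t ↦ 1 / (t * Real.log t)) (Set.Ioi 1) := by
  have h0 : ∀ t ∈ Set.Ioi (1 : ℝ), t ≠ 0 := fun t ht ↦ (zero_lt_one.trans ht).ne'
  exact continuousOn_const.div (continuousOn_id.mul (continuousOn_id.log h0))
    fun t ht ↦ mul_ne_zero (h0 t ht) (Real.log_pos ht).ne'

lemma integral_one_div_mul_log {b c : ℝ} (hb : 1 < b) (hbc : b ≤ c) :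
    ∫ t in b..c, 1 / (t * Real.log t) = Real.log (Real.log c) - Real.log (Real.log b) := by
  have hsub : Set.uIcc b c ⊆ Set.Ioi 1 := by
    rw [Set.uIcc_of_le hbc]
    exact fun t ht ↦ hb.trans_le ht.1
  exact intervalIntegral.integral_eq_sub_of_hasDerivAt
    (fun t ht ↦ hasDerivAt_log_log (hsub ht))
    (continuousOn_one_div_mul_log.mono hsub).intervalIntegrable

lemma abs_mul_sub_div_mul_log_le {n : ℕ} (hn : 1 ≤ n) {Δ C s t : ℝ} (hΔ : 0 ≤ Δ) (ht : 2 ≤ t)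
    (hs : |s - Δ * t ^ n / (n * Real.log t)| ≤ C * t ^ n / Real.log t ^ 2) :
    |projCardDeriv n t / projCard n t ^ 2 * s - Δ * (1 / (t * Real.log t))| ≤
      (n * C + 2 * n * Δ) * (1 / (t * Real.log t ^ 2)) := by
  have ht0 : 0 < t := by linarith
  have hl : 0 < Real.log t := Real.log_pos (by linarith)
  have hn0 : (0 : ℝ) < n := by exact_mod_cast hn
  have hlt : Real.log t ≤ t := Real.log_le_self ht0.le
  have hup := pow_mul_projCardDeriv_div_sq_le n ht0
  have hlow := le_pow_mul_projCardDeriv_div_sq n (by linarith : 1 ≤ t)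
  have hh : 0 ≤ projCardDeriv n t / projCard n t ^ 2 := by
    unfold projCardDeriv; positivity
  set h := projCardDeriv n t / projCard n t ^ 2
  have hsplit : h * s - Δ * (1 / (t * Real.log t)) =
      h * (s - Δ * t ^ n / (n * Real.log t)) +
        Δ / (n * (t * Real.log t)) * (t ^ (n + 1) * h - n) := by
    field_simp
    ring
  have h1 : |h * (s - Δ * t ^ n / (n * Real.log t))| ≤ n * C * (1 / (t * Real.log t ^ 2)) := by
    have hC : 0 ≤ C * (1 / (t * Real.log t ^ 2)) := by
      have := (abs_nonneg _).trans hs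
      have : 0 ≤ C * t ^ n / Real.log t ^ 2 / t ^ (n + 1) := by positivity
      convert this using 1
      field_simp
      ring
    rw [abs_mul, abs_of_nonneg hh]
    calc h * |s - Δ * t ^ n / (n * Real.log t)| ≤ h * (C * t ^ n / Real.log t ^ 2) := by gcongr
      _ = (t ^ (n + 1) * h) * (C * (1 / (t * Real.log t ^ 2))) := by
          field_simp
          ring
      _ ≤ n * (C * (1 / (t * Real.log t ^ 2))) := by gcongr
      _ = _ := by ring
  have h2 : |Δ / (n * (t * Real.log t)) * (t ^ (n + 1) * h - n)| ≤
      2 * n * Δ * (1 / (t * Real.log t ^ 2)) := by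
    have h3 : |t ^ (n + 1) * h - n| ≤ 2 * n ^ 2 / Real.log t := by
      have h4 : (2 : ℝ) * n ^ 2 / t ≤ 2 * n ^ 2 / Real.log t := by gcongr
      have h5 : (0 : ℝ) ≤ 2 * n ^ 2 / Real.log t := by positivity
      rw [abs_le]
      constructor <;> linarith
    rw [abs_mul, abs_of_nonneg (by positivity)]
    calc _ ≤ Δ / (n * (t * Real.log t)) * (2 * n ^ 2 / Real.log t) := by gcongr
      _ = _ := by field_simp
  rw [hsplit, add_mul]
  exact (abs_add_le _ _).trans (add_le_add h1 h2)

lemma abs_inv_projCard_mul_le {n : ℕ} (hn : 1 ≤ n) {Δ C s t : ℝ} (hΔ : 0 ≤ Δ) (hC : 0 < C)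
    (ht : 2 ≤ t)
    (hs : |s - Δ * t ^ n / (n * Real.log t)| ≤ C * t ^ n / Real.log t ^ 2) :
    |(projCard n t)⁻¹ * s| ≤ (Δ + C / Real.log 2) / Real.log t := by
  have ht0 : 0 < t := by linarith
  have hl2 : 0 < Real.log 2 := Real.log_pos one_lt_two
  have hl : Real.log 2 ≤ Real.log t := Real.log_le_log two_pos ht
  have hl0 : 0 < Real.log t := hl2.trans_le hl
  have hn1 : (1 : ℝ) ≤ n := by exact_mod_cast hn
  have hG := projCard_pos n ht0
  have hs' : |s| ≤ t ^ n * ((Δ + C / Real.log 2) / Real.log t) := by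
    have h1 : |Δ * t ^ n / (n * Real.log t)| ≤ t ^ n * (Δ / Real.log t) := by
      rw [abs_of_nonneg (by positivity)]
      calc Δ * t ^ n / (n * Real.log t) ≤ Δ * t ^ n / (1 * Real.log t) := by gcongr
        _ = _ := by ring
    have h2 : C * t ^ n / Real.log t ^ 2 ≤ t ^ n * (C / Real.log 2 / Real.log t) := by
      calc C * t ^ n / Real.log t ^ 2 ≤ C * t ^ n / (Real.log 2 * Real.log t) := by
            rw [sq]; gcongr
        _ = _ := by field_simp
    calc |s| = |(s - Δ * t ^ n / (n * Real.log t)) + Δ * t ^ n / (n * Real.log t)| := by ring_nf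
      _ ≤ _ := abs_add_le _ _
      _ ≤ t ^ n * (C / Real.log 2 / Real.log t) + t ^ n * (Δ / Real.log t) :=
          add_le_add (hs.trans h2) h1
      _ = _ := by ring
  rw [abs_mul, abs_of_pos (inv_pos.mpr hG), inv_mul_le_iff₀ hG]
  refine hs'.trans ?_
  gcongr
  exact pow_le_projCard n ht0.le

lemma sum_inv_projCard_mul (n : ℕ) {c : ℕ → ℝ} (hc0 : c 0 = 0) (hc1 : c 1 = 0) {b : ℝ}
    (hb : 2 ≤ b) :
    ∑ k ∈ Icc 0 ⌊b⌋₊, (projCard n k)⁻¹ * c k =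
      (projCard n b)⁻¹ * (∑ k ∈ Icc 0 ⌊b⌋₊, c k) +
        ∫ t in (2 : ℝ)..b, projCardDeriv n t / projCard n t ^ 2 * ∑ k ∈ Icc 0 ⌊t⌋₊, c k := by
  have hG : ∀ t ∈ Set.Icc 2 b, projCard n t ≠ 0 := fun t ht ↦
    (projCard_pos n (by linarith [ht.1])).ne'
  have hd : ∀ t ∈ Set.Icc 2 b, HasDerivAt (fun t ↦ (projCard n t)⁻¹)
      (-projCardDeriv n t / projCard n t ^ 2) t := fun t ht ↦
    (hasDerivAt_projCard n t).fun_inv (hG t ht)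
  have hint : IntegrableOn (deriv fun t ↦ (projCard n t)⁻¹) (Set.Icc 2 b) := by
    refine IntegrableOn.congr_fun (f := fun t ↦ -projCardDeriv n t / projCard n t ^ 2) ?_
      (fun t ht ↦ (hd t ht).deriv.symm) measurableSet_Icc
    exact ((continuous_projCardDeriv n).neg.continuousOn.div
      ((continuous_projCard n).pow 2).continuousOn
      fun t ht ↦ pow_ne_zero 2 (hG t ht)).integrableOn_Icc
  rw [sum_mul_eq_sub_integral_mul₁ c (f := fun t ↦ (projCard n t)⁻¹) hc0 hc1 b
    (fun t ht ↦ (hd t ht).differentiableAt) hint, sub_eq_add_neg, ← integral_neg,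
    intervalIntegral.integral_of_le hb]
  congr 1
  refine setIntegral_congr_fun measurableSet_Ioc fun t ht ↦ ?_
  simp only [(hd t (Set.Ioc_subset_Icc_self ht)).deriv]
  ring

lemma abs_integral_Ioi_le {R : ℝ → ℝ} {K b : ℝ} (hb : 1 < b)
    (hR : ∀ t, b < t → |R t| ≤ K * (1 / (t * Real.log t ^ 2))) :
    |∫ t in Set.Ioi b, R t| ≤ K / Real.log b := by
  rw [← Real.norm_eq_abs]
  calc ‖∫ t in Set.Ioi b, R t‖ ≤ ∫ t in Set.Ioi b, K * (1 / (t * Real.log t ^ 2)) :=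
        norm_integral_le_of_norm_le ((integrableOn_Ioi_one_div_mul_log_sq hb).const_mul K)
          ((ae_restrict_iff' measurableSet_Ioi).mpr (.of_forall fun t ht ↦ hR t ht))
    _ = K / Real.log b := by
        rw [integral_const_mul, integral_Ioi_one_div_mul_log_sq hb, mul_one_div]

/-- Analytic content of Proposition 3.6 of the paper: if the nonnegative
quantities `a p` (over primes `p`) satisfy
`∑_{p ≤ B} a p = Δ·B^n/(n log B) + O(B^n/(log B)^2)`, then there is a constant `β`
with `∑_{p ≤ B} a p·(p-1)/(p^{n+1}-1) = Δ·log log B + β + O(1/log B)`.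
(Here `(p-1)/(p^{n+1}-1) = 1/#ℙⁿ(𝔽_p)`.) -/
theorem partial_summation_loglog_proj (n : ℕ) (hn : 1 ≤ n) (Δ C : ℝ) (hΔ : 0 ≤ Δ)
    (hC : 0 < C) (a : ℕ → ℝ) (ha : ∀ p : ℕ, p.Prime → 0 ≤ a p)
    (hbound : ∀ B : ℝ, 2 ≤ B →
      |(∑ p ∈ (Finset.range (⌊B⌋₊ + 1)).filter Nat.Prime, a p) -
          Δ * B ^ n / (n * Real.log B)| ≤ C * B ^ n / Real.log B ^ 2) :
    ∃ β C' : ℝ, 0 < C' ∧ ∀ B : ℝ, 3 ≤ B →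
      |(∑ p ∈ (Finset.range (⌊B⌋₊ + 1)).filter Nat.Prime, a p * ((p : ℝ) - 1) / ((p : ℝ) ^ (n + 1) - 1)) -
          Δ * Real.log (Real.log B) - β| ≤ C' / Real.log B := by
  classical
  let c : ℕ → ℝ := fun k ↦ if k.Prime then a k else 0
  let S : ℝ → ℝ := fun t ↦ ∑ k ∈ Icc 0 ⌊t⌋₊, c k
  let h : ℝ → ℝ := fun t ↦ projCardDeriv n t / projCard n t ^ 2
  let R : ℝ → ℝ := fun t ↦ h t * S t - Δ * (1 / (t * Real.log t))
  have hsum (u : ℕ → ℝ) (N : ℕ) : ∑ p ∈ (range (N + 1)).filter Nat.Prime, u p =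
      ∑ k ∈ Icc 0 N, if k.Prime then u k else 0 := by
    rw [sum_filter, range_eq_Ico, Ico_add_one_right_eq_Icc]
  have hS : ∀ t : ℝ, 2 ≤ t →
      |S t - Δ * t ^ n / (n * Real.log t)| ≤ C * t ^ n / Real.log t ^ 2 := fun t ht ↦ by
    simpa only [hsum] using hbound t ht
  set K : ℝ := n * C + 2 * n * Δ
  have hR : ∀ t : ℝ, 2 ≤ t → |R t| ≤ K * (1 / (t * Real.log t ^ 2)) := fun t ht ↦
    abs_mul_sub_div_mul_log_le hn hΔ ht (hS t ht)
  have hSmeas : Measurable S :=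
    (measurable_from_nat (f := fun N ↦ ∑ k ∈ Icc 0 N, c k)).comp Nat.measurable_floor
  have hRmeas : Measurable R := by
    have hh : Measurable h :=
      (continuous_projCardDeriv n).measurable.div ((continuous_projCard n).measurable.pow_const 2)
    have hl : Measurable fun t : ℝ ↦ Δ * (1 / (t * Real.log t)) := by fun_prop
    exact (hh.mul hSmeas).sub hl
  have hRint : IntegrableOn R (Set.Ioi 2) :=
    ((integrableOn_Ioi_one_div_mul_log_sq one_lt_two).const_mul K).mono'
      hRmeas.aestronglyMeasurable
      ((ae_restrict_iff' measurableSet_Ioi).mpr (.of_forall fun t ht ↦ hR t (le_of_lt ht)))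
  have hK : 0 ≤ K := by positivity
  have hl2 : 0 < Real.log 2 := Real.log_pos one_lt_two
  refine ⟨(∫ t in Set.Ioi 2, R t) - Δ * Real.log (Real.log 2), Δ + C / Real.log 2 + K,
    by positivity, fun B hB ↦ ?_⟩
  have hB2 : 2 ≤ B := by linarith
  have hlhs : ∑ p ∈ (range (⌊B⌋₊ + 1)).filter Nat.Prime,
      a p * ((p : ℝ) - 1) / ((p : ℝ) ^ (n + 1) - 1) =
      ∑ k ∈ Icc 0 ⌊B⌋₊, (projCard n k)⁻¹ * c k := by
    rw [hsum]
    refine sum_congr rfl fun k _ ↦ ?_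
    by_cases hk : k.Prime
    · simp only [c, if_pos hk]
      rw [inv_projCard n (by exact_mod_cast hk.one_lt.ne'), mul_comm _ (a k), mul_div_assoc]
    · simp [c, hk]
  have hRB : IntervalIntegrable R volume 2 B :=
    (intervalIntegrable_iff_integrableOn_Ioc_of_le hB2).mpr
      (hRint.mono_set Set.Ioc_subset_Ioi_self)
  have hlogint : IntervalIntegrable (fun t ↦ Δ * (1 / (t * Real.log t))) volume 2 B := by
    refine ((continuousOn_one_div_mul_log.mono ?_).intervalIntegrable).const_mul Δ
    rw [Set.uIcc_of_le hB2]
    exact fun t ht ↦ one_lt_two.trans_le ht.1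
  have hmain : ∫ t in (2 : ℝ)..B, h t * S t =
      (∫ t in (2 : ℝ)..B, R t) + Δ * (Real.log (Real.log B) - Real.log (Real.log 2)) := by
    rw [← integral_one_div_mul_log one_lt_two hB2, ← intervalIntegral.integral_const_mul,
      ← intervalIntegral.integral_add hRB hlogint]
    simp only [R, sub_add_cancel]
  have htail : (∫ t in Set.Ioi 2, R t) = (∫ t in (2 : ℝ)..B, R t) + ∫ t in Set.Ioi B, R t :=
    (intervalIntegral.integral_interval_add_Ioi hRint
      (hRint.mono_set (Set.Ioi_subset_Ioi hB2))).symm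
  rw [hlhs, sum_inv_projCard_mul n (by simp [c, Nat.not_prime_zero]) (by simp [c, Nat.not_prime_one]) hB2, hmain,
    htail]
  calc _ = |(projCard n B)⁻¹ * S B - ∫ t in Set.Ioi B, R t| := by
        congr 1
        ring
    _ ≤ |(projCard n B)⁻¹ * S B| + |∫ t in Set.Ioi B, R t| := abs_sub _ _
    _ ≤ (Δ + C / Real.log 2) / Real.log B + K / Real.log B :=
        add_le_add (abs_inv_projCard_mul_le hn hΔ hC hB2 (hS B hB2))
          (abs_integral_Ioi_le (by linarith) fun t ht ↦ hR t (hB2.trans ht.le))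
    _ = (Δ + C / Real.log 2 + K) / Real.log B := by rw [← add_div]
end

section
/- Let d ≥ 1 and α ≥ 1 be real numbers, and let σ be a real-valued function on the primes with 0 ≤ σ_p ≤ d/p for every prime p. Let Q > 1 be a squarefree integer with smallest prime factor p₁ and with ω(Q) distinct prime factors, and let ψ ∈ {−1, +1}. Then | ∏_{p ∣ Q} (σ_p + ψ·α/p²) − ∏_{p ∣ Q} σ_p | ≤ (2αd)^{ω(Q)} / (Q · p₁). -/
/-- If each factor `a i` is perturbed by `e i`, with `|a i| ≤ b i` and `|e i| ≤ t * b i` for some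
`t ≤ 1`, then the product changes by at most `(2 ^ #s - 1) * t * ∏ b i`. -/
theorem abs_prod_add_sub_prod_le {ι : Type*} (s : Finset ι) (a e b : ι → ℝ) {t : ℝ}
    (ht0 : 0 ≤ t) (ht1 : t ≤ 1) (ha : ∀ i ∈ s, |a i| ≤ b i) (he : ∀ i ∈ s, |e i| ≤ t * b i) :
    |(∏ i ∈ s, (a i + e i)) - ∏ i ∈ s, a i| ≤ (2 ^ s.card - 1) * t * ∏ i ∈ s, b i := by
  classical
  induction s using Finset.induction_on with
  | empty => simp
  | insert j s hj ih =>
    have ih := ih (fun i hi => ha i (Finset.mem_insert_of_mem hi))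
      (fun i hi => he i (Finset.mem_insert_of_mem hi))
    have haj := ha j (Finset.mem_insert_self j s)
    have hej := he j (Finset.mem_insert_self j s)
    have hb : 0 ≤ b j := (abs_nonneg _).trans haj
    have hprod : |∏ i ∈ s, a i| ≤ ∏ i ∈ s, b i := by
      rw [Finset.abs_prod]
      exact Finset.prod_le_prod (fun _ _ => abs_nonneg _)
        (fun i hi => ha i (Finset.mem_insert_of_mem hi))
    have hsum : |a j + e j| ≤ 2 * b j := by
      have := abs_add_le (a j) (e j)
      have := mul_le_mul_of_nonneg_right ht1 hb
      linarith
    rw [Finset.prod_insert hj, Finset.prod_insert hj, Finset.prod_insert hj,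
      Finset.card_insert_of_notMem hj]
    calc |(a j + e j) * ∏ i ∈ s, (a i + e i) - a j * ∏ i ∈ s, a i|
        = |(a j + e j) * ((∏ i ∈ s, (a i + e i)) - ∏ i ∈ s, a i) + e j * ∏ i ∈ s, a i| := by
          congr 1
          ring
      _ ≤ |a j + e j| * |(∏ i ∈ s, (a i + e i)) - ∏ i ∈ s, a i| + |e j| * |∏ i ∈ s, a i| := by
          rw [← abs_mul, ← abs_mul]
          exact abs_add_le _ _
      _ ≤ 2 * b j * ((2 ^ s.card - 1) * t * ∏ i ∈ s, b i) + t * b j * ∏ i ∈ s, b i := by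
          gcongr
      _ = (2 ^ (s.card + 1) - 1) * t * (b j * ∏ i ∈ s, b i) := by ring


/-- (Lemma 3.9 of the paper.) If `0 ≤ σ_p ≤ d/p` for all primes `p`, `Q > 1` is
squarefree with smallest prime factor `p₁`, `α ≥ 1`, `d ≥ 1` and `ψ = ±1`, then
`|∏_{p∣Q}(σ_p + ψ·α/p²) − ∏_{p∣Q} σ_p| ≤ (2αd)^{ω(Q)}/(Q·p₁)`. -/
theorem prod_perturbed_densities_diff (d α : ℝ) (hd : 1 ≤ d) (hα : 1 ≤ α)
    (σ : ℕ → ℝ) (hσ : ∀ p : ℕ, p.Prime → 0 ≤ σ p ∧ σ p ≤ d / p)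
    (Q : ℕ) (hQ : 1 < Q) (hsf : Squarefree Q) (ψ : ℝ) (hψ : ψ = 1 ∨ ψ = -1) :
    |(∏ p ∈ Q.primeFactors, (σ p + ψ * α / (p : ℝ) ^ 2)) -
        ∏ p ∈ Q.primeFactors, σ p| ≤
      (2 * α * d) ^ Q.primeFactors.card / ((Q : ℝ) * Q.minFac) := by
  have hm : (1 : ℝ) ≤ Q.minFac := by exact_mod_cast Q.minFac_pos
  have hm0 : (0 : ℝ) < Q.minFac := by linarith
  have hαd : α ≤ α * d := le_mul_of_one_le_right (by linarith) hd
  have hdα : d ≤ α * d := le_mul_of_one_le_left (by linarith) hα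
  have hC : 0 ≤ α * d := by linarith
  have key := abs_prod_add_sub_prod_le Q.primeFactors σ (fun p => ψ * α / (p : ℝ) ^ 2)
    (fun p => α * d / p) (t := (Q.minFac : ℝ)⁻¹) (by positivity) (inv_le_one_of_one_le₀ hm)
    (fun p hp => by
      obtain ⟨h0, h1⟩ := hσ p (Nat.prime_of_mem_primeFactors hp)
      rw [abs_of_nonneg h0]
      exact h1.trans (by gcongr))
    (fun p hp => by
      have hpp := Nat.prime_of_mem_primeFactors hp
      have hp0 : (0 : ℝ) < p := by exact_mod_cast hpp.pos
      have hle : (Q.minFac : ℝ) ≤ p := by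
        exact_mod_cast Nat.minFac_le_of_dvd hpp.two_le (Nat.dvd_of_mem_primeFactors hp)
      have hψ1 : |ψ| = 1 := by rcases hψ with rfl | rfl <;> simp
      calc |ψ * α / (p : ℝ) ^ 2| = α / ((p : ℝ) * p) := by
            rw [abs_div, abs_mul, hψ1, one_mul, abs_of_nonneg (by linarith : 0 ≤ α),
              abs_of_pos (by positivity), sq]
        _ ≤ α * d / ((Q.minFac : ℝ) * p) := by gcongr
        _ = (Q.minFac : ℝ)⁻¹ * (α * d / p) := by field_simp)
  have hprod : ∏ p ∈ Q.primeFactors, (p : ℝ) = Q := by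
    rw [← Nat.cast_prod, Nat.prod_primeFactors_of_squarefree hsf]
  rw [Finset.prod_div_distrib, Finset.prod_const, hprod] at key
  calc _ ≤ _ := key
    _ ≤ 2 ^ Q.primeFactors.card * (Q.minFac : ℝ)⁻¹ * ((α * d) ^ Q.primeFactors.card / Q) := by
        gcongr
        exact sub_le_self _ zero_le_one
    _ = (2 * α * d) ^ Q.primeFactors.card / ((Q : ℝ) * Q.minFac) := by
        rw [mul_assoc 2 α d, mul_pow 2 (α * d)]
        field_simp
end

section
/- (Granville–Soundararajan, even moments.) There is an absolute constant K > 0 with the following property. Let 𝒫 be a finite set of primes and let 𝒜 = {a_1, …, a_y} be a multiset of y natural numbers; for Q ∈ ℕ set 𝒜_Q := #{m ≤ y : Q ∣ a_m}. Let h : ℕ → ℝ be a nonnegative multiplicative function with 0 ≤ h(Q) ≤ Q for all squarefree Q. Set μ_𝒫(h) := ∑_{p ∈ 𝒫} h(p)/p, σ_𝒫(h) := (∑_{p ∈ 𝒫} (h(p)/p)(1 − h(p)/p))^{1/2}, C_r := Γ(r+1)/(2^{r/2} Γ(1 + r/2)), and ℰ_𝒫(𝒜,h,r) := ∑ |𝒜_Q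 − (h(Q)/Q)·y|, the sum over squarefree Q all of whose prime factors lie in 𝒫 and with ω(Q) ≤ r. Then for every even integer r with 0 < r ≤ σ_𝒫(h)^{2/3}: | ∑_{a ∈ 𝒜} (#{p ∈ 𝒫 : p ∣ a} − μ_𝒫(h))^r − C_r·y·σ_𝒫(h)^r | ≤ K·( C_r·y·σ_𝒫(h)^{r−2}·r³ + μ_𝒫(h)^r·ℰ_𝒫(𝒜,h,r) ). -/
namespace GranvilleSoundararajan

open PowerSeries Finset
open scoped Nat

/-- The power series `exp (a t)`. -/
noncomputable def expSeries (a : ℝ) : PowerSeries ℝ := rescale a (PowerSeries.exp ℝ)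

lemma coeff_expSeries (a : ℝ) (n : ℕ) : coeff n (expSeries a) = a ^ n / n ! := by
  simp [expSeries, coeff_rescale, div_eq_mul_inv]

lemma expSeries_zero : expSeries 0 = 1 := by
  simp [expSeries]

lemma expSeries_add (a b : ℝ) : expSeries (a + b) = expSeries a * expSeries b :=
  (exp_mul_exp_eq_exp_add a b).symm

lemma expSeries_sum {ι : Type*} (s : Finset ι) (f : ι → ℝ) :
    expSeries (∑ i ∈ s, f i) = ∏ i ∈ s, expSeries (f i) := by
  classical
  induction s using Finset.induction_on with
  | empty => simp [expSeries_zero]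
  | insert i s hi ih => rw [sum_insert hi, prod_insert hi, expSeries_add, ih]

lemma derivative_expSeries (a : ℝ) :
    derivative ℝ (expSeries a) = C a * expSeries a := by
  ext n
  rw [coeff_derivative, coeff_C_mul, coeff_expSeries, coeff_expSeries, Nat.factorial_succ]
  push_cast
  field_simp
  ring

/-- The coefficient of `n.choose s` in the expansion of `(n - μ) ^ r`. -/
noncomputable def chooseCoeff (μ : ℝ) (r s : ℕ) : ℝ :=
  r ! * coeff r (expSeries (-μ) * (expSeries 1 - 1) ^ s)

lemma factorial_mul_coeff_succ (f : PowerSeries ℝ) (r : ℕ) :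
    ((r + 1)! : ℝ) * coeff (r + 1) f = r ! * coeff r (derivative ℝ f) := by
  rw [coeff_derivative, Nat.factorial_succ]
  push_cast
  ring

lemma chooseCoeff_succ_zero (μ : ℝ) (r : ℕ) :
    chooseCoeff μ (r + 1) 0 = -μ * chooseCoeff μ r 0 := by
  simp only [chooseCoeff, pow_zero, mul_one]
  rw [factorial_mul_coeff_succ, derivative_expSeries, coeff_C_mul]
  ring

lemma chooseCoeff_succ_succ (μ : ℝ) (r s : ℕ) :
    chooseCoeff μ (r + 1) (s + 1) =
      (s + 1 - μ) * chooseCoeff μ r (s + 1) + (s + 1) * chooseCoeff μ r s := by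
  have key : derivative ℝ (expSeries (-μ) * (expSeries 1 - 1) ^ (s + 1)) =
      C (s + 1 - μ : ℝ) * (expSeries (-μ) * (expSeries 1 - 1) ^ (s + 1)) +
        C (s + 1 : ℝ) * (expSeries (-μ) * (expSeries 1 - 1) ^ s) := by
    rw [Derivation.leibniz, derivative_pow, map_sub, derivative_expSeries, derivative_expSeries,
      derivative_one]
    simp only [smul_eq_mul, map_sub, map_add, map_one, map_neg, map_natCast, Nat.add_sub_cancel]
    push_cast
    ring
  simp only [chooseCoeff]
  rw [factorial_mul_coeff_succ, key, map_add, coeff_C_mul, coeff_C_mul]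
  ring

lemma chooseCoeff_zero_zero (μ : ℝ) : chooseCoeff μ 0 0 = 1 := by
  simp [chooseCoeff, coeff_expSeries]

lemma chooseCoeff_eq_zero (μ : ℝ) {r s : ℕ} (h : r < s) : chooseCoeff μ r s = 0 := by
  have hX : (X : PowerSeries ℝ) ∣ expSeries 1 - 1 := by
    simp [X_dvd_iff, expSeries]
  have := X_pow_dvd_iff.mp ((pow_dvd_pow_of_dvd hX s).mul_left (expSeries (-μ))) r h
  rw [chooseCoeff, this, mul_zero]

lemma abs_chooseCoeff_le {μ : ℝ} (r s : ℕ) (hs : (s : ℝ) ≤ μ) :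
    |chooseCoeff μ r s| ≤ μ ^ r := by
  have hμ : 0 ≤ μ := (Nat.cast_nonneg s).trans hs
  induction r generalizing s with
  | zero =>
    rcases Nat.eq_zero_or_pos s with rfl | h
    · simp [chooseCoeff_zero_zero]
    · simp [chooseCoeff_eq_zero μ h]
  | succ r ih =>
    cases s with
    | zero =>
      rw [chooseCoeff_succ_zero, abs_mul, abs_neg, abs_of_nonneg hμ, pow_succ']
      exact mul_le_mul_of_nonneg_left (ih 0 hs) hμ
    | succ s =>
      push_cast at hs
      rw [chooseCoeff_succ_succ]
      have h1 := ih (s + 1) (by push_cast; exact hs)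
      have h2 := ih s (by linarith)
      calc _ ≤ |(s + 1 - μ) * chooseCoeff μ r (s + 1)| + |(s + 1) * chooseCoeff μ r s| :=
            abs_add_le _ _
        _ ≤ (μ - (s + 1)) * μ ^ r + (s + 1) * μ ^ r := by
            rw [abs_mul, abs_mul, abs_of_nonpos (by linarith : (s + 1 - μ : ℝ) ≤ 0),
              abs_of_nonneg (by positivity : (0 : ℝ) ≤ s + 1)]
            gcongr
            linarith
        _ = μ ^ (r + 1) := by ring

/-- The exponential generating series of the central moments of a sum of independent
Bernoulli variables with parameters `q i`. -/
noncomputable def momentSeries {ι : Type*} (P : Finset ι) (q : ι → ℝ) : PowerSeries ℝ :=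
  ∏ i ∈ P, expSeries (-q i) * (1 + C (q i) * (expSeries 1 - 1))

lemma factorial_mul_coeff_expSeries_mul_prod {ι : Type*} (P : Finset ι) (x : ι → ℝ) (μ : ℝ)
    (r : ℕ) :
    r ! * coeff r (expSeries (-μ) * ∏ i ∈ P, (1 + C (x i) * (expSeries 1 - 1))) =
      ∑ S ∈ P.powerset with S.card ≤ r, chooseCoeff μ r S.card * ∏ i ∈ S, x i := by
  rw [prod_one_add, mul_sum, map_sum, mul_sum, sum_filter]
  refine sum_congr rfl fun S _ => ?_
  have : expSeries (-μ) * ∏ i ∈ S, C (x i) * (expSeries 1 - 1) =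
      C (∏ i ∈ S, x i) * (expSeries (-μ) * (expSeries 1 - 1) ^ S.card) := by
    rw [prod_mul_distrib, prod_const, map_prod]
    ring
  rw [this, coeff_C_mul]
  split_ifs with h
  · rw [chooseCoeff]; ring
  · have := chooseCoeff_eq_zero μ (not_le.mp h)
    rw [chooseCoeff] at this
    rw [mul_left_comm, this, mul_zero]

lemma factorial_mul_coeff_momentSeries {ι : Type*} (P : Finset ι) (q : ι → ℝ) (r : ℕ) :
    r ! * coeff r (momentSeries P q) =
      ∑ S ∈ P.powerset with S.card ≤ r,
        chooseCoeff (∑ i ∈ P, q i) r S.card * ∏ i ∈ S, q i := by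
  rw [← factorial_mul_coeff_expSeries_mul_prod, momentSeries, prod_mul_distrib,
    ← sum_neg_distrib, expSeries_sum]

lemma card_filter_sub_pow {ι : Type*} (P : Finset ι) (T : ι → Prop) [DecidablePred T] (μ : ℝ)
    (r : ℕ) :
    (((P.filter T).card : ℝ) - μ) ^ r =
      ∑ S ∈ P.powerset with S.card ≤ r,
        chooseCoeff μ r S.card * ∏ i ∈ S, if T i then 1 else 0 := by
  rw [← factorial_mul_coeff_expSeries_mul_prod]
  have h : ∏ i ∈ P, (1 + C (if T i then (1 : ℝ) else 0) * (expSeries 1 - 1)) =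
      expSeries (P.filter T).card := by
    have (i : ι) : 1 + C (if T i then (1 : ℝ) else 0) * (expSeries 1 - 1) =
        expSeries (if T i then 1 else 0) := by
      split_ifs <;> simp [expSeries_zero]
    rw [prod_congr rfl fun i _ => this i, ← expSeries_sum, card_filter]
    push_cast
    rfl
  rw [h, ← expSeries_add, coeff_expSeries, neg_add_eq_sub]
  field_simp

/-- The sum of `|coeff k f| * x ^ k` over even `k ≤ N`. -/
noncomputable def evenSum (N : ℕ) (x : ℝ) (f : PowerSeries ℝ) : ℝ :=
  ∑ k ∈ range (N + 1) with Even k, |coeff k f| * x ^ k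

/-- The sum of `|coeff k f| * x ^ k` over odd `k ≤ N`. -/
noncomputable def oddSum (N : ℕ) (x : ℝ) (f : PowerSeries ℝ) : ℝ :=
  ∑ k ∈ range (N + 1) with ¬Even k, |coeff k f| * x ^ k

lemma evenSum_nonneg (N : ℕ) {x : ℝ} (hx : 0 ≤ x) (f : PowerSeries ℝ) : 0 ≤ evenSum N x f :=
  sum_nonneg fun _ _ => by positivity

lemma oddSum_nonneg (N : ℕ) {x : ℝ} (hx : 0 ≤ x) (f : PowerSeries ℝ) : 0 ≤ oddSum N x f :=
  sum_nonneg fun _ _ => by positivity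

lemma evenSum_one (N : ℕ) (x : ℝ) : evenSum N x 1 = 1 := by
  rw [evenSum, sum_eq_single 0]
  · simp
  · intro k _ hk
    simp [coeff_one, hk]
  · simp

lemma oddSum_one (N : ℕ) (x : ℝ) : oddSum N x 1 = 0 := by
  refine sum_eq_zero fun k hk => ?_
  have : k ≠ 0 := by
    rintro rfl
    simp at hk
  simp [coeff_one, this]

lemma sum_abs_coeff_mul_le (N : ℕ) {x : ℝ} (hx : 0 ≤ x) (f g : PowerSeries ℝ) (p : ℕ → Prop)
    [DecidablePred p] :
    ∑ k ∈ range (N + 1) with p k, |coeff k (f * g)| * x ^ k ≤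
      ∑ ij ∈ range (N + 1) ×ˢ range (N + 1) with p (ij.1 + ij.2),
        (|coeff ij.1 f| * x ^ ij.1) * (|coeff ij.2 g| * x ^ ij.2) := by
  have h1 (k : ℕ) : |coeff k (f * g)| * x ^ k ≤ ∑ ij ∈ antidiagonal k,
      (|coeff ij.1 f| * x ^ ij.1) * (|coeff ij.2 g| * x ^ ij.2) := by
    rw [coeff_mul]
    refine (mul_le_mul_of_nonneg_right (abs_sum_le_sum_abs _ _) (by positivity)).trans_eq ?_
    rw [sum_mul]
    refine sum_congr rfl fun ij hij => ?_
    rw [← mem_antidiagonal.mp hij, abs_mul, pow_add]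
    ring
  refine (sum_le_sum fun k _ => h1 k).trans ?_
  refine le_of_eq_of_le (sum_congr rfl fun k hk => ?_)
    (sum_fiberwise_le_sum_of_sum_fiber_nonneg (t := {k ∈ range (N + 1) | p k})
      (g := fun ij : ℕ × ℕ => ij.1 + ij.2) fun _ _ => sum_nonneg fun _ _ => by positivity)
  refine sum_congr ?_ fun _ _ => rfl
  ext ⟨i, j⟩
  simp only [mem_filter, mem_range, HasAntidiagonal.mem_antidiagonal, mem_product] at hk ⊢
  constructor
  · rintro rfl
    exact ⟨⟨⟨by omega, by omega⟩, hk.2⟩, rfl⟩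
  · exact fun h => h.2

lemma evenSum_mul_le (N : ℕ) {x : ℝ} (hx : 0 ≤ x) (f g : PowerSeries ℝ) :
    evenSum N x (f * g) ≤ evenSum N x f * evenSum N x g + oddSum N x f * oddSum N x g := by
  refine (sum_abs_coeff_mul_le N hx f g _).trans_eq ?_
  simp only [evenSum, oddSum, sum_mul_sum, ← sum_product']
  rw [← sum_filter_add_sum_filter_not _ (fun ij : ℕ × ℕ => Even ij.1), filter_filter,
    filter_filter]
  congr 1 <;> refine sum_congr ?_ fun _ _ => rfl <;> ext ⟨i, j⟩ <;>
    simp only [mem_filter, mem_product, Nat.even_add] <;> tauto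

lemma oddSum_mul_le (N : ℕ) {x : ℝ} (hx : 0 ≤ x) (f g : PowerSeries ℝ) :
    oddSum N x (f * g) ≤ evenSum N x f * oddSum N x g + oddSum N x f * evenSum N x g := by
  refine (sum_abs_coeff_mul_le N hx f g _).trans_eq ?_
  simp only [evenSum, oddSum, sum_mul_sum, ← sum_product']
  rw [← sum_filter_add_sum_filter_not _ (fun ij : ℕ × ℕ => Even ij.1), filter_filter,
    filter_filter]
  congr 1 <;> refine sum_congr ?_ fun _ _ => rfl <;> ext ⟨i, j⟩ <;>
    simp only [mem_filter, mem_product, Nat.even_add] <;> tauto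

lemma evenSum_prod_le_and_oddSum_prod_le {ι : Type*} (P : Finset ι) (f : ι → PowerSeries ℝ)
    (s : ι → ℝ) (N : ℕ) {x a b : ℝ} (hx : 0 ≤ x) (ha : 0 ≤ a) (hb : 0 ≤ b)
    (hs : ∀ i ∈ P, 0 ≤ s i) (he : ∀ i ∈ P, evenSum N x (f i) ≤ 1 + s i * a)
    (ho : ∀ i ∈ P, oddSum N x (f i) ≤ s i * b) :
    evenSum N x (∏ i ∈ P, f i) ≤
        Real.exp ((∑ i ∈ P, s i) * a) * Real.cosh ((∑ i ∈ P, s i) * b) ∧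
      oddSum N x (∏ i ∈ P, f i) ≤
        Real.exp ((∑ i ∈ P, s i) * a) * Real.sinh ((∑ i ∈ P, s i) * b) := by
  classical
  induction P using Finset.induction_on with
  | empty => simp [evenSum_one, oddSum_one]
  | insert i P hi ih =>
    obtain ⟨ihe, iho⟩ := ih (fun j hj => hs j (mem_insert_of_mem hj))
      (fun j hj => he j (mem_insert_of_mem hj)) (fun j hj => ho j (mem_insert_of_mem hj))
    have hsi := hs i (mem_insert_self i P)
    have hexp : 1 ≤ Real.exp (s i * a) := Real.one_le_exp (by positivity)
    have he' : evenSum N x (f i) ≤ Real.exp (s i * a) * Real.cosh (s i * b) :=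
      calc _ ≤ 1 + s i * a := he i (mem_insert_self i P)
        _ ≤ Real.exp (s i * a) := by linarith [Real.add_one_le_exp (s i * a)]
        _ ≤ _ := le_mul_of_one_le_right (by positivity) (Real.one_le_cosh _)
    have ho' : oddSum N x (f i) ≤ Real.exp (s i * a) * Real.sinh (s i * b) :=
      calc _ ≤ s i * b := ho i (mem_insert_self i P)
        _ ≤ Real.sinh (s i * b) := Real.self_le_sinh_iff.mpr (by positivity)
        _ ≤ _ := le_mul_of_one_le_left (Real.sinh_nonneg_iff.mpr (by positivity)) hexp
    have e0 := evenSum_nonneg N hx (f i)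
    have o0 := oddSum_nonneg N hx (f i)
    have e1 := evenSum_nonneg N hx (∏ i ∈ P, f i)
    have o1 := oddSum_nonneg N hx (∏ i ∈ P, f i)
    rw [prod_insert hi, sum_insert hi, add_mul, add_mul, Real.exp_add, Real.cosh_add,
      Real.sinh_add]
    constructor
    · refine (evenSum_mul_le N hx _ _).trans ?_
      calc _ ≤ _ := add_le_add (mul_le_mul he' ihe e1 (e0.trans he'))
            (mul_le_mul ho' iho o1 (o0.trans ho'))
        _ = _ := by ring
    · refine (oddSum_mul_le N hx _ _).trans ?_
      calc _ ≤ _ := add_le_add (mul_le_mul he' iho o1 (e0.trans he'))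
            (mul_le_mul ho' ihe e1 (o0.trans ho'))
        _ = _ := by ring

/-- The power series `exp (v t ^ 2 / 2)`. -/
noncomputable def gaussSeries (v : ℝ) : PowerSeries ℝ :=
  expand 2 two_ne_zero (expSeries (v / 2))

lemma coeff_gaussSeries_two_mul (v : ℝ) (m : ℕ) :
    coeff (2 * m) (gaussSeries v) = (v / 2) ^ m / m ! := by
  rw [gaussSeries, coeff_expand_mul, coeff_expSeries]

lemma coeff_gaussSeries_of_not_even (v : ℝ) {k : ℕ} (hk : ¬Even k) :
    coeff k (gaussSeries v) = 0 := by
  rw [gaussSeries, coeff_expand_of_not_dvd _ _ _ (by rwa [← even_iff_two_dvd])]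

lemma gaussSeries_sum_mul_prod_neg {ι : Type*} (P : Finset ι) (v : ι → ℝ) :
    gaussSeries (∑ i ∈ P, v i) * ∏ i ∈ P, gaussSeries (-v i) = 1 := by
  simp only [gaussSeries]
  rw [← map_prod, ← map_mul, ← expSeries_sum, ← expSeries_add, ← sum_div, ← add_div,
    sum_neg_distrib, add_neg_cancel, zero_div, expSeries_zero, map_one]

lemma coeff_bernoulli (q : ℝ) (k : ℕ) :
    coeff k (expSeries (-q) * (1 + C q * (expSeries 1 - 1))) =
      ((1 - q) * (-q) ^ k + q * (1 - q) ^ k) / k ! := by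
  have : expSeries (-q) * (1 + C q * (expSeries 1 - 1)) =
      C (1 - q) * expSeries (-q) + C q * expSeries (1 - q) := by
    rw [show 1 - q = -q + 1 by ring, expSeries_add, map_add, map_neg, map_one]
    ring
  rw [this, map_add, coeff_C_mul, coeff_C_mul, coeff_expSeries, coeff_expSeries]
  ring

lemma abs_coeff_bernoulli_le {q : ℝ} (h0 : 0 ≤ q) (h1 : q ≤ 1) {k : ℕ} (hk : 2 ≤ k) :
    |coeff k (expSeries (-q) * (1 + C q * (expSeries 1 - 1)))| ≤ q * (1 - q) := by
  obtain ⟨k, rfl⟩ := Nat.exists_eq_add_of_le' hk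
  have h1' : 0 ≤ 1 - q := by linarith
  rw [coeff_bernoulli, abs_div, Nat.abs_cast]
  refine (div_le_self (abs_nonneg _) (by exact_mod_cast Nat.factorial_pos _)).trans ?_
  calc |(1 - q) * (-q) ^ (k + 2) + q * (1 - q) ^ (k + 2)|
      ≤ |(1 - q) * (-q) ^ (k + 2)| + |q * (1 - q) ^ (k + 2)| := abs_add_le _ _
    _ = q * (1 - q) * (q ^ (k + 1) + (1 - q) ^ (k + 1)) := by
        rw [abs_mul, abs_mul, abs_pow, abs_pow, abs_neg, abs_of_nonneg h0, abs_of_nonneg h1']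
        ring
    _ ≤ q * (1 - q) * (q + (1 - q)) := by
        gcongr
        · exact pow_le_of_le_one h0 h1 (by omega)
        · exact pow_le_of_le_one h1' (by linarith) (by omega)
    _ = q * (1 - q) := by ring

lemma abs_coeff_gaussSeries_neg_le {s : ℝ} (h0 : 0 ≤ s) (h1 : s ≤ 1 / 4) {k : ℕ} (hk : 1 ≤ k) :
    |coeff k (gaussSeries (-s))| ≤ 4 * s * (1 / 2) ^ k := by
  by_cases h : Even k
  · obtain ⟨m, rfl⟩ := even_iff_two_dvd.mp h
    obtain ⟨m, rfl⟩ := Nat.exists_eq_add_of_le' (show 1 ≤ m by omega)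
    rw [coeff_gaussSeries_two_mul, abs_div, Nat.abs_cast, abs_pow, abs_div, abs_neg, abs_two,
      abs_of_nonneg h0]
    refine (div_le_self (by positivity) (by exact_mod_cast Nat.factorial_pos _)).trans ?_
    calc (s / 2) ^ (m + 1) ≤ s ^ (m + 1) := by gcongr; linarith
      _ = s * s ^ m := pow_succ' _ _
      _ ≤ s * (1 / 4) ^ m := by gcongr
      _ = 4 * s * (1 / 2) ^ (2 * (m + 1)) := by
        rw [pow_mul, pow_succ]
        norm_num
        ring
  · rw [coeff_gaussSeries_of_not_even _ h, abs_zero]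
    positivity

/-- The moment series of a centred Bernoulli variable divided by that of the Gaussian variable
with the same variance. -/
noncomputable def normalizedSeries (q : ℝ) : PowerSeries ℝ :=
  gaussSeries (-(q * (1 - q))) * (expSeries (-q) * (1 + C q * (expSeries 1 - 1)))

lemma momentSeries_eq {ι : Type*} (P : Finset ι) (q : ι → ℝ) :
    momentSeries P q =
      gaussSeries (∑ i ∈ P, q i * (1 - q i)) * ∏ i ∈ P, normalizedSeries (q i) := by
  simp only [normalizedSeries]
  rw [prod_mul_distrib, ← mul_assoc, gaussSeries_sum_mul_prod_neg, one_mul, momentSeries]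

lemma coeff_zero_gaussSeries (v : ℝ) : coeff 0 (gaussSeries v) = 1 := by
  simpa using coeff_gaussSeries_two_mul v 0

lemma coeff_zero_normalizedSeries (q : ℝ) : coeff 0 (normalizedSeries q) = 1 := by
  rw [normalizedSeries, coeff_mul]
  simp [-coeff_zero_eq_constantCoeff, coeff_zero_gaussSeries, coeff_bernoulli]

lemma coeff_one_normalizedSeries (q : ℝ) : coeff 1 (normalizedSeries q) = 0 := by
  have h1 : coeff 1 (gaussSeries (-(q * (1 - q)))) = 0 :=
    coeff_gaussSeries_of_not_even _ (by decide)
  rw [normalizedSeries, coeff_mul, Nat.sum_antidiagonal_eq_sum_range_succ_mk]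
  simp only [sum_range_succ, range_zero, sum_empty, coeff_bernoulli, h1]
  norm_num [coeff_zero_gaussSeries]
  ring

lemma coeff_two_normalizedSeries (q : ℝ) : coeff 2 (normalizedSeries q) = 0 := by
  have h1 : coeff 1 (gaussSeries (-(q * (1 - q)))) = 0 :=
    coeff_gaussSeries_of_not_even _ (by decide)
  have h2 := coeff_gaussSeries_two_mul (-(q * (1 - q))) 1
  rw [normalizedSeries, coeff_mul, Nat.sum_antidiagonal_eq_sum_range_succ_mk]
  simp only [sum_range_succ, range_zero, sum_empty, coeff_bernoulli, h1, coeff_zero_gaussSeries]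
  norm_num at h2 ⊢
  rw [h2]
  ring

lemma abs_coeff_normalizedSeries_le {q : ℝ} (h0 : 0 ≤ q) (h1 : q ≤ 1) {k : ℕ} (hk : 2 ≤ k) :
    |coeff k (normalizedSeries q)| ≤ 5 * (q * (1 - q)) := by
  have hs0 : 0 ≤ q * (1 - q) := mul_nonneg h0 (by linarith)
  have hs1 : q * (1 - q) ≤ 1 / 4 := by nlinarith [sq_nonneg (q - 1 / 2)]
  have hb (j : ℕ) : |coeff j (expSeries (-q) * (1 + C q * (expSeries 1 - 1)))| ≤ 1 := by
    match j with
    | 0 => simp [-coeff_zero_eq_constantCoeff, coeff_bernoulli]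
    | 1 =>
      rw [coeff_bernoulli, pow_one, pow_one, show (1 - q) * -q + q * (1 - q) = 0 by ring]
      simp
    | j + 2 => exact (abs_coeff_bernoulli_le h0 h1 (by omega)).trans (by linarith)
  rw [normalizedSeries, coeff_mul, Nat.sum_antidiagonal_eq_sum_range_succ_mk, sum_range_succ']
  refine (abs_add_le _ _).trans ?_
  have hlast : |coeff 0 (gaussSeries (-(q * (1 - q)))) *
      coeff (k - 0) (expSeries (-q) * (1 + C q * (expSeries 1 - 1)))| ≤ q * (1 - q) := by
    rw [coeff_zero_gaussSeries, one_mul]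
    exact abs_coeff_bernoulli_le h0 h1 hk
  have hgeom : ∑ i ∈ range k, (1 / 2 : ℝ) ^ (i + 1) ≤ 1 := by
    simp only [pow_succ]
    rw [← sum_mul]
    linarith [sum_geometric_two_le k]
  have hmain : |∑ i ∈ range k, coeff (i + 1) (gaussSeries (-(q * (1 - q)))) *
      coeff (k - (i + 1)) (expSeries (-q) * (1 + C q * (expSeries 1 - 1)))| ≤
        4 * (q * (1 - q)) :=
    calc _ ≤ ∑ i ∈ range k, 4 * (q * (1 - q)) * (1 / 2) ^ (i + 1) * 1 := by
          refine (abs_sum_le_sum_abs _ _).trans (sum_le_sum fun i _ => ?_)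
          rw [abs_mul]
          exact mul_le_mul (abs_coeff_gaussSeries_neg_le hs0 hs1 (by omega)) (hb _)
            (abs_nonneg _) (by positivity)
      _ = 4 * (q * (1 - q)) * ∑ i ∈ range k, (1 / 2 : ℝ) ^ (i + 1) := by
          simp only [mul_one, mul_sum]
      _ ≤ 4 * (q * (1 - q)) := mul_le_of_le_one_right (by positivity) hgeom
  linarith

lemma sum_Ico_pow_le {x : ℝ} (h0 : 0 ≤ x) (h1 : x ≤ 1 / 2) (m n : ℕ) :
    ∑ k ∈ Ico m n, x ^ k ≤ 2 * x ^ m := by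
  refine (geom_sum_Ico_le_of_lt_one h0 (by linarith)).trans ?_
  rw [div_le_iff₀ (by linarith)]
  nlinarith [pow_nonneg h0 m]

lemma evenSum_normalizedSeries_le {q : ℝ} (h0 : 0 ≤ q) (h1 : q ≤ 1) (N : ℕ) {x : ℝ}
    (hx0 : 0 ≤ x) (hx1 : x ≤ 1 / 2) :
    evenSum N x (normalizedSeries q) ≤ 1 + q * (1 - q) * (10 * x ^ 4) := by
  have hs0 : 0 ≤ q * (1 - q) := mul_nonneg h0 (by linarith)
  have hsub : {k ∈ range (N + 1) | Even k} ⊆ {0, 2} ∪ Ico 4 (N + 1) := by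
    intro k hk
    simp only [mem_filter, mem_range, mem_union, mem_insert, mem_singleton, mem_Ico,
      Nat.even_iff] at hk ⊢
    omega
  have hdisj : Disjoint ({0, 2} : Finset ℕ) (Ico 4 (N + 1)) := by
    simp [disjoint_left]
  refine (sum_le_sum_of_subset_of_nonneg hsub fun _ _ _ => by positivity).trans ?_
  rw [sum_union hdisj, sum_pair (by decide), coeff_zero_normalizedSeries,
    coeff_two_normalizedSeries]
  have : ∑ k ∈ Ico 4 (N + 1), |coeff k (normalizedSeries q)| * x ^ k ≤
      5 * (q * (1 - q)) * (2 * x ^ 4) := by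
    refine le_trans (sum_le_sum fun k hk => ?_)
      ((mul_sum _ _ _).symm.trans_le (mul_le_mul_of_nonneg_left
        (sum_Ico_pow_le hx0 hx1 4 (N + 1)) (by positivity)))
    have := mem_Ico.mp hk
    exact mul_le_mul_of_nonneg_right (abs_coeff_normalizedSeries_le h0 h1 (by omega))
      (by positivity)
  simp only [abs_one, abs_zero, pow_zero]
  linarith

lemma oddSum_normalizedSeries_le {q : ℝ} (h0 : 0 ≤ q) (h1 : q ≤ 1) (N : ℕ) {x : ℝ}
    (hx0 : 0 ≤ x) (hx1 : x ≤ 1 / 2) :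
    oddSum N x (normalizedSeries q) ≤ q * (1 - q) * (10 * x ^ 3) := by
  have hs0 : 0 ≤ q * (1 - q) := mul_nonneg h0 (by linarith)
  have hsub : {k ∈ range (N + 1) | ¬Even k} ⊆ {1} ∪ Ico 3 (N + 1) := by
    intro k hk
    simp only [mem_filter, mem_range, mem_union, mem_singleton, mem_Ico, Nat.even_iff] at hk ⊢
    omega
  have hdisj : Disjoint ({1} : Finset ℕ) (Ico 3 (N + 1)) := by
    simp
  refine (sum_le_sum_of_subset_of_nonneg hsub fun _ _ _ => by positivity).trans ?_
  rw [sum_union hdisj, sum_singleton, coeff_one_normalizedSeries]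
  have : ∑ k ∈ Ico 3 (N + 1), |coeff k (normalizedSeries q)| * x ^ k ≤
      5 * (q * (1 - q)) * (2 * x ^ 3) := by
    refine le_trans (sum_le_sum fun k hk => ?_)
      ((mul_sum _ _ _).symm.trans_le (mul_le_mul_of_nonneg_left
        (sum_Ico_pow_le hx0 hx1 3 (N + 1)) (by positivity)))
    have := mem_Ico.mp hk
    exact mul_le_mul_of_nonneg_right (abs_coeff_normalizedSeries_le h0 h1 (by omega))
      (by positivity)
  simp only [abs_zero]
  linarith

lemma evenSum_eq_one_add (N : ℕ) (x : ℝ) {f : PowerSeries ℝ} (hf : coeff 0 f = 1) :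
    evenSum N x f = 1 + evenSum N x (f - 1) := by
  have h0 : (0 : ℕ) ∈ ({k ∈ range (N + 1) | Even k} : Finset ℕ) := by simp
  rw [evenSum, evenSum, ← add_sum_erase _ _ h0, ← add_sum_erase _ _ h0, map_sub, hf]
  simp only [coeff_one, if_true, sub_self, abs_zero, zero_mul, zero_add, abs_one, pow_zero, one_mul]
  congr 1
  refine sum_congr rfl fun k hk => ?_
  rw [map_sub, coeff_one, if_neg (ne_of_mem_erase hk), sub_zero]

lemma coeff_gaussSeries_le {v : ℝ} (hv : 0 < v) (l i : ℕ) :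
    (v / 2) ^ l / l ! ≤
      (v / 2) ^ (l + i) / (l + i)! * (((2 * (l + i) : ℕ) : ℝ) / v) ^ i := by
  have h : ((l + i)! : ℝ) ≤ (l + i) ^ i * l ! := by
    have h1 := Nat.factorial_mul_descFactorial (Nat.le_add_left i l)
    have h2 := Nat.descFactorial_le_pow (l + i) i
    rw [Nat.add_sub_cancel] at h1
    rw [← h1, mul_comm]
    push_cast
    gcongr
    exact_mod_cast h2
  have hrhs : (v / 2) ^ (l + i) / (l + i)! * (((2 * (l + i) : ℕ) : ℝ) / v) ^ i =
      (v / 2) ^ l * ((l + i) ^ i / (l + i)!) := by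
    have : (v / 2) ^ i * (((2 * (l + i) : ℕ) : ℝ) / v) ^ i = (l + i) ^ i := by
      rw [← mul_pow]
      congr 1
      push_cast
      field_simp
    rw [← this, pow_add]
    ring
  rw [hrhs, div_eq_mul_one_div]
  refine mul_le_mul_of_nonneg_left ?_ (by positivity)
  rw [div_le_div_iff₀ (by positivity) (by positivity), one_mul]
  exact h

lemma abs_coeff_gaussSeries_mul_le {v : ℝ} (hv : 0 < v) (m : ℕ) (f : PowerSeries ℝ) {x : ℝ}
    (hx : x ^ 2 = ((2 * m : ℕ) : ℝ) / v) :
    |coeff (2 * m) (gaussSeries v * f)| ≤ (v / 2) ^ m / m ! * evenSum (2 * m) x f := by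
  rw [mul_comm (gaussSeries v), coeff_mul, Nat.sum_antidiagonal_eq_sum_range_succ_mk, evenSum, mul_sum,
    sum_filter]
  refine (abs_sum_le_sum_abs _ _).trans (sum_le_sum fun k hk => ?_)
  have hk' : k ≤ 2 * m := Nat.lt_succ_iff.mp (mem_range.mp hk)
  split_ifs with h
  · obtain ⟨i, rfl⟩ := even_iff_two_dvd.mp h
    obtain ⟨l, rfl⟩ := Nat.exists_eq_add_of_le' (show i ≤ m by omega)
    rw [show 2 * (l + i) - 2 * i = 2 * l by omega, coeff_gaussSeries_two_mul, abs_mul,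
      abs_of_nonneg (by positivity : 0 ≤ (v / 2) ^ l / (l ! : ℝ)), pow_mul, hx, mul_left_comm]
    exact mul_le_mul_of_nonneg_left (coeff_gaussSeries_le hv l i) (abs_nonneg _)
  · rw [coeff_gaussSeries_of_not_even, mul_zero, abs_zero]
    rwa [Nat.even_sub hk', iff_true_left (even_two_mul m)]

lemma exp_sub_one_le_mul_exp {z : ℝ} : Real.exp z - 1 ≤ z * Real.exp z := by
  have h := Real.add_one_le_exp (-z)
  have h2 : Real.exp (-z) * Real.exp z = 1 := by rw [← Real.exp_add]; simp
  nlinarith [Real.exp_pos z]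

/-- The even central moments of a sum of independent Bernoulli variables are close to those of
a Gaussian variable with the same variance `v`. -/
lemma abs_moment_sub_le {ι : Type*} (P : Finset ι) (q : ι → ℝ) (h0 : ∀ i ∈ P, 0 ≤ q i)
    (h1 : ∀ i ∈ P, q i ≤ 1) (m : ℕ) (hm : 0 < m) {v : ℝ} (hv : v = ∑ i ∈ P, q i * (1 - q i))
    (hmv : ((2 * m : ℕ) : ℝ) ^ 3 ≤ v) :
    |(2 * m)! * coeff (2 * m) (momentSeries P q) - (2 * m)! / (2 ^ m * m !) * v ^ m| ≤
      60 * Real.exp 60 *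
        ((2 * m)! / (2 ^ m * m !) * v ^ m * (((2 * m : ℕ) : ℝ) ^ 3 / v)) := by
  set r : ℝ := ((2 * m : ℕ) : ℝ) with hr
  have hr2 : 2 ≤ r := by
    rw [hr]
    exact_mod_cast (show 2 ≤ 2 * m by omega)
  have hv0 : 0 < v := lt_of_lt_of_le (by positivity) hmv
  set x : ℝ := √(r / v) with hx
  have hx0 : 0 ≤ x := Real.sqrt_nonneg _
  have hx2 : x ^ 2 = r / v := Real.sq_sqrt (by positivity)
  have hx1 : x ≤ 1 / 2 := by
    refine abs_le_of_sq_le_sq' ?_ (by norm_num) |>.2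
    rw [hx2, div_le_iff₀ hv0]
    nlinarith [mul_nonneg (by linarith : 0 ≤ r) (by nlinarith : 0 ≤ r ^ 2 - 4)]
  set H := ∏ i ∈ P, normalizedSeries (q i) with hH
  have hH0 : coeff 0 H = 1 := by
    rw [hH, coeff_zero_eq_constantCoeff_apply, map_prod]
    exact prod_eq_one fun i _ => by
      rw [← coeff_zero_eq_constantCoeff_apply, coeff_zero_normalizedSeries]
  set z := r ^ 3 / v with hz
  have hz1 : z ≤ 1 := (div_le_one hv0).mpr hmv
  have hz0 : 0 ≤ z := by positivity
  have heven : evenSum (2 * m) x H ≤ Real.exp (60 * z) := by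
    refine (evenSum_prod_le_and_oddSum_prod_le P (fun i => normalizedSeries (q i))
      (fun i => q i * (1 - q i)) (2 * m) (x := x) (a := 10 * x ^ 4) (b := 10 * x ^ 3) hx0
      (by positivity) (by positivity)
      (fun i hi => mul_nonneg (h0 i hi) (sub_nonneg.mpr (h1 i hi)))
      (fun i hi => evenSum_normalizedSeries_le (h0 i hi) (h1 i hi) _ hx0 hx1)
      (fun i hi => oddSum_normalizedSeries_le (h0 i hi) (h1 i hi) _ hx0 hx1)).1.trans ?_
    rw [← hv]
    refine (mul_le_mul_of_nonneg_left (Real.cosh_le_exp_half_sq _) (Real.exp_nonneg _)).trans ?_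
    rw [← Real.exp_add]
    refine Real.exp_le_exp.mpr ?_
    have e1 : v * (10 * x ^ 4) = 10 * (r ^ 2 / v) := by
      rw [show x ^ 4 = (x ^ 2) ^ 2 by ring, hx2]
      field_simp
    have e2 : (v * (10 * x ^ 3)) ^ 2 / 2 = 50 * z := by
      rw [show (v * (10 * x ^ 3)) ^ 2 / 2 = 50 * v ^ 2 * (x ^ 2) ^ 3 by ring, hx2, hz]
      field_simp
    have e3 : r ^ 2 / v ≤ z := by
      rw [hz]
      gcongr
      · linarith
      · norm_num
    rw [e1, e2]
    linarith
  have hdiff : (2 * m)! * coeff (2 * m) (momentSeries P q) -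
      (2 * m)! / (2 ^ m * m !) * v ^ m =
        (2 * m)! * coeff (2 * m) (gaussSeries v * (H - 1)) := by
    rw [momentSeries_eq, ← hv, mul_sub, mul_one, map_sub, coeff_gaussSeries_two_mul, div_pow,
      mul_sub]
    congr 1
    field_simp
  rw [hdiff, abs_mul, Nat.abs_cast]
  have hE : evenSum (2 * m) x (H - 1) ≤ 60 * Real.exp 60 * z :=
    calc evenSum (2 * m) x (H - 1) = evenSum (2 * m) x H - 1 := by
          rw [evenSum_eq_one_add _ _ hH0]; ring
      _ ≤ Real.exp (60 * z) - 1 := by linarith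
      _ ≤ 60 * z * Real.exp (60 * z) := exp_sub_one_le_mul_exp
      _ ≤ 60 * z * Real.exp 60 := by gcongr; linarith
      _ = _ := by ring
  calc ((2 * m)! : ℝ) * |coeff (2 * m) (gaussSeries v * (H - 1))|
      ≤ (2 * m)! * ((v / 2) ^ m / m ! * (60 * Real.exp 60 * z)) := by
        gcongr
        exact (abs_coeff_gaussSeries_mul_le hv0 m _ hx2).trans (by gcongr)
    _ = _ := by
        rw [div_pow]
        field_simp

lemma map_prod_of_multiplicative {P : Finset ℕ} (hP : ∀ p ∈ P, p.Prime) {h : ℕ → ℝ}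
    (h1 : h 1 = 1) (hmul : ∀ m n : ℕ, Nat.Coprime m n → h (m * n) = h m * h n) :
    h (∏ p ∈ P, p) = ∏ p ∈ P, h p := by
  induction P using Finset.induction_on with
  | empty => simpa using h1
  | insert p P hp ih =>
    rw [prod_insert hp, prod_insert hp, hmul, ih fun q hq => hP q (mem_insert_of_mem hq)]
    refine Nat.Coprime.prod_right fun q hq => ?_
    refine (Nat.coprime_primes (hP p (mem_insert_self p P)) (hP q (mem_insert_of_mem hq))).mpr ?_
    rintro rfl
    exact hp hq

lemma sum_map_prod_ite_dvd {S : Finset ℕ} (hS : ∀ p ∈ S, p.Prime) (A : Multiset ℕ) :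
    (A.map fun a => ∏ p ∈ S, if p ∣ a then (1 : ℝ) else 0).sum =
      (A.filter fun a => (∏ p ∈ S, p) ∣ a).card := by
  have hdvd (a : ℕ) : (∀ p ∈ S, p ∣ a) ↔ (∏ p ∈ S, p) ∣ a :=
    ⟨fun h => prod_primes_dvd a (fun p hp => (hS p hp).prime) h,
      fun h p hp => (dvd_prod_of_mem _ hp).trans h⟩
  rw [← Multiset.countP_eq_card_filter]
  induction A using Multiset.induction_on with
  | empty => simp
  | cons a A ih =>
    rw [Multiset.map_cons, Multiset.sum_cons, ih, Multiset.countP_cons, prod_ite_zero]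
    simp only [hdvd, prod_const_one]
    push_cast
    ring

lemma sum_powerset_le_sum_divisors {P : Finset ℕ} (hP : ∀ p ∈ P, p.Prime) (r : ℕ) {F : ℕ → ℝ}
    (hF : ∀ Q, 0 ≤ F Q) :
    ∑ S ∈ P.powerset with S.card ≤ r, F (∏ p ∈ S, p) ≤
      ∑ Q ∈ (∏ p ∈ P, p).divisors with Q.primeFactors.card ≤ r, F Q := by
  have hprime {S : Finset ℕ} (hS : S ∈ ({S ∈ P.powerset | S.card ≤ r} : Finset (Finset ℕ))) :
      (∏ p ∈ S, p).primeFactors = S :=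
    Nat.primeFactors_prod fun p hp => hP p (mem_powerset.mp (mem_filter.mp hS).1 hp)
  rw [← sum_image (g := fun S : Finset ℕ => ∏ p ∈ S, p) (f := F) fun S hS T hT hST => by
    rw [← hprime hS, ← hprime hT]
    exact congrArg _ hST]
  refine sum_le_sum_of_subset_of_nonneg (fun Q hQ => ?_) fun Q _ _ => hF Q
  obtain ⟨S, hS, rfl⟩ := mem_image.mp hQ
  have hSmem := mem_filter.mp hS
  refine mem_filter.mpr ⟨Nat.mem_divisors.mpr ⟨prod_dvd_prod_of_subset _ _ _
    (mem_powerset.mp hSmem.1), prod_ne_zero_iff.mpr fun p hp => (hP p hp).ne_zero⟩, ?_⟩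
  rw [hprime hS]
  exact hSmem.2

/-- Comparison of the moments of the number of prime divisors with the moments of the
corresponding sum of independent Bernoulli variables. -/
lemma abs_sum_pow_sub_card_mul_moment_le {P : Finset ℕ} (hP : ∀ p ∈ P, p.Prime)
    (A : Multiset ℕ) {h : ℕ → ℝ} (h1 : h 1 = 1)
    (hmul : ∀ m n : ℕ, Nat.Coprime m n → h (m * n) = h m * h n) (r : ℕ)
    (hr : (r : ℝ) ≤ ∑ p ∈ P, h p / p) :
    |(A.map fun a => (((P.filter fun p => p ∣ a).card : ℝ) - ∑ p ∈ P, h p / p) ^ r).sum -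
        A.card * (r ! * coeff r (momentSeries P fun p => h p / p))| ≤
      (∑ p ∈ P, h p / p) ^ r *
        ∑ Q ∈ (∏ p ∈ P, p).divisors with Q.primeFactors.card ≤ r,
          |((A.filter fun a => Q ∣ a).card : ℝ) - h Q / Q * A.card| := by
  set μ := ∑ p ∈ P, h p / p with hμ
  have hμ0 : 0 ≤ μ := (Nat.cast_nonneg r).trans hr
  have hsum : (A.map fun a => (((P.filter fun p => p ∣ a).card : ℝ) - μ) ^ r).sum =
      ∑ S ∈ P.powerset with S.card ≤ r, chooseCoeff μ r S.card *
        (A.map fun a => ∏ p ∈ S, if p ∣ a then (1 : ℝ) else 0).sum := by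
    simp_rw [card_filter_sub_pow, ← Multiset.sum_map_mul_left]
    exact Multiset.sum_map_sum_map _ _
  rw [hsum, factorial_mul_coeff_momentSeries, mul_sum, ← sum_sub_distrib]
  refine (abs_sum_le_sum_abs _ _).trans (le_trans (sum_le_sum fun S hS => ?_)
    ((mul_sum _ _ _).symm.trans_le (mul_le_mul_of_nonneg_left
      (sum_powerset_le_sum_divisors hP r fun _ => abs_nonneg _) (by positivity))))
  obtain ⟨hSP, hSr⟩ := mem_filter.mp hS
  have hSprime : ∀ p ∈ S, p.Prime := fun p hp => hP p (mem_powerset.mp hSP hp)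
  rw [sum_map_prod_ite_dvd hSprime, map_prod_of_multiplicative hSprime h1 hmul, Nat.cast_prod,
    ← prod_div_distrib, ← hμ, mul_left_comm, ← mul_sub, abs_mul, mul_comm (A.card : ℝ)]
  exact mul_le_mul_of_nonneg_right
    (abs_chooseCoeff_le r _ ((Nat.cast_le.mpr hSr).trans hr)) (abs_nonneg _)

end GranvilleSoundararajan

/-- (Granville–Soundararajan, even moments; Lemma 3.10 of the paper.) There is an
absolute constant `K > 0` such that for any finite set `P` of primes, any multiset
`A` of `y` natural numbers, any nonnegative multiplicative `h` with `0 ≤ h Q ≤ Q`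
for squarefree `Q`, and any even `r` with `0 < r ≤ σ_P(h)^{2/3}`:
`|∑_{a ∈ A} (#{p ∈ P : p ∣ a} − μ_P(h))^r − C_r·y·σ_P(h)^r|
  ≤ K·(C_r·y·σ_P(h)^{r−2}·r³ + μ_P(h)^r·ℰ_P(A,h,r))`,
where `μ_P(h) = ∑_{p∈P} h(p)/p`, `σ_P(h) = (∑_{p∈P} (h(p)/p)(1−h(p)/p))^{1/2}`,
`C_r = Γ(r+1)/(2^{r/2}Γ(1+r/2))`, and `ℰ_P(A,h,r)` is the sum of
`|A_Q − (h(Q)/Q)·y|` over squarefree `Q` composed of primes of `P` with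
`ω(Q) ≤ r` (such `Q` are exactly the divisors of `∏_{p∈P} p`). -/
theorem granville_soundararajan_even_moments :
    ∃ K : ℝ, 0 < K ∧
      ∀ (P : Finset ℕ), (∀ p ∈ P, p.Prime) →
      ∀ (A : Multiset ℕ) (h : ℕ → ℝ),
        h 1 = 1 →
        (∀ m n : ℕ, Nat.Coprime m n → h (m * n) = h m * h n) →
        (∀ Q : ℕ, Squarefree Q → 0 ≤ h Q ∧ h Q ≤ Q) →
        ∀ r : ℕ, 0 < r → Even r →
        (r : ℝ) ≤ (Real.sqrt (∑ p ∈ P, (h p / p) * (1 - h p / p))) ^ ((2 : ℝ) / 3) →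
        |(A.map (fun a =>
              (((P.filter (fun p => p ∣ a)).card : ℝ) - ∑ p ∈ P, h p / p) ^ r)).sum -
            (Real.Gamma (r + 1) / (2 ^ ((r : ℝ) / 2) * Real.Gamma (1 + (r : ℝ) / 2))) *
              A.card *
              Real.sqrt (∑ p ∈ P, (h p / p) * (1 - h p / p)) ^ r| ≤
          K * ((Real.Gamma (r + 1) / (2 ^ ((r : ℝ) / 2) * Real.Gamma (1 + (r : ℝ) / 2))) *
                A.card * Real.sqrt (∑ p ∈ P, (h p / p) * (1 - h p / p)) ^ (r - 2) *
                (r : ℝ) ^ 3 +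
              (∑ p ∈ P, h p / p) ^ r *
                ∑ Q ∈ (∏ p ∈ P, p).divisors.filter (fun Q => Q.primeFactors.card ≤ r),
                  |((A.filter (fun a => Q ∣ a)).card : ℝ) - h Q / Q * A.card|) := by
  refine ⟨60 * Real.exp 60, by positivity, ?_⟩
  intro P hP A h h1 hmul hbd r hr hreven hrσ
  have hq0 : ∀ p ∈ P, 0 ≤ h p / p := fun p hp =>
    div_nonneg (hbd p (hP p hp).squarefree).1 (Nat.cast_nonneg p)
  have hq1 : ∀ p ∈ P, h p / p ≤ 1 := fun p hp =>
    div_le_one_of_le₀ (hbd p (hP p hp).squarefree).2 (Nat.cast_nonneg p)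
  set μ := ∑ p ∈ P, h p / p with hμ
  set v := ∑ p ∈ P, h p / p * (1 - h p / p) with hv
  have hv0 : 0 ≤ v := Finset.sum_nonneg fun p hp =>
    mul_nonneg (hq0 p hp) (sub_nonneg.mpr (hq1 p hp))
  have hvμ : v ≤ μ := Finset.sum_le_sum fun p hp =>
    mul_le_of_le_one_right (hq0 p hp) (by linarith [hq0 p hp])
  have hr1 : (1 : ℝ) ≤ r := by exact_mod_cast hr
  have hr3 : (r : ℝ) ^ 3 ≤ v := by
    refine (pow_le_pow_left₀ (Nat.cast_nonneg r) hrσ 3).trans_eq ?_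
    rw [← Real.rpow_mul_natCast (Real.sqrt_nonneg v),
      show (2 : ℝ) / 3 * (3 : ℕ) = (2 : ℕ) by norm_num, Real.rpow_natCast, Real.sq_sqrt hv0]
  have hrμ : (r : ℝ) ≤ μ := by
    refine le_trans ?_ (hr3.trans hvμ)
    exact le_self_pow₀ hr1 (by norm_num)
  have hvpos : 0 < v := lt_of_lt_of_le (by positivity) hr3
  have hcomp := GranvilleSoundararajan.abs_sum_pow_sub_card_mul_moment_le hP A h1 hmul r hrμ
  rw [← hμ] at hcomp
  obtain ⟨m, rfl⟩ := even_iff_two_dvd.mp hreven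
  have hm : 0 < m := by omega
  have hmoment := GranvilleSoundararajan.abs_moment_sub_le P (fun p => h p / p) hq0 hq1 m hm hv hr3
  have hC : Real.Gamma ((2 * m : ℕ) + 1) /
      (2 ^ (((2 * m : ℕ) : ℝ) / 2) * Real.Gamma (1 + ((2 * m : ℕ) : ℝ) / 2)) =
        ((2 * m).factorial : ℝ) / (2 ^ m * m.factorial) := by
    have hhalf : ((2 * m : ℕ) : ℝ) / 2 = m := by push_cast; ring
    rw [hhalf, Real.Gamma_nat_eq_factorial, add_comm (1 : ℝ), Real.Gamma_nat_eq_factorial,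
      Real.rpow_natCast]
  have hσ : √v ^ (2 * m) = v ^ m := by rw [pow_mul, Real.sq_sqrt hv0]
  have hσ' : √v ^ (2 * m - 2) = v ^ m / v := by
    rw [show 2 * m - 2 = 2 * (m - 1) by omega, pow_mul, Real.sq_sqrt hv0,
      eq_div_iff hvpos.ne', ← pow_succ, Nat.sub_add_cancel hm]
  rw [hC, hσ, hσ']
  set C := ((2 * m).factorial : ℝ) / (2 ^ m * m.factorial)
  set M := ((2 * m).factorial : ℝ) *
    PowerSeries.coeff (2 * m) (GranvilleSoundararajan.momentSeries P fun p => h p / p)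
  set T := (A.map fun a => (((P.filter fun p => p ∣ a).card : ℝ) - μ) ^ (2 * m)).sum
  set E := ∑ Q ∈ (∏ p ∈ P, p).divisors with Q.primeFactors.card ≤ 2 * m,
    |((A.filter fun a => Q ∣ a).card : ℝ) - h Q / Q * A.card|
  have hE : 0 ≤ μ ^ (2 * m) * E := (abs_nonneg _).trans hcomp
  have hK : 1 ≤ 60 * Real.exp 60 := by linarith [Real.one_le_exp (show (0 : ℝ) ≤ 60 by norm_num)]
  calc |T - C * A.card * v ^ m| = |(T - A.card * M) + A.card * (M - C * v ^ m)| := by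
        congr 1
        ring
    _ ≤ |T - A.card * M| + A.card * |M - C * v ^ m| :=
        (abs_add_le _ _).trans_eq (by rw [abs_mul, Nat.abs_cast])
    _ ≤ 60 * Real.exp 60 * (μ ^ (2 * m) * E) + A.card * (60 * Real.exp 60 *
          (C * v ^ m * (((2 * m : ℕ) : ℝ) ^ 3 / v))) := by
        gcongr
        exact hcomp.trans (le_mul_of_one_le_left hE hK)
    _ = _ := by ring
end

section
/- (Granville–Soundararajan, odd moments.) There is an absolute constant K > 0 with the following property. Let 𝒫 be a finite set of primes and let 𝒜 = {a_1, …, a_y} be a multiset of y natural numbers; for Q ∈ ℕ set 𝒜_Q := #{m ≤ y : Q ∣ a_m}. Let h : ℕ → ℝ be a nonnegative multiplicative function with 0 ≤ h(Q) ≤ Q for all squarefree Q. Set μ_𝒫(h) := ∑_{p ∈ 𝒫} h(p)/p, σ_𝒫(h) := (∑_{p ∈ 𝒫} (h(p)/p)(1 − h(p)/p))^{1/2}, C_r := Γ(r+1)/(2^{r/2} Γ(1 + r/2)), and ℰ_𝒫(𝒜,h,r) := ∑ |𝒜_Q − (h(Q)/Q)·y|, the sum over squarefree Q all of whose prime factors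 lie in 𝒫 and with ω(Q) ≤ r. Then for every odd integer r with 0 < r ≤ σ_𝒫(h)^{2/3}: | ∑_{a ∈ 𝒜} (#{p ∈ 𝒫 : p ∣ a} − μ_𝒫(h))^r | ≤ K·( C_r·y·σ_𝒫(h)^{r−1}·r^{3/2} + μ_𝒫(h)^r·ℰ_𝒫(𝒜,h,r) ). -/
/-- The even moment `(2m - 1)‼` of order `2m` of a standard Gaussian. -/
noncomputable def gaussianEvenMoment (m : ℕ) : ℝ := ∏ i ∈ Finset.range m, (2 * (i : ℝ) + 1)

lemma gaussianEvenMoment_succ (m : ℕ) :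
    gaussianEvenMoment (m + 1) = gaussianEvenMoment m * (2 * m + 1) :=
  Finset.prod_range_succ _ _

lemma gaussianEvenMoment_pos (m : ℕ) : 0 < gaussianEvenMoment m :=
  Finset.prod_pos fun _ _ => by positivity

lemma sq_gaussianEvenMoment_le (m : ℕ) :
    gaussianEvenMoment m ^ 2 * (2 * m + 1) ≤ (2 ^ m * (m.factorial : ℝ)) ^ 2 := by
  induction m with
  | zero => simp [gaussianEvenMoment]
  | succ m ih =>
    rw [gaussianEvenMoment_succ, Nat.factorial_succ]
    push_cast
    calc (gaussianEvenMoment m * (2 * m + 1)) ^ 2 * (2 * ((m : ℝ) + 1) + 1)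
        = (gaussianEvenMoment m ^ 2 * (2 * m + 1)) * ((2 * m + 1) * (2 * m + 3)) := by ring
      _ ≤ (2 ^ m * (m.factorial : ℝ)) ^ 2 * (2 * m + 2) ^ 2 := by
        gcongr
        nlinarith
      _ = _ := by ring

lemma gaussianEvenMoment_mul_sqrt_le (m : ℕ) :
    gaussianEvenMoment m * √(2 * m + 1) ≤ 2 ^ m * (m.factorial : ℝ) := by
  refine le_of_sq_le_sq ?_ (by positivity)
  rw [mul_pow, Real.sq_sqrt (by positivity)]
  exact sq_gaussianEvenMoment_le m

lemma factorial_two_mul_add_one_eq (m : ℕ) :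
    ((2 * m + 1).factorial : ℝ) = 2 ^ m * m.factorial * gaussianEvenMoment (m + 1) := by
  induction m with
  | zero => simp [gaussianEvenMoment]
  | succ m ih =>
    rw [show 2 * (m + 1) + 1 = (2 * m + 1) + 1 + 1 by ring, Nat.factorial_succ, Nat.factorial_succ,
      gaussianEvenMoment_succ]
    push_cast
    rw [ih, Nat.factorial_succ]
    push_cast
    ring

lemma Gamma_add_three_halves (m : ℕ) :
    Real.Gamma (m + 3 / 2) = gaussianEvenMoment (m + 1) * √Real.pi / 2 ^ (m + 1) := by
  induction m with
  | zero =>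
    rw [show ((0 : ℕ) : ℝ) + 3 / 2 = 1 / 2 + 1 by norm_num, Real.Gamma_add_one (by norm_num),
      Real.Gamma_one_half_eq]
    simp [gaussianEvenMoment]
    ring
  | succ m ih =>
    rw [show ((m + 1 : ℕ) : ℝ) + 3 / 2 = m + 3 / 2 + 1 by push_cast; ring,
      Real.Gamma_add_one (by positivity), ih, gaussianEvenMoment_succ (m + 1)]
    push_cast
    field_simp
    ring

/-- The absolute Gaussian moment of odd order `2m + 1` dominates `2^m m! / 2`. -/
lemma le_absolute_gaussian_moment (m : ℕ) :
    2 ^ m * (m.factorial : ℝ) ≤ 2 * (Real.Gamma ((2 * m + 1 : ℕ) + 1) /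
      (2 ^ (((2 * m + 1 : ℕ) : ℝ) / 2) * Real.Gamma (1 + ((2 * m + 1 : ℕ) : ℝ) / 2))) := by
  have h2 : (2 : ℝ) ^ (((2 * m + 1 : ℕ) : ℝ) / 2) = 2 ^ m * √2 := by
    rw [show (((2 * m + 1 : ℕ) : ℝ) / 2) = m + 1 / 2 by push_cast; ring,
      Real.rpow_add (by norm_num), Real.rpow_natCast, Real.sqrt_eq_rpow]
  rw [Real.Gamma_nat_eq_factorial, h2,
    show 1 + ((2 * m + 1 : ℕ) : ℝ) / 2 = m + 3 / 2 by push_cast; ring, Gamma_add_three_halves,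
    factorial_two_mul_add_one_eq]
  have hD := gaussianEvenMoment_pos (m + 1)
  have hs : √2 * √Real.pi ≤ 4 := by
    rw [← Real.sqrt_mul (by norm_num), Real.sqrt_le_left (by norm_num)]
    linarith [Real.pi_le_four]
  have hpi : 0 < √Real.pi := Real.sqrt_pos.2 Real.pi_pos
  have : 2 * (2 ^ m * (m.factorial : ℝ) * gaussianEvenMoment (m + 1) /
      (2 ^ m * √2 * (gaussianEvenMoment (m + 1) * √Real.pi / 2 ^ (m + 1)))) =
      2 ^ m * m.factorial * (4 / (√2 * √Real.pi)) := by
    field_simp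
    ring
  rw [this]
  refine le_mul_of_one_le_right (by positivity) ?_
  rwa [one_le_div (by positivity)]

/-- An upper bound for the `n`-th central moment, `n ≤ r`, of a sum of independent Bernoulli
variables of total variance `L ≥ r³`. -/
noncomputable def centralMomentBound (L r : ℝ) (n : ℕ) : ℝ :=
  gaussianEvenMoment (n / 2) * L ^ (n / 2) * if Even n then 1 + n / r else ((n : ℝ) - 1) ^ 2

lemma centralMomentBound_two_mul (L r : ℝ) (m : ℕ) :
    centralMomentBound L r (2 * m) = gaussianEvenMoment m * L ^ m * (1 + 2 * m / r) := by
  simp [centralMomentBound]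

lemma centralMomentBound_two_mul_add_one (L r : ℝ) (m : ℕ) :
    centralMomentBound L r (2 * m + 1) = gaussianEvenMoment m * L ^ m * (4 * m ^ 2) := by
  have : (2 * m + 1) / 2 = m := by omega
  simp [centralMomentBound, this]
  ring_nf
  simp

lemma centralMomentBound_nonneg {L r : ℝ} (hL : 0 ≤ L) (hr : 0 ≤ r) (n : ℕ) :
    0 ≤ centralMomentBound L r n := by
  have := gaussianEvenMoment_pos (n / 2)
  unfold centralMomentBound
  split_ifs <;> positivity

lemma mul_centralMomentBound_le {L r : ℝ} (hL : 0 ≤ L) (hr : 0 ≤ r) (n : ℕ) :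
    (n + 1) * L * centralMomentBound L r n ≤ centralMomentBound L r (n + 2) := by
  obtain ⟨m, rfl | rfl⟩ := n.even_or_odd'
  · have := gaussianEvenMoment_pos m
    rw [show 2 * m + 2 = 2 * (m + 1) by ring, centralMomentBound_two_mul,
      centralMomentBound_two_mul, gaussianEvenMoment_succ]
    push_cast
    calc (2 * (m : ℝ) + 1) * L * (gaussianEvenMoment m * L ^ m * (1 + 2 * m / r))
        = gaussianEvenMoment m * (2 * m + 1) * L ^ (m + 1) * (1 + 2 * m / r) := by ring
      _ ≤ _ := by gcongr; linarith
  · have := gaussianEvenMoment_pos m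
    rw [show 2 * m + 1 + 2 = 2 * (m + 1) + 1 by ring, centralMomentBound_two_mul_add_one,
      centralMomentBound_two_mul_add_one, gaussianEvenMoment_succ]
    push_cast
    calc (2 * (m : ℝ) + 1 + 1) * L * (gaussianEvenMoment m * L ^ m * (4 * m ^ 2))
        = gaussianEvenMoment m * L ^ (m + 1) * 4 * ((2 * m + 2) * m ^ 2) := by ring
      _ ≤ gaussianEvenMoment m * L ^ (m + 1) * 4 * ((2 * m + 1) * (m + 1) ^ 2) := by
        refine mul_le_mul_of_nonneg_left ?_ (by positivity)
        nlinarith [Nat.cast_nonneg (α := ℝ) m]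
      _ = _ := by ring

lemma centralMomentBound_step {L r : ℝ} (hr : 1 ≤ r) (hL : r ^ 3 ≤ L) {n : ℕ}
    (hn : (n : ℝ) + 3 ≤ r) :
    L * ((n + 2) * (1 + (n + 2) / (5 * L)) * centralMomentBound L r (n + 1) +
      11 / 10 * ((n + 2) * (n + 1) / 2) * centralMomentBound L r n) ≤
      centralMomentBound L r (n + 3) := by
  have hr0 : 0 < r := by linarith
  have hL0 : 0 < L := lt_of_lt_of_le (by positivity) hL
  obtain ⟨m, rfl | rfl⟩ := n.even_or_odd'
  · have hD := gaussianEvenMoment_pos m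
    push_cast at hn
    have hm : (0 : ℝ) ≤ m := Nat.cast_nonneg m
    rw [show 2 * m + 3 = 2 * (m + 1) + 1 by ring, centralMomentBound_two_mul_add_one,
      centralMomentBound_two_mul_add_one, centralMomentBound_two_mul, gaussianEvenMoment_succ]
    push_cast
    have h1 : (2 * m / r : ℝ) ≤ 1 := by rw [div_le_one hr0]; linarith
    have h2 : (2 * m + 2) / (5 * L) * (m + 1 : ℝ) ≤ 1 / 10 := by
      rw [div_mul_eq_mul_div, div_le_iff₀ (by positivity)]
      nlinarith [sq_nonneg r]
    calc L * ((2 * m + 2) * (1 + (2 * m + 2) / (5 * L)) * (gaussianEvenMoment m * L ^ m * (4 * m ^ 2)) +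
          11 / 10 * ((2 * m + 2) * (2 * m + 1) / 2) *
            (gaussianEvenMoment m * L ^ m * (1 + 2 * m / r)))
        = gaussianEvenMoment m * L ^ (m + 1) * (8 * m ^ 2 * (m + 1) +
            8 * m ^ 2 * ((2 * m + 2) / (5 * L) * (m + 1)) +
            11 / 10 * ((m + 1) * (2 * m + 1)) * (1 + 2 * m / r)) := by ring
      _ ≤ gaussianEvenMoment m * L ^ (m + 1) * (8 * m ^ 2 * (m + 1) +
            8 * m ^ 2 * (1 / 10) +
            11 / 10 * ((m + 1) * (2 * m + 1)) * (1 + 1)) := by gcongr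
      _ ≤ gaussianEvenMoment m * L ^ (m + 1) * ((2 * m + 1) * (4 * (m + 1) ^ 2)) := by
        gcongr; nlinarith
      _ = _ := by ring
  · have hD := gaussianEvenMoment_pos m
    push_cast at hn
    have hm : (0 : ℝ) ≤ m := Nat.cast_nonneg m
    rw [show 2 * m + 1 + 3 = 2 * (m + 1 + 1) by ring, show 2 * m + 1 + 1 = 2 * (m + 1) by ring,
      centralMomentBound_two_mul_add_one,
      centralMomentBound_two_mul, centralMomentBound_two_mul, gaussianEvenMoment_succ,
      gaussianEvenMoment_succ, gaussianEvenMoment_succ]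
    push_cast
    have h1 : (2 * (m + 1) / r : ℝ) ≤ 1 := by rw [div_le_one hr0]; linarith
    have h2 : (2 * m + 3) / (5 * L) ≤ 1 / (5 * r) := by
      rw [div_le_div_iff₀ (by positivity) (by positivity)]
      nlinarith [sq_nonneg r]
    have h3 : (m + 1 : ℝ) * m ^ 2 * 4 ≤ (2 * m + 1) * (L / r / 2) := by
      have : r ^ 2 ≤ L / r := by rw [le_div_iff₀ hr0]; linarith
      have : (2 * m + 4) ^ 2 ≤ r ^ 2 := by gcongr; linarith
      calc (m + 1 : ℝ) * m ^ 2 * 4 ≤ (2 * m + 1) * ((2 * m + 4) ^ 2 / 2) := by nlinarith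
        _ ≤ _ := by gcongr; linarith
    have key : 11 / 10 * ((m + 1 : ℝ) * m ^ 2 * 4) ≤ (2 * m + 1) * (L * (11 / 10 / (2 * r))) := by
      calc _ ≤ 11 / 10 * ((2 * m + 1) * (L / r / 2)) := by gcongr
        _ = _ := by field_simp
    calc L * ((2 * m + 1 + 2) * (1 + (2 * m + 1 + 2) / (5 * L)) *
            (gaussianEvenMoment m * (2 * m + 1) * L ^ (m + 1) * (1 + 2 * (m + 1) / r)) +
          11 / 10 * ((2 * m + 1 + 2) * (2 * m + 1 + 1) / 2) *
            (gaussianEvenMoment m * L ^ m * (4 * m ^ 2)))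
        = gaussianEvenMoment m * L ^ (m + 1) * (2 * m + 3) * (
            L * (2 * m + 1) * (1 + 2 * (m + 1) / r + (2 * m + 3) / (5 * L) * (1 + 2 * (m + 1) / r)) +
            11 / 10 * ((m + 1) * m ^ 2 * 4)) := by ring
      _ ≤ gaussianEvenMoment m * L ^ (m + 1) * (2 * m + 3) * (
            L * (2 * m + 1) * (1 + 2 * (m + 1) / r + 1 / (5 * r) * (1 + 1)) +
            (2 * m + 1) * (L * (11 / 10 / (2 * r)))) := by gcongr
      _ = gaussianEvenMoment m * L ^ (m + 1) * (2 * m + 3) * (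
            L * (2 * m + 1) * (1 + (2 * (m + 1) + 2 / 5 + 11 / 20) / r)) := by field_simp; ring
      _ ≤ gaussianEvenMoment m * L ^ (m + 1) * (2 * m + 3) * (
            L * (2 * m + 1) * (1 + (2 * (m + 1 + 1)) / r)) := by gcongr; linarith
      _ = _ := by ring

lemma sum_range_le_of_two_step {T : ℕ → ℝ} (hT : ∀ k, 0 ≤ T k) (h : ∀ k, T (k + 2) ≤ T k / 6)
    (N : ℕ) : ∑ k ∈ Finset.range N, T k ≤ 6 / 5 * (T 0 + T 1) := by
  have key : ∀ N j, ∑ k ∈ Finset.range N, T (j + k) ≤ 6 / 5 * (T j + T (j + 1)) := by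
    intro N
    induction N using Nat.twoStepInduction with
    | zero => intro j; have := hT j; have := hT (j + 1); simp; linarith
    | one => intro j; have := hT j; have := hT (j + 1); simp; linarith
    | more N ih _ =>
      intro j
      rw [Finset.sum_range_succ', Finset.sum_range_succ']
      have h1 := ih (j + 2)
      have e : ∑ k ∈ Finset.range N, T (j + (k + 1 + 1)) = ∑ k ∈ Finset.range N, T (j + 2 + k) :=
        Finset.sum_congr rfl fun k _ => by congr 1; ring
      rw [e]
      have h2 := h j
      have h3 := h (j + 1)
      have h4 : j + 2 + 1 = j + 1 + 2 := by ring
      rw [h4] at h1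
      simp only [zero_add, add_zero]
      linarith
  simpa using key N 0

lemma choose_mul_centralMomentBound_le {L r : ℝ} (hr : 0 ≤ r) {n k : ℕ} (hk : k + 2 ≤ n)
    (hL : (n : ℝ) ≤ L) (hL0 : 0 < L) :
    n.choose (k + 2) * centralMomentBound L r (n - (k + 2)) ≤
      n / (L * ((k + 1) * (k + 2))) * (n.choose k * centralMomentBound L r (n - k)) := by
  obtain ⟨j, rfl⟩ := Nat.exists_eq_add_of_le hk
  rw [show k + 2 + j - (k + 2) = j by omega, show k + 2 + j - k = j + 2 by omega]
  have h1 := Nat.choose_succ_right_eq (k + 2 + j) k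
  have h2 := Nat.choose_succ_right_eq (k + 2 + j) (k + 1)
  rw [show k + 2 + j - k = j + 2 by omega] at h1
  rw [show k + 2 + j - (k + 1) = j + 1 by omega] at h2
  have h1' : ((k + 2 + j).choose (k + 1) : ℝ) * (k + 1) = (k + 2 + j).choose k * (j + 2) := by
    exact_mod_cast h1
  have h2' : ((k + 2 + j).choose (k + 2) : ℝ) * (k + 2) = (k + 2 + j).choose (k + 1) * (j + 1) := by
    exact_mod_cast h2
  have h3 : ((k + 2 + j).choose (k + 2) : ℝ) =
      (k + 2 + j).choose k * (j + 2) * (j + 1) / ((k + 1) * (k + 2)) := by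
    rw [eq_div_iff (by positivity), ← h1']
    linear_combination (k + 1 : ℝ) * h2'
  have hB := mul_centralMomentBound_le hL0.le hr j
  have hB0 := centralMomentBound_nonneg hL0.le hr j
  rw [h3]
  calc ((k + 2 + j).choose k : ℝ) * (j + 2) * (j + 1) / ((k + 1) * (k + 2)) *
        centralMomentBound L r j
      = (j + 2) / (L * ((k + 1) * (k + 2))) * ((k + 2 + j).choose k *
          ((j + 1) * L * centralMomentBound L r j)) := by field_simp
    _ ≤ ((k + 2 + j : ℕ) : ℝ) / (L * ((k + 1) * (k + 2))) * ((k + 2 + j).choose k *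
          centralMomentBound L r (j + 2)) := by
      gcongr
      push_cast
      linarith [Nat.cast_nonneg (α := ℝ) k]

/-- The bound satisfies the recursion of the central moments of a Poisson variable as an
inequality. -/
lemma sum_choose_mul_centralMomentBound_le {L r : ℝ} (hr : 1 ≤ r) (hL : r ^ 3 ≤ L) {n : ℕ}
    (hn : (n : ℝ) + 1 ≤ r) :
    L * ∑ k ∈ Finset.range n, n.choose (k + 1) * centralMomentBound L r (n - (k + 1)) ≤
      centralMomentBound L r (n + 1) := by
  have hr0 : 0 < r := by linarith
  have hL0 : 0 < L := lt_of_lt_of_le (by positivity) hL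
  have hB := centralMomentBound_nonneg hL0.le hr0.le
  match n with
  | 0 => simpa using hB 1
  | 1 => simpa using mul_centralMomentBound_le hL0.le hr0.le 0
  | n + 2 =>
    push_cast at hn
    have hnL : ((n + 2 : ℕ) : ℝ) ≤ L := by
      push_cast
      nlinarith [sq_nonneg r]
    set T : ℕ → ℝ := fun k => (n + 2).choose k * centralMomentBound L r (n + 2 - k) with hT
    have hT0 : ∀ k, 0 ≤ T k := fun k => mul_nonneg (Nat.cast_nonneg _) (hB _)
    have hstep : ∀ k, T (k + 2) ≤ (n + 2) / (L * ((k + 1) * (k + 2))) * T k := by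
      intro k
      by_cases hk : k + 2 ≤ n + 2
      · simpa [hT] using choose_mul_centralMomentBound_le hr0.le hk hnL hL0
      · have : T (k + 2) = 0 := by simp [hT, Nat.choose_eq_zero_of_lt (not_le.1 hk)]
        rw [this]
        have := hT0 k
        positivity
    have hq : ((n : ℝ) + 2) / L ≤ 1 := by
      rw [div_le_one hL0]; exact_mod_cast hnL
    have hstep' : ∀ k, T (k + 1 + 2) ≤ T (k + 1) / 6 := by
      intro k
      refine (hstep (k + 1)).trans ?_
      have hk : (0 : ℝ) ≤ k := Nat.cast_nonneg k
      rw [div_mul_eq_div_div, div_eq_mul_inv (T (k + 1)), mul_comm]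
      have := hT0 (k + 1)
      gcongr
      push_cast
      calc ((n : ℝ) + 2) / L / ((k + 1 + 1) * (k + 1 + 2)) ≤ 1 / 6 := by
            apply div_le_div₀ <;> nlinarith
        _ = _ := by norm_num
    have h1 := hstep 1
    have h2 := hstep 2
    have h3 := sum_range_le_of_two_step (T := fun k => T (k + 3)) (fun k => hT0 _)
      (fun k => hstep' (k + 2)) n
    have hsum : ∑ k ∈ Finset.range (n + 2), T (k + 1) ≤
        (1 + (n + 2) / (5 * L)) * T 1 + 11 / 10 * T 2 := by
      rw [Finset.sum_range_succ', Finset.sum_range_succ']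
      simp only [zero_add, add_assoc, Nat.reduceAdd] at h1 h2 h3 ⊢
      have e1 : ((n : ℝ) + 2) / (L * (((1 : ℕ) + 1) * ((1 : ℕ) + 2))) = 1 / 6 * ((n + 2) / L) := by
        field_simp; norm_num
      have e2 : ((n : ℝ) + 2) / (L * (((2 : ℕ) + 1) * ((2 : ℕ) + 2))) = 1 / 12 * ((n + 2) / L) := by
        field_simp; norm_num
      have e3 : ((n : ℝ) + 2) / (5 * L) = 1 / 5 * ((n + 2) / L) := by field_simp
      rw [e1] at h1
      rw [e2] at h2
      rw [e3]
      have := mul_le_mul_of_nonneg_right hq (hT0 2)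
      linarith
    refine le_trans (mul_le_mul_of_nonneg_left hsum hL0.le) (le_trans (le_of_eq ?_)
      (centralMomentBound_step hr hL (n := n) (by linarith)))
    have hc : ((n + 2).choose 2 : ℝ) = (n + 2) * (n + 1) / 2 := by
      rw [Nat.cast_choose_two]; push_cast; ring
    simp only [hT, hc, Nat.choose_one_right]
    rw [show n + 2 - 1 = n + 1 by omega, show n + 2 - 2 = n by omega]
    push_cast
    ring

section BernoulliExpectation

variable {α : Type*} [DecidableEq α]

/-- The expectation of `g S` where `S` is the random subset of `P` that contains each `p ∈ P`
independently with probability `x p`. -/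
noncomputable def bernoulliExpectation (x : α → ℝ) (P : Finset α) (g : Finset α → ℝ) : ℝ :=
  ∑ S ∈ P.powerset, (∏ p ∈ S, x p) * (∏ p ∈ P \ S, (1 - x p)) * g S

lemma bernoulliExpectation_congr {x : α → ℝ} {P : Finset α} {g g' : Finset α → ℝ}
    (h : ∀ S ⊆ P, g S = g' S) : bernoulliExpectation x P g = bernoulliExpectation x P g' :=
  Finset.sum_congr rfl fun S hS => by rw [h S (Finset.mem_powerset.1 hS)]

lemma bernoulliExpectation_sum {ι : Type*} (x : α → ℝ) (P : Finset α) (s : Finset ι)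
    (g : ι → Finset α → ℝ) :
    bernoulliExpectation x P (fun S => ∑ i ∈ s, g i S) =
      ∑ i ∈ s, bernoulliExpectation x P (g i) := by
  simp only [bernoulliExpectation, Finset.mul_sum]
  exact Finset.sum_comm

lemma bernoulliExpectation_const_mul (x : α → ℝ) (P : Finset α) (c : ℝ) (g : Finset α → ℝ) :
    bernoulliExpectation x P (fun S => c * g S) = c * bernoulliExpectation x P g := by
  simp only [bernoulliExpectation, Finset.mul_sum]
  exact Finset.sum_congr rfl fun _ _ => by ring

lemma bernoulliExpectation_insert (x : α → ℝ) {p : α} {P : Finset α} (hp : p ∉ P)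
    (g : Finset α → ℝ) :
    bernoulliExpectation x (insert p P) g =
      x p * bernoulliExpectation x P (fun S => g (insert p S)) +
        (1 - x p) * bernoulliExpectation x P g := by
  unfold bernoulliExpectation
  rw [Finset.sum_powerset_insert hp, add_comm, Finset.mul_sum, Finset.mul_sum]
  congr 1
  · refine Finset.sum_congr rfl fun S hS => ?_
    have hpS : p ∉ S := fun h => hp (Finset.mem_powerset.1 hS h)
    rw [Finset.prod_insert hpS, Finset.insert_sdiff_insert, Finset.sdiff_insert_of_notMem hp]
    ring
  · refine Finset.sum_congr rfl fun S hS => ?_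
    have hpS : p ∉ S := fun h => hp (Finset.mem_powerset.1 hS h)
    rw [Finset.insert_sdiff_of_notMem _ hpS, Finset.prod_insert (by simp [hp])]
    ring

lemma bernoulliExpectation_indicator_subset (x : α → ℝ) {P T : Finset α} (hT : T ⊆ P) :
    bernoulliExpectation x P (fun S => if T ⊆ S then 1 else 0) = ∏ p ∈ T, x p := by
  have h := Finset.prod_add x (fun p => if p ∈ T then 0 else 1 - x p) P
  have h1 : ∏ p ∈ P, (x p + if p ∈ T then 0 else 1 - x p) = ∏ p ∈ T, x p := by
    rw [← Finset.prod_subset hT (f := fun p => x p + if p ∈ T then 0 else 1 - x p)]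
    · exact Finset.prod_congr rfl fun p hp => by simp [hp]
    · intro p _ hp; simp [hp]
  rw [← h1, h]
  refine Finset.sum_congr rfl fun S _ => ?_
  rw [mul_assoc]
  congr 1
  change _ * (if T ⊆ S then (1 : ℝ) else 0) = _
  split_ifs with hTS
  · rw [mul_one]
    refine Finset.prod_congr rfl fun p hp => ?_
    rw [if_neg fun hpT => (Finset.mem_sdiff.1 hp).2 (hTS hpT)]
  · obtain ⟨p, hpT, hpS⟩ := Finset.not_subset.1 hTS
    rw [mul_zero, Finset.prod_eq_zero (Finset.mem_sdiff.2 ⟨hT hpT, hpS⟩) (by simp [hpT])]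

/-- The `n`-th central moment of the sum of independent Bernoulli variables with parameters
`x p`, `p ∈ P`. -/
noncomputable def bernoulliCentralMoment (x : α → ℝ) (P : Finset α) (n : ℕ) : ℝ :=
  bernoulliExpectation x P fun S => ((S.card : ℝ) - ∑ p ∈ P, x p) ^ n

lemma bernoulliCentralMoment_zero (x : α → ℝ) (P : Finset α) :
    bernoulliCentralMoment x P 0 = 1 := by
  have := bernoulliExpectation_indicator_subset x (P.empty_subset)
  simpa [bernoulliCentralMoment] using this

lemma bernoulliExpectation_indicator_mul_pow (x : α → ℝ) {p : α} {P : Finset α} (hp : p ∈ P)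
    (n : ℕ) :
    bernoulliExpectation x P (fun S => ((if p ∈ S then 1 else 0) - x p) *
        ((S.card : ℝ) - ∑ q ∈ P, x q) ^ n) =
      x p * (1 - x p) * ∑ k ∈ Finset.range (n + 1), n.choose k *
        (((1 - x p) ^ k - (-x p) ^ k) * bernoulliCentralMoment x (P.erase p) (n - k)) := by
  obtain ⟨Q, hQ, rfl⟩ : ∃ Q, p ∉ Q ∧ P = insert p Q :=
    ⟨P.erase p, by simp, (Finset.insert_erase hp).symm⟩
  have hexp : ∀ c : ℝ, bernoulliExpectation x Q (fun S => (c + ((S.card : ℝ) - ∑ q ∈ Q, x q)) ^ n) =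
      ∑ k ∈ Finset.range (n + 1), c ^ k * n.choose k * bernoulliCentralMoment x Q (n - k) := by
    intro c
    simp only [add_pow, bernoulliCentralMoment, ← bernoulliExpectation_const_mul]
    rw [← bernoulliExpectation_sum]
    refine bernoulliExpectation_congr fun S _ => Finset.sum_congr rfl fun k _ => by ring
  rw [bernoulliExpectation_insert x hQ, Finset.erase_insert hQ, Finset.sum_insert hQ]
  have e1 : bernoulliExpectation x Q (fun S => ((if p ∈ insert p S then 1 else 0) - x p) *
        (((insert p S).card : ℝ) - (x p + ∑ q ∈ Q, x q)) ^ n) =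
      (1 - x p) * bernoulliExpectation x Q
        (fun S => ((1 - x p) + ((S.card : ℝ) - ∑ q ∈ Q, x q)) ^ n) := by
    rw [← bernoulliExpectation_const_mul]
    refine bernoulliExpectation_congr fun S hS => ?_
    rw [Finset.card_insert_of_notMem fun h => hQ (hS h)]
    simp only [Finset.mem_insert_self, if_true]
    push_cast
    ring
  have e2 : bernoulliExpectation x Q (fun S => ((if p ∈ S then 1 else 0) - x p) *
        ((S.card : ℝ) - (x p + ∑ q ∈ Q, x q)) ^ n) =
      (-x p) * bernoulliExpectation x Q
        (fun S => (-x p + ((S.card : ℝ) - ∑ q ∈ Q, x q)) ^ n) := by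
    rw [← bernoulliExpectation_const_mul]
    refine bernoulliExpectation_congr fun S hS => ?_
    rw [if_neg fun h => hQ (hS h)]
    ring
  rw [e1, e2, hexp, hexp]
  simp only [Finset.mul_sum]
  rw [← Finset.sum_add_distrib]
  exact Finset.sum_congr rfl fun k _ => by ring

lemma bernoulliCentralMoment_succ (x : α → ℝ) (P : Finset α) (n : ℕ) :
    bernoulliCentralMoment x P (n + 1) =
      ∑ p ∈ P, x p * (1 - x p) * ∑ k ∈ Finset.range (n + 1), n.choose k *
        (((1 - x p) ^ k - (-x p) ^ k) * bernoulliCentralMoment x (P.erase p) (n - k)) := by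
  rw [Finset.sum_congr rfl fun p hp => (bernoulliExpectation_indicator_mul_pow x hp n).symm,
    ← bernoulliExpectation_sum]
  refine bernoulliExpectation_congr fun S hS => ?_
  rw [← Finset.sum_mul, Finset.sum_sub_distrib, pow_succ']
  congr 2
  rw [Finset.sum_ite_mem, Finset.inter_eq_right.2 hS]
  simp

lemma abs_one_sub_pow_sub_neg_pow_le {t : ℝ} (h0 : 0 ≤ t) (h1 : t ≤ 1) (k : ℕ) :
    |(1 - t) ^ (k + 1) - (-t) ^ (k + 1)| ≤ 1 := by
  calc |(1 - t) ^ (k + 1) - (-t) ^ (k + 1)| ≤ |(1 - t) ^ (k + 1)| + |(-t) ^ (k + 1)| := abs_sub _ _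
    _ = (1 - t) ^ (k + 1) + t ^ (k + 1) := by
      rw [abs_pow, abs_pow, abs_neg, abs_of_nonneg h0, abs_of_nonneg (by linarith)]
    _ ≤ (1 - t) + t :=
      add_le_add (pow_le_of_le_one (by linarith) (by linarith) (by simp))
        (pow_le_of_le_one h0 h1 (by simp))
    _ = 1 := by ring

lemma abs_bernoulliCentralMoment_le {x : α → ℝ} {P : Finset α}
    (hx : ∀ p ∈ P, 0 ≤ x p ∧ x p ≤ 1) {r : ℝ} (hr : 1 ≤ r)
    (hL : r ^ 3 ≤ ∑ p ∈ P, x p * (1 - x p)) (n : ℕ) (hn : (n : ℝ) ≤ r) {Q : Finset α}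
    (hQ : Q ⊆ P) :
    |bernoulliCentralMoment x Q n| ≤
      centralMomentBound (∑ p ∈ P, x p * (1 - x p)) r n := by
  induction n using Nat.strong_induction_on generalizing Q with
  | _ n ih =>
  set L := ∑ p ∈ P, x p * (1 - x p)
  have hL0 : 0 < L := lt_of_lt_of_le (by positivity) hL
  have hB := centralMomentBound_nonneg hL0.le (r := r) (by linarith)
  have hv : ∀ p ∈ P, 0 ≤ x p * (1 - x p) := fun p hp =>
    mul_nonneg (hx p hp).1 (by linarith [(hx p hp).2])
  match n with
  | 0 => simp [bernoulliCentralMoment_zero, centralMomentBound, gaussianEvenMoment]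
  | n + 1 =>
    push_cast at hn
    refine le_trans ?_ (sum_choose_mul_centralMomentBound_le hr hL hn)
    set s := ∑ k ∈ Finset.range n, n.choose (k + 1) * centralMomentBound L r (n - (k + 1))
    have hs0 : 0 ≤ s := Finset.sum_nonneg fun k _ => mul_nonneg (Nat.cast_nonneg _) (hB _)
    have hterm : ∀ p ∈ Q, |∑ k ∈ Finset.range (n + 1), n.choose k *
        (((1 - x p) ^ k - (-x p) ^ k) * bernoulliCentralMoment x (Q.erase p) (n - k))| ≤ s := by
      intro p hp
      rw [Finset.sum_range_succ']
      simp only [pow_zero, sub_self, zero_mul, mul_zero, add_zero]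
      refine (Finset.abs_sum_le_sum_abs _ _).trans (Finset.sum_le_sum fun k hk => ?_)
      rw [abs_mul, abs_mul, Nat.abs_cast]
      refine mul_le_mul_of_nonneg_left ?_ (Nat.cast_nonneg _)
      have h1 := abs_one_sub_pow_sub_neg_pow_le (hx p (hQ hp)).1 (hx p (hQ hp)).2 k
      have hlt : n - (k + 1) < n + 1 := by omega
      have h2 := ih (n - (k + 1)) hlt
        (le_trans (by exact_mod_cast (by omega : n - (k + 1) ≤ n + 1)) hn)
        ((Finset.erase_subset p Q).trans hQ)
      calc _ ≤ 1 * centralMomentBound L r (n - (k + 1)) :=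
            mul_le_mul h1 h2 (abs_nonneg _) zero_le_one
        _ = _ := one_mul _
    rw [bernoulliCentralMoment_succ]
    calc _ ≤ ∑ p ∈ Q, x p * (1 - x p) * s := by
          refine (Finset.abs_sum_le_sum_abs _ _).trans (Finset.sum_le_sum fun p hp => ?_)
          rw [abs_mul, abs_of_nonneg (hv p (hQ hp))]
          exact mul_le_mul_of_nonneg_left (hterm p hp) (hv p (hQ hp))
      _ = (∑ p ∈ Q, x p * (1 - x p)) * s := by rw [Finset.sum_mul]
      _ ≤ L * s := by
          refine mul_le_mul_of_nonneg_right ?_ hs0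
          exact Finset.sum_le_sum_of_subset_of_nonneg hQ fun p hp _ => hv p hp

end BernoulliExpectation

lemma abs_fwdDiff_iter_eval_le (k : ℕ) (f : Polynomial ℝ) (t C : ℝ)
    (h : ∀ s, t ≤ s → s ≤ t + k → |(Polynomial.derivative^[k] f).eval s| ≤ C) :
    |(fwdDiff 1)^[k] (fun x : ℝ => f.eval x) t| ≤ C := by
  induction k generalizing f with
  | zero => simpa using h t le_rfl (by simp)
  | succ k ih =>
    have hd : fwdDiff 1 (fun x : ℝ => f.eval x) =
        fun x : ℝ => (f.comp (Polynomial.X + Polynomial.C 1) - f).eval x := by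
      ext x; simp [fwdDiff]
    rw [Function.iterate_succ_apply, hd]
    refine ih _ fun s hs hs' => ?_
    have hcomp : ∀ (k : ℕ) (g : Polynomial ℝ),
        Polynomial.derivative^[k] (g.comp (Polynomial.X + Polynomial.C 1)) =
          (Polynomial.derivative^[k] g).comp (Polynomial.X + Polynomial.C 1) := by
      intro k
      induction k with
      | zero => simp
      | succ k ihk =>
        intro g
        rw [Function.iterate_succ_apply, Function.iterate_succ_apply, ← ihk]
        simp [Polynomial.derivative_comp]
    set g := Polynomial.derivative^[k] f
    have hmv := norm_image_sub_le_of_norm_deriv_le_segment' (f := fun x => g.eval x)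
      (f' := fun x => g.derivative.eval x) (a := s) (b := s + 1) (C := C)
      (fun y _ => (g.hasDerivAt y).hasDerivWithinAt) (fun y hy => by
        have := h y (hs.trans hy.1) (by push_cast; linarith [hy.2])
        rwa [Function.iterate_succ_apply'] at this) (s + 1) ⟨by linarith, le_rfl⟩
    rw [Polynomial.iterate_derivative_sub, hcomp]
    simpa using hmv

lemma abs_fwdDiff_iter_sub_pow_le {r k : ℕ} {μ : ℝ} (hr : (r : ℝ) ≤ μ) (hk : k ≤ r) :
    |(fwdDiff 1)^[k] (fun x : ℝ => (x - μ) ^ r) 0| ≤ μ ^ r := by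
  have := abs_fwdDiff_iter_eval_le k ((Polynomial.X - Polynomial.C μ) ^ r) 0 (μ ^ r) fun s hs hs' => by
    have hk' : (k : ℝ) ≤ r := by exact_mod_cast hk
    have hμ : 0 ≤ μ := (Nat.cast_nonneg r).trans hr
    rw [Polynomial.iterate_derivative_X_sub_pow, nsmul_eq_mul]
    simp only [Polynomial.eval_mul, Polynomial.eval_natCast, Polynomial.eval_pow,
      Polynomial.eval_sub, Polynomial.eval_X, Polynomial.eval_C, abs_mul, Nat.abs_cast, abs_pow]
    have h1 : (r.descFactorial k : ℝ) ≤ (r : ℝ) ^ k := by exact_mod_cast Nat.descFactorial_le_pow r k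
    have h2 : |s - μ| ≤ μ := abs_le.2 ⟨by linarith, by linarith⟩
    calc _ ≤ μ ^ k * μ ^ (r - k) := by gcongr; exact h1.trans (by gcongr)
      _ = μ ^ r := by rw [← pow_add, Nat.add_sub_cancel' hk]
  simpa using this

lemma fwdDiff_iter_sub_pow_eq_zero {r k : ℕ} (μ : ℝ) (hk : r < k) :
    (fwdDiff 1)^[k] (fun x : ℝ => (x - μ) ^ r) 0 = 0 := by
  have := abs_fwdDiff_iter_eval_le k ((Polynomial.X - Polynomial.C μ) ^ r) 0 0 fun s _ _ => by
    rw [Polynomial.iterate_derivative_X_sub_pow, Nat.descFactorial_eq_zero_iff_lt.2 hk]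
    simp
  simpa using this

lemma card_sub_pow_eq_sum_powerset {α : Type*} [DecidableEq α] (r : ℕ) (μ : ℝ) {S P : Finset α}
    (hS : S ⊆ P) :
    ((S.card : ℝ) - μ) ^ r = ∑ T ∈ P.powerset.filter (fun T => T.card ≤ r),
      (fwdDiff 1)^[T.card] (fun x : ℝ => (x - μ) ^ r) 0 * if T ⊆ S then 1 else 0 := by
  set c : ℕ → ℝ := fun k => (fwdDiff 1)^[k] (fun x : ℝ => (x - μ) ^ r) 0
  have h := shift_eq_sum_fwdDiff_iter (1 : ℝ) (fun x : ℝ => (x - μ) ^ r) S.card 0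
  simp only [zero_add, nsmul_eq_mul, mul_one] at h
  have h2 := Finset.sum_powerset_apply_card c (x := S)
  simp only [nsmul_eq_mul] at h2
  rw [h, ← h2, Finset.sum_filter]
  rw [← Finset.sum_subset (Finset.powerset_mono.2 hS)]
  · refine Finset.sum_congr rfl fun T hT => ?_
    rw [if_pos (Finset.mem_powerset.1 hT), mul_one]
    split_ifs with hTr
    · rfl
    · exact fwdDiff_iter_sub_pow_eq_zero μ (not_le.1 hTr)
  · intro T _ hT
    rw [if_neg fun h => hT (Finset.mem_powerset.2 h)]
    simp

lemma prod_dvd_iff_subset_filter {P T : Finset ℕ} (hP : ∀ p ∈ P, p.Prime) (hT : T ⊆ P) (a : ℕ) :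
    ∏ p ∈ T, p ∣ a ↔ T ⊆ P.filter (fun p => p ∣ a) := by
  constructor
  · intro h p hp
    exact Finset.mem_filter.2 ⟨hT hp, (Finset.dvd_prod_of_mem _ hp).trans h⟩
  · intro h
    exact Finset.prod_primes_dvd a (fun p hp => (hP p (hT hp)).prime)
      fun p hp => (Finset.mem_filter.1 (h hp)).2

lemma sum_map_card_filter_sub_pow {P : Finset ℕ} (hP : ∀ p ∈ P, p.Prime) (A : Multiset ℕ) (r : ℕ)
    (μ : ℝ) :
    (A.map (fun a => (((P.filter (fun p => p ∣ a)).card : ℝ) - μ) ^ r)).sum =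
      ∑ T ∈ P.powerset.filter (fun T => T.card ≤ r),
        (fwdDiff 1)^[T.card] (fun x : ℝ => (x - μ) ^ r) 0 *
          ((A.filter (fun a => ∏ p ∈ T, p ∣ a)).card : ℝ) := by
  induction A using Multiset.induction_on with
  | empty => simp
  | cons a A ih =>
    rw [Multiset.map_cons, Multiset.sum_cons, ih,
      card_sub_pow_eq_sum_powerset r μ (Finset.filter_subset (fun p => p ∣ a) P),
      ← Finset.sum_add_distrib]
    refine Finset.sum_congr rfl fun T hT => ?_
    have hT' := Finset.mem_powerset.1 (Finset.mem_filter.1 hT).1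
    rw [← mul_add, Multiset.filter_cons, Multiset.card_add]
    simp only [← prod_dvd_iff_subset_filter hP hT']
    split_ifs <;> simp

lemma bernoulliCentralMoment_eq_sum_powerset {α : Type*} [DecidableEq α] (x : α → ℝ)
    (P : Finset α) (r : ℕ) :
    bernoulliCentralMoment x P r = ∑ T ∈ P.powerset.filter (fun T => T.card ≤ r),
      (fwdDiff 1)^[T.card] (fun t : ℝ => (t - ∑ p ∈ P, x p) ^ r) 0 * ∏ p ∈ T, x p := by
  rw [bernoulliCentralMoment,
    bernoulliExpectation_congr fun S hS => card_sub_pow_eq_sum_powerset r _ hS,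
    bernoulliExpectation_sum]
  refine Finset.sum_congr rfl fun T hT => ?_
  rw [bernoulliExpectation_const_mul,
    bernoulliExpectation_indicator_subset x (Finset.mem_powerset.1 (Finset.mem_filter.1 hT).1)]

lemma multiplicative_div_prod_primes {h : ℕ → ℝ} (h1 : h 1 = 1)
    (hmul : ∀ m n : ℕ, Nat.Coprime m n → h (m * n) = h m * h n) (T : Finset ℕ)
    (hT : ∀ p ∈ T, p.Prime) :
    h (∏ p ∈ T, p) / ((∏ p ∈ T, p : ℕ) : ℝ) = ∏ p ∈ T, h p / p := by
  induction T using Finset.induction_on with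
  | empty => simp [h1]
  | insert q T hq ih =>
    rw [Finset.prod_insert hq, Finset.prod_insert hq,
      ← ih fun p hp => hT p (Finset.mem_insert_of_mem hp), hmul]
    · push_cast
      rw [mul_div_mul_comm]
    · refine Nat.Coprime.prod_right fun p hp => ?_
      exact (Nat.coprime_primes (hT q (by simp)) (hT p (by simp [hp]))).2
        (ne_of_mem_of_not_mem hp hq).symm

lemma sum_powerset_prod_primes_le {P : Finset ℕ} (hP : ∀ p ∈ P, p.Prime) (r : ℕ) {g : ℕ → ℝ}
    (hg : ∀ Q, 0 ≤ g Q) :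
    ∑ T ∈ P.powerset.filter (fun T => T.card ≤ r), g (∏ p ∈ T, p) ≤
      ∑ Q ∈ (∏ p ∈ P, p).divisors.filter (fun Q => Q.primeFactors.card ≤ r), g Q := by
  have hpf : ∀ T ⊆ P, (∏ p ∈ T, p).primeFactors = T := fun T hT =>
    Nat.primeFactors_prod fun p hp => hP p (hT hp)
  have hinj : Set.InjOn (fun T : Finset ℕ => ∏ p ∈ T, p)
      (P.powerset.filter (fun T => T.card ≤ r)) := by
    intro T hT T' hT' hTT
    simp only [Finset.coe_filter, Finset.mem_powerset, Set.mem_ofPred_eq] at hT hT' hTT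
    rw [← hpf T hT.1, ← hpf T' hT'.1, hTT]
  rw [← Finset.sum_image hinj]
  refine Finset.sum_le_sum_of_subset_of_nonneg ?_ fun _ _ _ => hg _
  intro Q hQ
  obtain ⟨T, hT, rfl⟩ := Finset.mem_image.1 hQ
  rw [Finset.mem_filter, Finset.mem_powerset] at hT
  rw [Finset.mem_filter, Nat.mem_divisors, hpf T hT.1]
  exact ⟨⟨Finset.prod_dvd_prod_of_subset _ _ _ hT.1,
    (Finset.prod_pos fun p hp => (hP p hp).pos).ne'⟩, hT.2⟩

lemma centralMomentBound_odd_le {L : ℝ} (hL : 0 ≤ L) {r : ℕ} (hr : Odd r) :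
    centralMomentBound L r r ≤ 2 * ((Real.Gamma (r + 1) /
      (2 ^ ((r : ℝ) / 2) * Real.Gamma (1 + (r : ℝ) / 2))) * √L ^ (r - 1) *
        (r : ℝ) ^ ((3 : ℝ) / 2)) := by
  obtain ⟨m, rfl⟩ := hr
  have hD := gaussianEvenMoment_pos m
  rw [centralMomentBound_two_mul_add_one, Nat.add_sub_cancel, pow_mul, Real.sq_sqrt hL]
  have hG := le_absolute_gaussian_moment m
  set G := Real.Gamma ((2 * m + 1 : ℕ) + 1) /
      (2 ^ (((2 * m + 1 : ℕ) : ℝ) / 2) * Real.Gamma (1 + ((2 * m + 1 : ℕ) : ℝ) / 2))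
  have hs := gaussianEvenMoment_mul_sqrt_le m
  have hpow : ((2 * m + 1 : ℕ) : ℝ) ^ ((3 : ℝ) / 2) = (2 * m + 1) * √(2 * m + 1) := by
    rw [show (3 : ℝ) / 2 = 1 + 1 / 2 by norm_num, Real.rpow_add (by positivity), Real.rpow_one,
      Real.sqrt_eq_rpow]
    push_cast
    rfl
  rw [hpow]
  calc gaussianEvenMoment m * L ^ m * (4 * m ^ 2)
      ≤ gaussianEvenMoment m * L ^ m * (2 * m + 1) ^ 2 := by gcongr; nlinarith
    _ = (gaussianEvenMoment m * √(2 * m + 1)) * L ^ m * ((2 * m + 1) * √(2 * m + 1)) := by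
      have h2 : √(2 * (m : ℝ) + 1) * √(2 * m + 1) = 2 * m + 1 :=
        Real.mul_self_sqrt (by positivity)
      linear_combination -(gaussianEvenMoment m * L ^ m * (2 * m + 1)) * h2
    _ ≤ (2 * G) * L ^ m * ((2 * m + 1) * √(2 * m + 1)) := by
      refine mul_le_mul_of_nonneg_right (mul_le_mul_of_nonneg_right (hs.trans hG) ?_) ?_ <;>
        positivity
    _ = _ := by ring

lemma abs_sum_map_sub_card_mul_le {P : Finset ℕ} (hP : ∀ p ∈ P, p.Prime) (A : Multiset ℕ)
    {h : ℕ → ℝ} (h1 : h 1 = 1) (hmul : ∀ m n : ℕ, Nat.Coprime m n → h (m * n) = h m * h n)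
    {r : ℕ} (hr : (r : ℝ) ≤ ∑ p ∈ P, h p / p) :
    |(A.map (fun a =>
        (((P.filter (fun p => p ∣ a)).card : ℝ) - ∑ p ∈ P, h p / p) ^ r)).sum -
          A.card * bernoulliCentralMoment (fun p => h p / (p : ℝ)) P r| ≤
      (∑ p ∈ P, h p / p) ^ r *
        ∑ Q ∈ (∏ p ∈ P, p).divisors.filter (fun Q => Q.primeFactors.card ≤ r),
          |((A.filter (fun a => Q ∣ a)).card : ℝ) - h Q / Q * A.card| := by
  have hμ : 0 ≤ ∑ p ∈ P, h p / p := (Nat.cast_nonneg r).trans hr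
  refine le_trans ?_ (mul_le_mul_of_nonneg_left
    (sum_powerset_prod_primes_le hP r fun Q => abs_nonneg _) (pow_nonneg hμ r))
  rw [sum_map_card_filter_sub_pow hP, bernoulliCentralMoment_eq_sum_powerset, Finset.mul_sum,
    Finset.mul_sum, ← Finset.sum_sub_distrib]
  refine (Finset.abs_sum_le_sum_abs _ _).trans (Finset.sum_le_sum fun T hT => ?_)
  obtain ⟨hTP, hTr⟩ := Finset.mem_filter.1 hT
  rw [multiplicative_div_prod_primes h1 hmul T fun p hp => hP p (Finset.mem_powerset.1 hTP hp),
    show ∀ c u y v : ℝ, c * u - y * (c * v) = c * (u - v * y) by intros; ring, abs_mul]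
  exact mul_le_mul_of_nonneg_right (abs_fwdDiff_iter_sub_pow_le hr hTr) (abs_nonneg _)

/-- (Granville–Soundararajan, odd moments; Lemma 3.10 of the paper.) There is an
absolute constant `K > 0` such that for any finite set `P` of primes, any multiset
`A` of `y` natural numbers, any nonnegative multiplicative `h` with `0 ≤ h Q ≤ Q`
for squarefree `Q`, and any odd `r` with `0 < r ≤ σ_P(h)^{2/3}`:
`|∑_{a ∈ A} (#{p ∈ P : p ∣ a} − μ_P(h))^r|
  ≤ K·(C_r·y·σ_P(h)^{r−1}·r^{3/2} + μ_P(h)^r·ℰ_P(A,h,r))`,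
where `μ_P(h) = ∑_{p∈P} h(p)/p`, `σ_P(h) = (∑_{p∈P} (h(p)/p)(1−h(p)/p))^{1/2}`,
`C_r = Γ(r+1)/(2^{r/2}Γ(1+r/2))`, and `ℰ_P(A,h,r)` is the sum of
`|A_Q − (h(Q)/Q)·y|` over squarefree `Q` composed of primes of `P` with
`ω(Q) ≤ r` (such `Q` are exactly the divisors of `∏_{p∈P} p`). -/
theorem granville_soundararajan_odd_moments :
    ∃ K : ℝ, 0 < K ∧
      ∀ (P : Finset ℕ), (∀ p ∈ P, p.Prime) →
      ∀ (A : Multiset ℕ) (h : ℕ → ℝ),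
        h 1 = 1 →
        (∀ m n : ℕ, Nat.Coprime m n → h (m * n) = h m * h n) →
        (∀ Q : ℕ, Squarefree Q → 0 ≤ h Q ∧ h Q ≤ Q) →
        ∀ r : ℕ, 0 < r → Odd r →
        (r : ℝ) ≤ (Real.sqrt (∑ p ∈ P, (h p / p) * (1 - h p / p))) ^ ((2 : ℝ) / 3) →
        |(A.map (fun a =>
              (((P.filter (fun p => p ∣ a)).card : ℝ) - ∑ p ∈ P, h p / p) ^ r)).sum| ≤
          K * ((Real.Gamma (r + 1) / (2 ^ ((r : ℝ) / 2) * Real.Gamma (1 + (r : ℝ) / 2))) *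
                A.card * Real.sqrt (∑ p ∈ P, (h p / p) * (1 - h p / p)) ^ (r - 1) *
                (r : ℝ) ^ ((3 : ℝ) / 2) +
              (∑ p ∈ P, h p / p) ^ r *
                ∑ Q ∈ (∏ p ∈ P, p).divisors.filter (fun Q => Q.primeFactors.card ≤ r),
                  |((A.filter (fun a => Q ∣ a)).card : ℝ) - h Q / Q * A.card|) := by
  refine ⟨2, by norm_num, fun P hP A h h1 hmul hb r hr0 hodd hrσ => ?_⟩
  have hx : ∀ p ∈ P, 0 ≤ h p / p ∧ h p / p ≤ 1 := fun p hp => by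
    have := hb p (hP p hp).prime.squarefree
    exact ⟨div_nonneg this.1 (Nat.cast_nonneg p), div_le_one_of_le₀ this.2 (Nat.cast_nonneg p)⟩
  set L := ∑ p ∈ P, (h p / p) * (1 - h p / p)
  have hL0 : 0 ≤ L :=
    Finset.sum_nonneg fun p hp => mul_nonneg (hx p hp).1 (by linarith [(hx p hp).2])
  have hr1 : (1 : ℝ) ≤ r := by exact_mod_cast hr0
  have hrL : (r : ℝ) ^ 3 ≤ L := by
    calc (r : ℝ) ^ 3 ≤ (√L ^ ((2 : ℝ) / 3)) ^ 3 := by gcongr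
      _ = √L ^ ((2 : ℝ) / 3 * (3 : ℕ)) := by rw [Real.rpow_mul (by positivity), Real.rpow_natCast]
      _ = √L ^ (2 : ℕ) := by rw [← Real.rpow_natCast]; norm_num
      _ = L := Real.sq_sqrt hL0
  have hLμ : L ≤ ∑ p ∈ P, h p / p := Finset.sum_le_sum fun p hp => by nlinarith [hx p hp]
  have hrμ : (r : ℝ) ≤ ∑ p ∈ P, h p / p := by
    have : (r : ℝ) ≤ (r : ℝ) ^ 3 := le_self_pow₀ hr1 (by norm_num)
    linarith
  have herr := abs_sum_map_sub_card_mul_le hP A h1 hmul hrμ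
  have hmain := (abs_bernoulliCentralMoment_le (x := fun p => h p / (p : ℝ)) hx hr1 hrL r le_rfl
    (Finset.Subset.refl P)).trans (centralMomentBound_odd_le hL0 hodd)
  have hmain' := mul_le_mul_of_nonneg_left hmain (Nat.cast_nonneg (α := ℝ) A.card)
  have htri := abs_sub_abs_le_abs_sub (A.map (fun a =>
    (((P.filter (fun p => p ∣ a)).card : ℝ) - ∑ p ∈ P, h p / p) ^ r)).sum
      (A.card * bernoulliCentralMoment (fun p => h p / (p : ℝ)) P r)
  rw [abs_mul, Nat.abs_cast] at htri
  have herr0 := (abs_nonneg _).trans herr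
  linarith
end
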